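/- Main technical proposition (Proposition 3.4): Let B ≥ 1 and suppose F⁺, F⁻, G, ω⁺, ω⁻, E⁺, E⁻, E ∈ L²(I_δ) satisfy: ‖F⁺‖_{C¹(I_{2√ε})} + ‖F⁻‖_{C¹(I_{2√ε})} + ‖G‖_{C¹(I_{2√ε})} + ‖ω⁺‖_{L∞(I_{2√ε})} + ‖ω⁻‖_{L∞(I_{2√ε})} ≤ B and ‖E⁺‖_Z + ‖E⁻‖_Z + sup{|∫_ℝ E·φ dα| : φ ∈ C₂ with supp φ ⊆ I_{√ε/8}} ≤ B·ε·log(1/ε); and suppose the following identities hold on I_{√ε}: F⁺ = T_{1,f}ω⁺ − T_{3,(f,g)}ω⁻ − (1/2)ω⁺ + E⁺; F⁻ = −T_{3,(g,f)}ω⁺ + T_{1,g}ω⁻ + (1/2)ω⁻ + E⁻; G = (T_{4,(g,f)} − T_{2,f})ω⁺ + (T_{4,(f,g)} − T_{2,g})ω⁻ + E. Then |G(0)| ≤ C·ε·log(1/ε) for a constant C depending only on A, δ and B. -/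

import Mathlib

noncomputable section
open Set MeasureTheory Filter Real

/-- The principal value at `α` of the integral `∫_ℝ F(β) dβ`, understood as the limit of the
integrals over `{β : r < |α − β|}` as `r → 0⁺`. -/
def pvI (F : ℝ → ℝ) (α : ℝ) : ℝ :=
  limUnder (nhdsWithin (0:ℝ) (Ioi 0)) (fun r => ∫ β in {β : ℝ | r < |α - β|}, F β)

/-- `ψ` is a smooth even cutoff, with values in `[0,1]`, supported in `[−1,1]`,
equal to `1` on `[−1/2,1/2]`. -/
def IsCutoff (ψ : ℝ → ℝ) : Prop :=
  ContDiff ℝ (⊤ : ℕ∞) ψ ∧ (∀ x : ℝ, ψ (-x) = ψ x) ∧ (∀ x : ℝ, ψ x ∈ Icc (0:ℝ) 1) ∧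
    (∀ x : ℝ, 1 < |x| → ψ x = 0) ∧ (∀ x : ℝ, |x| ≤ 1/2 → ψ x = 1)

/-- The rescaled cutoff `ψ_r(x) = ψ(x/r)`. -/
def scut (ψ : ℝ → ℝ) (r x : ℝ) : ℝ := ψ (x / r)

/-- `X̃(α) = 2ε + f(α) + g(α)`. -/
def Xt (ε : ℝ) (f g : ℝ → ℝ) (α : ℝ) : ℝ := 2 * ε + f α + g α

/-- The operator `T_{1,f}`. -/
def T1 (ψ : ℝ → ℝ) (ε : ℝ) (f : ℝ → ℝ) (h : ℝ → ℝ) (α : ℝ) : ℝ :=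
  (2 * π)⁻¹ * pvI (fun β =>
    (f α - f β) / ((α - β) ^ 2 + (f α - f β) ^ 2) * h β * scut ψ (Real.sqrt ε) (α - β)) α

/-- The operator `T_{2,f}`. -/
def T2 (ψ : ℝ → ℝ) (ε : ℝ) (f : ℝ → ℝ) (h : ℝ → ℝ) (α : ℝ) : ℝ :=
  (2 * π)⁻¹ * pvI (fun β =>
    (α - β) / ((α - β) ^ 2 + (f α - f β) ^ 2) * h β * scut ψ (Real.sqrt ε) (α - β)) α

/-- The operator `T_{3,(f,g)}`. -/
def T3 (ψ : ℝ → ℝ) (ε : ℝ) (f g : ℝ → ℝ) (h : ℝ → ℝ) (α : ℝ) : ℝ :=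
  (2 * π)⁻¹ * ∫ β : ℝ,
    (2 * ε + f α + g β) / ((α - β) ^ 2 + (2 * ε + f α + g β) ^ 2) * h β *
      scut ψ (Real.sqrt ε) (α - β)

/-- The operator `T_{4,(f,g)}`. -/
def T4 (ψ : ℝ → ℝ) (ε : ℝ) (f g : ℝ → ℝ) (h : ℝ → ℝ) (α : ℝ) : ℝ :=
  (2 * π)⁻¹ * ∫ β : ℝ,
    (α - β) / ((α - β) ^ 2 + (2 * ε + f α + g β) ^ 2) * h β * scut ψ (Real.sqrt ε) (α - β)

/-- The kernel of the operator `H`. -/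
def Hker (ψ : ℝ → ℝ) (ε : ℝ) (f g : ℝ → ℝ) (α β : ℝ) : ℝ :=
  (α - β)⁻¹ * ((Xt ε f g α) ^ 2 / ((α - β) ^ 2 + (Xt ε f g α) ^ 2)) *
    scut ψ (Real.sqrt ε / 2 ^ 6) α * scut ψ (Real.sqrt ε / 2 ^ 6) (α - β)

/-- The kernel of the operator `M`. -/
def Mker (ψ : ℝ → ℝ) (ε : ℝ) (f g : ℝ → ℝ) (α β : ℝ) : ℝ :=
  (Xt ε f g α) / ((α - β) ^ 2 + (Xt ε f g α) ^ 2) *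
    scut ψ (Real.sqrt ε / 2 ^ 6) α * scut ψ (Real.sqrt ε / 2 ^ 6) (α - β)

/-- The operator `H` (a principal value integral in the second variable of the kernel). -/
def Hop (ψ : ℝ → ℝ) (ε : ℝ) (f g : ℝ → ℝ) (h : ℝ → ℝ) (α : ℝ) : ℝ :=
  (2 * π)⁻¹ * pvI (fun β => Hker ψ ε f g α β * h β) α

/-- The adjoint operator `H*` (integration of the kernel of `H` in its first variable). -/
def Hstar (ψ : ℝ → ℝ) (ε : ℝ) (f g : ℝ → ℝ) (φ : ℝ → ℝ) (β : ℝ) : ℝ :=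
  (2 * π)⁻¹ * pvI (fun α => Hker ψ ε f g α β * φ α) β

/-- The operator `M`. -/
def Mop (ψ : ℝ → ℝ) (ε : ℝ) (f g : ℝ → ℝ) (h : ℝ → ℝ) (α : ℝ) : ℝ :=
  (2 * π)⁻¹ * ∫ β : ℝ, Mker ψ ε f g α β * h β

/-- The adjoint operator `M*` (integration of the kernel of `M` in its first variable). -/
def Mstar (ψ : ℝ → ℝ) (ε : ℝ) (f g : ℝ → ℝ) (φ : ℝ → ℝ) (β : ℝ) : ℝ :=
  (2 * π)⁻¹ * ∫ α : ℝ, Mker ψ ε f g α β * φ α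

/-- The class `C₂` of test functions: `C¹` functions compactly supported in `I_δ = (−δ,δ)` with
`|φ⁽ᵏ⁾(α)| ≤ ε/(ε^{2+k} + |α|^{2+k})` on `I_δ` for `k ∈ {0,1}`. -/
def InC2 (δ ε : ℝ) (φ : ℝ → ℝ) : Prop :=
  ContDiff ℝ 1 φ ∧ HasCompactSupport φ ∧ tsupport φ ⊆ Ioo (-δ) δ ∧
    ∀ α ∈ Ioo (-δ) δ,
      |φ α| ≤ ε / (ε ^ 2 + |α| ^ 2) ∧ |deriv φ α| ≤ ε / (ε ^ 3 + |α| ^ 3)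

/-- The standing hypotheses on `f, g : (−δ,δ) → ℝ`: they are `C⁵`, with
`‖f‖_{C³} + ‖g‖_{C³} ≤ A`, `f(0) = f'(0) = g(0) = g'(0) = 0`, and
`f(α) + g(β) ≥ −ε` for `α, β ∈ (−4√ε, 4√ε)`. -/
def GoodFG (δ A ε : ℝ) (f g : ℝ → ℝ) : Prop :=
  ContDiffOn ℝ 5 f (Ioo (-δ) δ) ∧ ContDiffOn ℝ 5 g (Ioo (-δ) δ) ∧
    f 0 = 0 ∧ g 0 = 0 ∧
    derivWithin f (Ioo (-δ) δ) 0 = 0 ∧ derivWithin g (Ioo (-δ) δ) 0 = 0 ∧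
    (∀ x ∈ Ioo (-δ) δ, ∀ i : ℕ, i ≤ 3 →
      |iteratedDerivWithin i f (Ioo (-δ) δ) x| + |iteratedDerivWithin i g (Ioo (-δ) δ) x| ≤ A) ∧
    (∀ α ∈ Ioo (-(4 * Real.sqrt ε)) (4 * Real.sqrt ε),
      ∀ β ∈ Ioo (-(4 * Real.sqrt ε)) (4 * Real.sqrt ε), -ε ≤ f α + g β)


section
def PK (c x : ℝ) : ℝ := c / (x ^ 2 + c ^ 2)
def QK (c x : ℝ) : ℝ := x / (x ^ 2 + c ^ 2)

lemma den_pos {c : ℝ} (hc : 0 < c) (x : ℝ) : 0 < x ^ 2 + c ^ 2 := by positivity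

lemma measurable_PK (c : ℝ) : Measurable (PK c) := by unfold PK; fun_prop
lemma measurable_QK (c : ℝ) : Measurable (QK c) := by unfold QK; fun_prop

lemma QK_neg (c x : ℝ) : QK c (-x) = -QK c x := by unfold QK; rw [neg_sq, neg_div]
lemma PK_neg (c x : ℝ) : PK c (-x) = PK c x := by unfold PK; rw [neg_sq]
lemma PK_nonneg {c : ℝ} (hc : 0 < c) (x : ℝ) : 0 ≤ PK c x := by unfold PK; positivity

lemma PK_eq {c : ℝ} (hc : 0 < c) : PK c = fun x => c⁻¹ * (1 + (x / c) ^ 2)⁻¹ := by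
  funext x; unfold PK
  have := den_pos hc x
  field_simp
  ring

lemma integrable_PK {c : ℝ} (hc : 0 < c) : Integrable (PK c) := by
  rw [PK_eq hc]
  exact (integrable_inv_one_add_sq.comp_div hc.ne').const_mul _

lemma integral_PK {c : ℝ} (hc : 0 < c) : ∫ x, PK c x = π := by
  rw [PK_eq hc, integral_const_mul,
    MeasureTheory.Measure.integral_comp_div (fun y : ℝ => (1 + y ^ 2)⁻¹) c,
    integral_univ_inv_one_add_sq, abs_of_pos hc, smul_eq_mul]
  field_simp

lemma QK_sq_le {c : ℝ} (hc : 0 < c) (x : ℝ) : QK c x ^ 2 ≤ c⁻¹ * PK c x := by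
  unfold QK PK
  have := den_pos hc x
  rw [div_pow, div_le_iff₀ (by positivity)]
  have : c⁻¹ * (c / (x ^ 2 + c ^ 2)) * (x ^ 2 + c ^ 2) ^ 2 = x ^ 2 + c ^ 2 := by
    field_simp
  rw [this]; nlinarith

lemma abs_QK_le {c : ℝ} (hc : 0 < c) (x : ℝ) : |QK c x| ≤ c⁻¹ := by
  unfold QK
  have := den_pos hc x
  rw [abs_div, abs_of_pos this, div_le_iff₀ this, inv_mul_eq_div, le_div_iff₀ hc]
  nlinarith [sq_abs x, sq_nonneg (|x| - c), abs_nonneg x, sq_nonneg |x|]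

lemma PK_le {c : ℝ} (hc : 0 < c) (x : ℝ) : PK c x ≤ c⁻¹ := by
  unfold PK
  have := den_pos hc x
  rw [div_le_iff₀ this, inv_mul_eq_div, le_div_iff₀ hc]
  nlinarith [sq_nonneg x]

lemma integrable_QK_sq {c : ℝ} (hc : 0 < c) : Integrable (fun x => QK c x ^ 2) := by
  refine ((integrable_PK hc).const_mul c⁻¹).mono' ((measurable_QK c).pow_const 2).aestronglyMeasurable ?_
  filter_upwards with x
  rw [Real.norm_eq_abs, abs_of_nonneg (sq_nonneg _)]
  exact QK_sq_le hc x

lemma integrable_QQ {a b : ℝ} (ha : 0 < a) (hb : 0 < b) (t : ℝ) :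
    Integrable (fun x => QK a (x - t) * QK b x) := by
  refine (((integrable_QK_sq ha).comp_sub_right t).add (integrable_QK_sq hb)).mono'
    (((measurable_QK a).comp (measurable_id.sub_const t)).mul (measurable_QK b)).aestronglyMeasurable ?_
  filter_upwards with x
  rw [Real.norm_eq_abs, abs_le]
  simp only [Pi.add_apply]
  constructor <;> nlinarith [sq_nonneg (QK a (x-t) + QK b x), sq_nonneg (QK a (x-t) - QK b x)]

lemma integrable_PQ {a b : ℝ} (ha : 0 < a) (hb : 0 < b) (t : ℝ) :
    Integrable (fun x => PK a (x - t) * QK b x) := by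
  refine (((integrable_PK ha).comp_sub_right t).mul_const b⁻¹).mono'
    (((measurable_PK a).comp (measurable_id.sub_const t)).mul (measurable_QK b)).aestronglyMeasurable ?_
  filter_upwards with x
  rw [norm_mul, Real.norm_eq_abs, Real.norm_eq_abs, abs_of_nonneg (PK_nonneg ha _)]
  exact mul_le_mul_of_nonneg_left (abs_QK_le hb x) (PK_nonneg ha _)

lemma QQ_formula {a b t : ℝ} (ha : 0 < a) (hb : 0 < b) (ht : t ≠ 0) (x : ℝ) :
    QK a (x - t) * QK b x =
      (t / (t ^ 2 + (a - b) ^ 2) + t / (t ^ 2 + (a + b) ^ 2)) / 2 * (QK a (x - t) - QK b x)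
      + ((a - b) / (t ^ 2 + (a - b) ^ 2) + (a + b) / (t ^ 2 + (a + b) ^ 2)) / 2 * PK a (x - t)
      + ((b - a) / (t ^ 2 + (a - b) ^ 2) + (a + b) / (t ^ 2 + (a + b) ^ 2)) / 2 * PK b x := by
  unfold QK PK
  have h1 := (den_pos ha (x - t)).ne'
  have h2 := (den_pos hb x).ne'
  have h3 : t ^ 2 + (a - b) ^ 2 ≠ 0 := by positivity
  have h4 : t ^ 2 + (a + b) ^ 2 ≠ 0 := by positivity
  field_simp
  ring

lemma PQ_formula {a b t : ℝ} (ha : 0 < a) (hb : 0 < b) (ht : t ≠ 0) (x : ℝ) :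
    PK a (x - t) * QK b x =
      -((a - b) / (t ^ 2 + (a - b) ^ 2) + (a + b) / (t ^ 2 + (a + b) ^ 2)) / 2 * (QK a (x - t) - QK b x)
      + (t / (t ^ 2 + (a - b) ^ 2) + t / (t ^ 2 + (a + b) ^ 2)) / 2 * PK a (x - t)
      + (-t / (t ^ 2 + (a - b) ^ 2) + t / (t ^ 2 + (a + b) ^ 2)) / 2 * PK b x := by
  unfold QK PK
  have h1 := (den_pos ha (x - t)).ne'
  have h2 := (den_pos hb x).ne'
  have h3 : t ^ 2 + (a - b) ^ 2 ≠ 0 := by positivity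
  have h4 : t ^ 2 + (a + b) ^ 2 ≠ 0 := by positivity
  field_simp
  ring

lemma integrable_Qdiff {a b t : ℝ} (ha : 0 < a) (hb : 0 < b) (ht : t ≠ 0) :
    Integrable (fun x => QK a (x - t) - QK b x) := by
  set m := (t / (t ^ 2 + (a - b) ^ 2) + t / (t ^ 2 + (a + b) ^ 2)) / 2 with hm
  have hm0 : m ≠ 0 := by
    have : m = t * ((1 / (t ^ 2 + (a - b) ^ 2) + 1 / (t ^ 2 + (a + b) ^ 2)) / 2) := by
      rw [hm]; ring
    rw [this]
    have : 0 < 1 / (t ^ 2 + (a - b) ^ 2) + 1 / (t ^ 2 + (a + b) ^ 2) := by positivity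
    positivity
  have key : (fun x => QK a (x - t) - QK b x) = fun x => m⁻¹ * (QK a (x - t) * QK b x
      - ((a - b) / (t ^ 2 + (a - b) ^ 2) + (a + b) / (t ^ 2 + (a + b) ^ 2)) / 2 * PK a (x - t)
      - ((b - a) / (t ^ 2 + (a - b) ^ 2) + (a + b) / (t ^ 2 + (a + b) ^ 2)) / 2 * PK b x) := by
    funext x
    rw [QQ_formula ha hb ht x, ← hm]
    field_simp
    ring
  rw [key]
  exact (((integrable_QQ ha hb t).sub (((integrable_PK ha).comp_sub_right t).const_mul _)).sub
    ((integrable_PK hb).const_mul _)).const_mul _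

lemma integral_Qdiff {a b t : ℝ} (ha : 0 < a) (hb : 0 < b) (ht : t ≠ 0) :
    ∫ x, (QK a (x - t) - QK b x) = 0 := by
  have hd : ∀ x, HasDerivAt (fun x => (1/2) * Real.log ((x - t) ^ 2 + a ^ 2) -
      (1/2) * Real.log (x ^ 2 + b ^ 2)) (QK a (x - t) - QK b x) x := by
    intro x
    have h1 := den_pos ha (x - t)
    have h2 := den_pos hb x
    have e1 : HasDerivAt (fun x : ℝ => (x - t) ^ 2 + a ^ 2) (2 * (x - t)) x := by
      have := (((hasDerivAt_id x).sub_const t).pow 2).add_const (a ^ 2)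
      simpa using this
    have e2 : HasDerivAt (fun x : ℝ => x ^ 2 + b ^ 2) (2 * x) x := by
      have := (((hasDerivAt_id x)).pow 2).add_const (b ^ 2)
      simpa using this
    have := ((e1.log h1.ne').const_mul (1/2 : ℝ)).sub ((e2.log h2.ne').const_mul (1/2 : ℝ))
    refine this.congr_deriv ?_
    unfold QK
    field_simp
  have hlim : ∀ l : Filter ℝ, Tendsto (fun x : ℝ => x⁻¹) l (nhds 0) → (∀ᶠ x in l, x ≠ 0) →
      Tendsto (fun x => (1/2) * Real.log ((x - t) ^ 2 + a ^ 2) -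
      (1/2) * Real.log (x ^ 2 + b ^ 2)) l (nhds 0) := by
    intro l hl hne
    have h1 : Tendsto (fun x : ℝ => (1/2) * Real.log (((1 - t * x⁻¹) ^ 2 + a ^ 2 * (x⁻¹) ^ 2) /
        (1 + b ^ 2 * (x⁻¹) ^ 2))) l (nhds ((1/2) * Real.log (((1 - t * 0) ^ 2 + a ^ 2 * 0 ^ 2) /
        (1 + b ^ 2 * 0 ^ 2)))) := by
      refine Tendsto.const_mul _ (Tendsto.log ?_ (by norm_num))
      refine Tendsto.div ?_ ?_ (by norm_num)
      · exact ((hl.const_mul t).const_sub 1 |>.pow 2).add ((hl.pow 2).const_mul _)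
      · exact ((hl.pow 2).const_mul _).const_add 1
    have e0 : (1/2) * Real.log (((1 - t * 0) ^ 2 + a ^ 2 * 0 ^ 2) / (1 + b ^ 2 * 0 ^ 2)) = 0 := by
      norm_num
    rw [e0] at h1
    refine h1.congr' ?_
    filter_upwards [hne] with x hx
    have p1 := den_pos ha (x - t)
    have p2 := den_pos hb x
    rw [← mul_sub, ← Real.log_div p1.ne' p2.ne']
    congr 2
    field_simp
  have := integral_of_hasDerivAt_of_tendsto hd (integrable_Qdiff ha hb ht)
    (hlim atBot tendsto_inv_atBot_zero (eventually_ne_atBot 0))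
    (hlim atTop tendsto_inv_atTop_zero (eventually_ne_atTop 0))
  simpa using this

lemma integral_QQ {a b t : ℝ} (ha : 0 < a) (hb : 0 < b) (ht : t ≠ 0) :
    ∫ x, QK a (x - t) * QK b x = π * PK (a + b) t := by
  have hP : ∫ x, PK a (x - t) = π := by
    rw [integral_sub_right_eq_self (PK a) t, integral_PK ha]
  simp_rw [QQ_formula ha hb ht]
  rw [integral_add, integral_add, integral_const_mul, integral_const_mul, integral_const_mul,
    integral_Qdiff ha hb ht, hP, integral_PK hb]
  · unfold PK; ring
  · exact (integrable_Qdiff ha hb ht).const_mul _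
  · exact ((integrable_PK ha).comp_sub_right t).const_mul _
  · exact ((integrable_Qdiff ha hb ht).const_mul _).add
      (((integrable_PK ha).comp_sub_right t).const_mul _)
  · exact (integrable_PK hb).const_mul _

lemma integral_PQ {a b t : ℝ} (ha : 0 < a) (hb : 0 < b) (ht : t ≠ 0) :
    ∫ x, PK a (x - t) * QK b x = π * QK (a + b) t := by
  have hP : ∫ x, PK a (x - t) = π := by
    rw [integral_sub_right_eq_self (PK a) t, integral_PK ha]
  simp_rw [PQ_formula ha hb ht]
  rw [integral_add, integral_add, integral_const_mul, integral_const_mul, integral_const_mul,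
    integral_Qdiff ha hb ht, hP, integral_PK hb]
  · unfold QK; ring
  · exact (integrable_Qdiff ha hb ht).const_mul _
  · exact ((integrable_PK ha).comp_sub_right t).const_mul _
  · exact ((integrable_Qdiff ha hb ht).const_mul _).add
      (((integrable_PK ha).comp_sub_right t).const_mul _)
  · exact (integrable_PK hb).const_mul _

end


section
open scoped ENNReal Topology

def LebPt (u : ℝ → ℝ) (α : ℝ) : Prop :=
  ∀ η : ℝ, 0 < η → ∃ y0 : ℝ, 0 < y0 ∧ ∀ y : ℝ, 0 < y → y ≤ y0 →
    ∫⁻ t in Metric.closedBall α y, ‖u t - u α‖ₑ ≤ ENNReal.ofReal (η * y)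

lemma lebPt_ae {u : ℝ → ℝ} (hu : LocallyIntegrable u) : ∀ᵐ α, LebPt u α := by
  filter_upwards [(Besicovitch.vitaliFamily (volume : Measure ℝ)).ae_tendsto_lintegral_enorm_sub_div hu]
    with α hα η hη
  have h := hα.comp (Besicovitch.tendsto_filterAt volume α)
  have h2 : ∀ᶠ r in 𝓝[>] (0:ℝ), (∫⁻ t in Metric.closedBall α r, ‖u t - u α‖ₑ) /
      volume (Metric.closedBall α r) < ENNReal.ofReal (η / 2) :=
    h.eventually (gt_mem_nhds (by simpa using half_pos hη))
  obtain ⟨y0, hy0, H⟩ := (mem_nhdsGT_iff_exists_Ioc_subset).1 h2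
  refine ⟨y0, hy0, fun y hy hy' => ?_⟩
  have := H ⟨hy, hy'⟩
  simp only [Set.mem_ofPred_eq] at this
  rw [Real.volume_closedBall] at this
  have h3 : ENNReal.ofReal (2 * y) ≠ 0 := by simpa using by linarith
  have := (ENNReal.div_lt_iff (Or.inl h3) (Or.inl ENNReal.ofReal_ne_top)).1 this
  refine this.le.trans ?_
  rw [← ENNReal.ofReal_mul (by positivity)]
  apply ENNReal.ofReal_le_ofReal; linarith

lemma lebPt_of_continuousAt {u : ℝ → ℝ} {α : ℝ} (hu : ContinuousAt u α) : LebPt u α := by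
  intro η hη
  obtain ⟨d, hd, H⟩ := Metric.continuousAt_iff.1 hu (η / 2) (half_pos hη)
  refine ⟨d / 2, half_pos hd, fun y hy hy' => ?_⟩
  have : ∫⁻ t in Metric.closedBall α y, ‖u t - u α‖ₑ ≤
      ∫⁻ t in Metric.closedBall α y, ENNReal.ofReal (η / 2) := by
    apply setLIntegral_mono measurable_const
    intro t ht
    rw [← ofReal_norm]
    apply ENNReal.ofReal_le_ofReal
    have := @H t (by rw [Metric.mem_closedBall] at ht; linarith)
    rw [Real.dist_eq] at this
    exact this.le
  refine this.trans ?_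
  rw [setLIntegral_const, Real.volume_closedBall, ← ENNReal.ofReal_mul (by positivity)]
  apply ENNReal.ofReal_le_ofReal; linarith

lemma PK_layer {a : ℝ} (ha : 0 < a) (x : ℝ) :
    ENNReal.ofReal (PK a x) = ∫⁻ y in Ioi |x|, ENNReal.ofReal (2 * a * y / (y ^ 2 + a ^ 2) ^ 2) := by
  have hd : ∀ y ∈ Ici |x|, HasDerivAt (fun y => - PK a y) (2 * a * y / (y ^ 2 + a ^ 2) ^ 2) y := by
    intro y _
    unfold PK
    have h0 := den_pos ha y
    have : HasDerivAt (fun y : ℝ => -(a / (y ^ 2 + a ^ 2))) _ y :=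
      ((hasDerivAt_const y a).div (((hasDerivAt_id y).pow 2).add_const (a ^ 2)) h0.ne').neg
    refine this.congr_deriv ?_
    simp; ring
  have hn : ∀ y ∈ Ioi |x|, 0 ≤ 2 * a * y / (y ^ 2 + a ^ 2) ^ 2 := by
    intro y hy
    have : 0 < y := (abs_nonneg x).trans_lt hy
    positivity
  have hl : Tendsto (fun y => - PK a y) atTop (𝓝 0) := by
    have : Tendsto (PK a) atTop (𝓝 0) := by
      unfold PK
      apply Tendsto.div_atTop tendsto_const_nhds
      exact tendsto_atTop_add_const_right _ _ (tendsto_pow_atTop two_ne_zero)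
    simpa using this.neg
  have h1 := integral_Ioi_of_hasDerivAt_of_nonneg' hd hn hl
  have h2 := integrableOn_Ioi_deriv_of_nonneg' hd hn hl
  rw [← ofReal_integral_eq_lintegral_ofReal h2, h1]
  · congr 1
    unfold PK; rw [sq_abs]; ring
  · exact (ae_restrict_iff' measurableSet_Ioi).2 (Eventually.of_forall hn)

lemma near_bound {a y0 η α : ℝ} (ha : 0 < a) (hy0 : 0 < y0) (hη : 0 < η) {W : ℝ → ℝ≥0∞}
    (hW : Measurable W) (h : ∀ y : ℝ, 0 < y → y ≤ y0 →
      ∫⁻ t in Metric.closedBall α y, W t ≤ ENNReal.ofReal (η * y)) :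
    ∫⁻ t in Metric.closedBall α y0, ENNReal.ofReal (PK a (α - t)) * W t ≤
      ENNReal.ofReal (2 * π * η) := by
  set k : ℝ → ℝ≥0∞ := fun y => ENNReal.ofReal (2 * a * y / (y ^ 2 + a ^ 2) ^ 2) with hk
  have hkm : Measurable k := by rw [hk]; fun_prop
  have e1 : ∀ t, ENNReal.ofReal (PK a (α - t)) * W t =
      ∫⁻ y in Ioi (0:ℝ), (if |α - t| < y then k y * W t else 0) := by
    intro t
    rw [PK_layer ha, ← lintegral_mul_const _ (by fun_prop),
      ← lintegral_indicator measurableSet_Ioi, ← lintegral_indicator measurableSet_Ioi]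
    congr 1; ext y
    by_cases hy : |α - t| < y
    · have : 0 < y := (abs_nonneg _).trans_lt hy
      rw [Set.indicator_of_mem (by exact hy), Set.indicator_of_mem (by exact this), if_pos hy]
    · rw [Set.indicator_of_notMem (by simpa using hy)]
      by_cases h0 : 0 < y
      · rw [Set.indicator_of_mem (by exact h0), if_neg hy]
      · rw [Set.indicator_of_notMem (by simpa using h0)]
  simp_rw [e1]
  rw [lintegral_lintegral_swap]
  swap
  · apply Measurable.aemeasurable
    apply Measurable.ite
    · exact measurableSet_lt (by fun_prop) (by fun_prop)
    · fun_prop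
    · fun_prop
  have e2 : ∀ y ∈ Ioi (0:ℝ), (∫⁻ t in Metric.closedBall α y0, (if |α - t| < y then k y * W t else 0)) ≤
      ENNReal.ofReal (2 * η * PK a y) := by
    intro y hy
    have hy : 0 < y := hy
    have hle : (∫⁻ t in Metric.closedBall α y0, (if |α - t| < y then k y * W t else 0)) ≤
        ∫⁻ t in Metric.closedBall α (min y y0), k y * W t := by
      rw [← lintegral_indicator Metric.isClosed_closedBall.measurableSet,
        ← lintegral_indicator Metric.isClosed_closedBall.measurableSet]
      apply lintegral_mono
      intro t
      by_cases h1 : t ∈ Metric.closedBall α y0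
      · rw [Set.indicator_of_mem h1]
        split_ifs with h2
        · rw [Set.indicator_of_mem]
          rw [Metric.mem_closedBall, Real.dist_eq] at *
          rw [abs_sub_comm] at h2
          exact le_min h2.le h1
        · exact bot_le
      · rw [Set.indicator_of_notMem h1]; exact bot_le
    refine hle.trans ?_
    rw [lintegral_const_mul _ hW]
    refine (mul_le_mul_right (h _ (lt_min hy hy0) (min_le_right _ _)) (k y)).trans ?_
    rw [hk, ← ENNReal.ofReal_mul (by positivity)]
    apply ENNReal.ofReal_le_ofReal
    have h0 := den_pos ha y
    unfold PK
    have : 2 * a * y / (y ^ 2 + a ^ 2) ^ 2 * (η * min y y0) ≤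
        2 * a * y / (y ^ 2 + a ^ 2) ^ 2 * (η * y) := by
      gcongr; exact min_le_left _ _
    refine this.trans ?_
    rw [div_mul_eq_mul_div, ← mul_div_assoc, div_le_div_iff₀ (by positivity) h0]
    have : 0 ≤ η * a * (y^2 + a^2) * a ^ 2 := by positivity
    nlinarith
  refine (setLIntegral_mono (by unfold PK; fun_prop) e2).trans ?_
  refine (setLIntegral_le_lintegral _ _).trans ?_
  rw [← ofReal_integral_eq_lintegral_ofReal ((integrable_PK ha).const_mul _)
    (Eventually.of_forall fun y => by have := PK_nonneg ha y; simp only [Pi.zero_apply]; positivity),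
    integral_const_mul, integral_PK ha]
  apply ENNReal.ofReal_le_ofReal; linarith

lemma LP {u : ℝ → ℝ} (hu : Measurable u) (hi : Integrable (fun t => u t * PK 1 t)) {α : ℝ}
    (hL : LebPt u α) :
    Tendsto (fun a => ∫⁻ t, ENNReal.ofReal (PK a (α - t)) * ‖u t - u α‖ₑ) (𝓝[>] 0) (𝓝 0) := by
  have hi2 : Integrable (fun t => PK 1 t * (u t - u α)) := by
    have := hi.sub ((integrable_PK one_pos).mul_const (u α))
    refine this.congr (Eventually.of_forall fun t => ?_)
    simp only [Pi.sub_apply]; ring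
  set I := ∫⁻ t, ‖PK 1 t * (u t - u α)‖ₑ with hI
  have hIfin : I ≠ ∞ := hi2.2.ne
  rw [ENNReal.tendsto_nhds_zero]
  intro e he
  obtain ⟨e', he'0, he'⟩ : ∃ e' : ℝ, 0 < e' ∧ ENNReal.ofReal e' ≤ e := by
    rcases eq_or_ne e ∞ with h | h
    · exact ⟨1, one_pos, by rw [h]; exact le_top⟩
    · exact ⟨e.toReal, ENNReal.toReal_pos he.ne' h, by rw [ENNReal.ofReal_toReal h]⟩
  obtain ⟨y0, hy0, H⟩ := hL (e' / (4 * π)) (by positivity)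
  set C := (1 + 2 * α ^ 2) / y0 ^ 2 + 2 with hC
  have hCpos : 0 < C := by positivity
  have hev : ∀ᶠ a in 𝓝[>] (0:ℝ), a < e' / (2 * (C * I.toReal + 1)) :=
    mem_nhdsWithin_of_mem_nhds (gt_mem_nhds (by positivity))
  filter_upwards [self_mem_nhdsWithin, hev] with a ha ha2
  have ha : 0 < a := ha
  rw [← lintegral_add_compl _ (Metric.isClosed_closedBall (x := α) (ε := y0)).measurableSet]
  have n1 := near_bound (α := α) ha hy0 (η := e' / (4 * π)) (by positivity)
    (W := fun t => ‖u t - u α‖ₑ) (by fun_prop) H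
  have n2 : ∫⁻ t in (Metric.closedBall α y0)ᶜ, ENNReal.ofReal (PK a (α - t)) * ‖u t - u α‖ₑ ≤
      ENNReal.ofReal (a * C) * I := by
    rw [hI, ← lintegral_const_mul _ (by unfold PK; fun_prop)]
    refine le_trans ?_ (setLIntegral_le_lintegral (Metric.closedBall α y0)ᶜ _)
    apply setLIntegral_mono (by unfold PK; fun_prop)
    intro t ht
    rw [enorm_mul, ← mul_assoc, ← ofReal_norm (PK 1 t), ← ENNReal.ofReal_mul (by positivity),
      Real.norm_eq_abs, abs_of_nonneg (PK_nonneg one_pos _)]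
    gcongr
    simp only [Metric.mem_closedBall, Set.mem_compl_iff, not_le, Real.dist_eq] at ht
    have h1 : y0 ^ 2 < (α - t) ^ 2 := by
      rw [← sq_abs (α - t), abs_sub_comm]; gcongr
    have h2 : 0 < (α - t) ^ 2 := (by positivity : 0 < y0 ^ 2).trans h1
    unfold PK
    rw [one_pow, mul_one_div, mul_div_assoc, div_eq_mul_one_div]
    apply mul_le_mul_of_nonneg_left _ ha.le
    rw [div_le_div_iff₀ (by positivity) (by positivity), hC]
    have h3 : (1 + 2 * α ^ 2) / y0 ^ 2 * y0 ^ 2 = 1 + 2 * α ^ 2 := by field_simp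
    have h4 : (1 + 2 * α ^ 2) / y0 ^ 2 * y0 ^ 2 ≤ (1 + 2 * α ^ 2) / y0 ^ 2 * (α - t) ^ 2 := by gcongr
    have h5 : 0 ≤ (1 + 2 * α ^ 2) / y0 ^ 2 := by positivity
    nlinarith [sq_nonneg (2 * α - t), mul_nonneg h5 (sq_nonneg a)]
  refine (add_le_add n1 n2).trans (le_trans ?_ he')
  rw [← ENNReal.ofReal_toReal hIfin, ← ENNReal.ofReal_mul (by positivity),
    ← ENNReal.ofReal_add (by positivity) (by positivity)]
  apply ENNReal.ofReal_le_ofReal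
  have h6 : 2 * π * (e' / (4 * π)) = e' / 2 := by field_simp; ring
  have h7 : 0 ≤ I.toReal := ENNReal.toReal_nonneg
  rw [lt_div_iff₀ (by positivity)] at ha2
  nlinarith

lemma integrable_shift_PK {u : ℝ → ℝ} (hu : Measurable u) (hi : Integrable (fun t => u t * PK 1 t))
    {a : ℝ} (ha : 0 < a) (α : ℝ) : Integrable (fun t => PK a (α - t) * u t) := by
  refine (hi.norm.const_mul (a * (2 + (1 + 2 * α ^ 2) / a ^ 2))).mono' ?_ ?_
  · exact (by unfold PK; fun_prop : Measurable fun t => PK a (α - t) * u t).aestronglyMeasurable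
  · filter_upwards with t
    rw [norm_mul, norm_mul, mul_comm ‖u t‖, ← mul_assoc]
    gcongr
    rw [Real.norm_eq_abs, Real.norm_eq_abs, abs_of_nonneg (PK_nonneg ha _),
      abs_of_nonneg (PK_nonneg one_pos _)]
    unfold PK
    rw [one_pow, mul_one_div, mul_div_assoc, div_eq_mul_one_div]
    apply mul_le_mul_of_nonneg_left _ ha.le
    rw [div_le_div_iff₀ (by positivity) (by positivity)]
    have h3 : (1 + 2 * α ^ 2) / a ^ 2 * a ^ 2 = 1 + 2 * α ^ 2 := by field_simp
    have h5 : 0 ≤ (1 + 2 * α ^ 2) / a ^ 2 := by positivity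
    nlinarith [sq_nonneg (2 * α - t), mul_nonneg h5 (sq_nonneg (α - t)), sq_nonneg a]

lemma LPK {u : ℝ → ℝ} (hu : Measurable u) (hi : Integrable (fun t => u t * PK 1 t)) {α : ℝ}
    (hL : LebPt u α) {E : ℝ → ℝ → ℝ} {c : ℝ} (hE : ∀ a, Measurable (E a))
    (hb : ∀ a, 0 < a → ∀ x, |E a x| ≤ c * PK a x) :
    Tendsto (fun a => (∫ t, E a (α - t) * u t) - u α * ∫ x, E a x) (𝓝[>] 0) (𝓝 0) := by
  have h0 := ENNReal.Tendsto.const_mul (a := ENNReal.ofReal c) (LP hu hi hL) (Or.inr ENNReal.ofReal_ne_top)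
  rw [mul_zero] at h0
  rw [tendsto_zero_iff_enorm_tendsto_zero]
  refine tendsto_of_tendsto_of_tendsto_of_le_of_le' tendsto_const_nhds h0
    (Eventually.of_forall fun _ => bot_le) ?_
  filter_upwards [self_mem_nhdsWithin] with a ha
  have ha : 0 < a := ha
  have hc : 0 ≤ c := by
    have := (abs_nonneg _).trans (hb a ha 0)
    have h2 : 0 < PK a 0 := by unfold PK; positivity
    by_contra h; push Not at h; nlinarith
  have i1 : Integrable (fun t => E a (α - t) * u t) := by
    refine ((integrable_shift_PK hu hi ha α).norm.const_mul c).mono' ?_ ?_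
    · exact (((hE a).comp (measurable_const.sub measurable_id)).mul hu).aestronglyMeasurable
    · filter_upwards with t
      rw [norm_mul, norm_mul, ← mul_assoc]
      gcongr
      rw [Real.norm_eq_abs, Real.norm_eq_abs, abs_of_nonneg (PK_nonneg ha _)]
      exact hb a ha _
  have i2 : Integrable (fun t => E a (α - t)) := by
    have : Integrable (E a) := ((integrable_PK ha).const_mul c).mono' (hE a).aestronglyMeasurable
      (Eventually.of_forall (hb a ha))
    exact this.comp_sub_left α
  have e1 : (∫ t, E a (α - t) * u t) - u α * ∫ x, E a x = ∫ t, E a (α - t) * (u t - u α) := by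
    rw [← integral_sub_left_eq_self (E a) volume α, ← integral_const_mul,
      ← integral_sub i1 (i2.const_mul _)]
    congr 1; ext t; ring
  rw [e1]
  refine (enorm_integral_le_lintegral_enorm _).trans ?_
  rw [← lintegral_const_mul _ (by unfold PK; fun_prop)]
  apply lintegral_mono
  intro t
  simp only
  rw [enorm_mul, ← mul_assoc, ← ofReal_norm, ← ENNReal.ofReal_mul hc]
  gcongr
  exact hb a ha _

lemma LP_poisson {u : ℝ → ℝ} (hu : Measurable u) (hi : Integrable (fun t => u t * PK 1 t)) {α : ℝ}
    (hL : LebPt u α) :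
    Tendsto (fun a => ∫ t, PK a (α - t) * u t) (𝓝[>] 0) (𝓝 (π * u α)) := by
  have h := LPK hu hi hL (E := PK) (c := 1) measurable_PK
    (fun a ha x => by rw [one_mul, abs_of_nonneg (PK_nonneg ha x)])
  have h2 := h.add_const (u α * π)
  rw [zero_add, mul_comm] at h2
  refine h2.congr' ?_
  filter_upwards [self_mem_nhdsWithin] with a ha
  rw [integral_PK ha]; ring

/-- the truncated Hilbert transform compares with the conjugate Poisson integral -/
lemma LP_trunc {u : ℝ → ℝ} (hu : Measurable u) (hi : Integrable (fun t => u t * PK 1 t))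
    (hi2 : ∀ a, 0 < a → ∀ α, Integrable (fun t => QK a (α - t) * u t)) {α : ℝ}
    (hL : LebPt u α) :
    Tendsto (fun a => (∫ t in {t : ℝ | a < |α - t|}, u t / (α - t)) - ∫ t, QK a (α - t) * u t)
      (𝓝[>] 0) (𝓝 0) := by
  set E : ℝ → ℝ → ℝ := fun a x => (if a < |x| then 1 / x else 0) - QK a x with hEd
  have hEm : ∀ a, Measurable (E a) := by
    intro a
    refine Measurable.sub (Measurable.ite ?_ (by fun_prop) (by fun_prop)) (measurable_QK a)
    exact measurableSet_lt measurable_const (by fun_prop)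
  have hb : ∀ a, 0 < a → ∀ x, |E a x| ≤ 1 * PK a x := by
    intro a ha x
    have h0 := den_pos ha x
    simp only [hEd]
    unfold PK QK
    rw [one_mul]
    split_ifs with h
    · have hx : x ≠ 0 := by rintro rfl; simp at h; linarith
      have : 1 / x - x / (x ^ 2 + a ^ 2) = (a / x) * (a / (x ^ 2 + a ^ 2)) := by
        field_simp; ring
      rw [this, abs_mul, abs_of_nonneg (by positivity : 0 ≤ a / (x ^ 2 + a ^ 2)), abs_div, abs_of_pos ha]
      have h1 : a / |x| ≤ 1 := by rw [div_le_one (ha.trans h)]; exact h.le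
      have h2 : 0 ≤ a / (x ^ 2 + a ^ 2) := by positivity
      nlinarith
    · rw [zero_sub, abs_neg, abs_div, abs_of_pos h0]
      gcongr
      exact not_lt.1 h
  have hz : ∀ a, 0 < a → ∫ x, E a x = 0 := by
    intro a ha
    have h1 : ∀ x, E a (-x) = - E a x := by
      intro x; simp only [hEd, abs_neg, QK_neg]
      split_ifs
      · rw [one_div, one_div, inv_neg]; ring
      · ring
    have h2 := integral_neg_eq_self (E a) volume
    simp_rw [h1, integral_neg] at h2
    linarith
  have h := LPK hu hi hL hEm hb
  refine h.congr' ?_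
  filter_upwards [self_mem_nhdsWithin] with a ha
  have ha : 0 < a := ha
  rw [hz a ha, mul_zero, sub_zero]
  have hms : MeasurableSet {t : ℝ | a < |α - t|} := measurableSet_lt measurable_const (by fun_prop)
  rw [← integral_indicator hms]
  have e1 : (fun t => E a (α - t) * u t) = fun t =>
      {t : ℝ | a < |α - t|}.indicator (fun t => u t / (α - t)) t - QK a (α - t) * u t := by
    ext t
    simp only [hEd, Set.indicator, Set.mem_ofPred_eq]
    split_ifs <;> ring
  have i1 : Integrable (fun t => E a (α - t) * u t) := by
    refine ((integrable_shift_PK hu hi ha α).norm.const_mul 1).mono' ?_ ?_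
    · exact (((hEm a).comp (measurable_const.sub measurable_id)).mul hu).aestronglyMeasurable
    · filter_upwards with t
      rw [norm_mul, norm_mul, ← mul_assoc]
      gcongr
      rw [Real.norm_eq_abs, Real.norm_eq_abs, abs_of_nonneg (PK_nonneg ha _)]
      exact hb a ha _
  have i3 : Integrable ({t : ℝ | a < |α - t|}.indicator (fun t => u t / (α - t))) := by
    have := i1.add (hi2 a ha α)
    refine this.congr (Eventually.of_forall fun t => ?_)
    simp only [Pi.add_apply, e1]; ring
  rw [e1, integral_sub i3 (hi2 a ha α)]

end


section
open scoped ENNReal Topology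

def Vb (u : ℝ → ℝ) (b α : ℝ) : ℝ := ∫ t, QK b (α - t) * u t

structure BC (u : ℝ → ℝ) (M R : ℝ) : Prop where
  meas : Measurable u
  bd : ∀ t, |u t| ≤ M
  supp : ∀ t, R < |t| → u t = 0

lemma BC.M_nonneg {u : ℝ → ℝ} {M R : ℝ} (h : BC u M R) : 0 ≤ M := (abs_nonneg _).trans (h.bd 0)

lemma BC.integrable {u : ℝ → ℝ} {M R : ℝ} (h : BC u M R) : Integrable u := by
  have : Integrable ((Icc (-R) R).indicator (fun _ => M)) := by
    rw [integrable_indicator_iff measurableSet_Icc]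
    exact integrableOn_const (by simp)
  refine this.mono' h.meas.aestronglyMeasurable (Eventually.of_forall fun t => ?_)
  by_cases ht : R < |t|
  · rw [h.supp t ht, norm_zero]
    exact Set.indicator_nonneg (fun _ _ => h.M_nonneg) _
  · rw [Set.indicator_of_mem (show t ∈ Icc (-R) R from abs_le.1 (not_lt.1 ht))]; exact h.bd t

lemma BC.integrable_mul {u : ℝ → ℝ} {M R : ℝ} (h : BC u M R) {g : ℝ → ℝ} (hg : Measurable g) {c : ℝ}
    (hc : ∀ t, |g t| ≤ c) : Integrable (fun t => g t * u t) := by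
  refine (h.integrable.norm.const_mul c).mono' (hg.mul h.meas).aestronglyMeasurable
    (Eventually.of_forall fun t => ?_)
  rw [norm_mul]
  exact mul_le_mul_of_nonneg_right (hc t) (norm_nonneg _)

lemma BC.integrable_sq {u : ℝ → ℝ} {M R : ℝ} (h : BC u M R) : Integrable (fun t => u t ^ 2) := by
  simpa [pow_two] using h.integrable_mul h.meas h.bd

lemma BC.QK_sq_bound {u : ℝ → ℝ} {M R : ℝ} (h : BC u M R) {a : ℝ} (ha : 0 < a) (x t : ℝ) (ht : u t ≠ 0) :
    QK a (x - t) ^ 2 ≤ (2 + (1 + 2 * R ^ 2) / a ^ 2) * PK 1 x := by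
  have htR : |t| ≤ R := by
    by_contra h'; exact ht (h.supp t (not_le.1 h'))
  have h0 := den_pos ha (x - t)
  have h1 : QK a (x - t) ^ 2 ≤ 1 / ((x - t) ^ 2 + a ^ 2) := by
    unfold QK
    rw [div_pow, div_le_div_iff₀ (by positivity) h0]
    nlinarith [sq_nonneg a, mul_nonneg (sq_nonneg a) h0.le]
  refine h1.trans ?_
  unfold PK
  rw [one_pow, mul_one_div, div_le_div_iff₀ h0 (by positivity)]
  have h3 : (1 + 2 * R ^ 2) / a ^ 2 * a ^ 2 = 1 + 2 * R ^ 2 := by field_simp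
  have h5 : 0 ≤ (1 + 2 * R ^ 2) / a ^ 2 := by positivity
  have h6 : t ^ 2 ≤ R ^ 2 := by rw [← sq_abs t]; gcongr
  nlinarith [mul_nonneg h5 (sq_nonneg (x - t)), sq_nonneg a, sq_nonneg (x - 2 * t)]

lemma BC.integrable_gV {u : ℝ → ℝ} {M R : ℝ} (h : BC u M R) {b : ℝ} (hb : 0 < b) {g : ℝ → ℝ}
    (hg : Measurable g) (hg2 : Integrable (fun x => g x ^ 2)) :
    Integrable (Function.uncurry fun α t => g α * (QK b (α - t) * u t)) (volume.prod volume) := by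
  set K := 2 + (1 + 2 * R ^ 2) / b ^ 2
  have hK : 0 ≤ K := by positivity
  have i1 : Integrable (fun p : ℝ × ℝ => (g p.1 ^ 2 + K * PK 1 p.1) * ‖u p.2‖) (volume.prod volume) :=
    (hg2.add ((integrable_PK one_pos).const_mul K)).mul_prod h.integrable.norm
  have hm := h.meas
  refine i1.mono' ?_ (Eventually.of_forall fun p => ?_)
  · apply Measurable.aestronglyMeasurable
    unfold Function.uncurry QK; fun_prop
  · simp only [Function.uncurry]
    rw [← mul_assoc, norm_mul]
    by_cases hu : u p.2 = 0
    · simp [hu]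
    apply mul_le_mul_of_nonneg_right _ (norm_nonneg _)
    have := h.QK_sq_bound hb p.1 p.2 hu
    rw [Real.norm_eq_abs, abs_le]
    constructor <;> nlinarith [sq_nonneg (g p.1 + QK b (p.1 - p.2)), sq_nonneg (g p.1 - QK b (p.1 - p.2)),
      sq_nonneg (g p.1), sq_nonneg (QK b (p.1 - p.2))]

lemma BC.integral_gV {u : ℝ → ℝ} {M R : ℝ} (h : BC u M R) {b : ℝ} (hb : 0 < b) {g : ℝ → ℝ}
    (hg : Measurable g) (hg2 : Integrable (fun x => g x ^ 2)) :
    ∫ α, g α * Vb u b α = ∫ t, (∫ α, g α * QK b (α - t)) * u t := by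
  have h1 := integral_integral_swap (h.integrable_gV hb hg hg2)
  simp_rw [integral_const_mul] at h1
  unfold Vb
  rw [h1]
  congr 1; ext t
  rw [← integral_mul_const]
  congr 1; ext α; ring

lemma BC.Vb_meas {u : ℝ → ℝ} {M R : ℝ} (h : BC u M R) (b : ℝ) : Measurable (Vb u b) := by
  unfold Vb
  have hm := h.meas
  have : StronglyMeasurable (Function.uncurry fun α t : ℝ => QK b (α - t) * u t) := by
    apply Measurable.stronglyMeasurable; unfold Function.uncurry QK; fun_prop
  exact this.integral_prod_right.measurable

lemma BC.Vb_abs_le {u : ℝ → ℝ} {M R : ℝ} (h : BC u M R) {b : ℝ} (hb : 0 < b) (x : ℝ) :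
    Vb u b x ^ 2 ≤ ((2 + (1 + 2 * R ^ 2) / b ^ 2) * PK 1 x) * (∫ t, |u t|) ^ 2 := by
  set K := (2 + (1 + 2 * R ^ 2) / b ^ 2) * PK 1 x with hK
  have hK0 : 0 ≤ K := mul_nonneg (by positivity) (PK_nonneg one_pos x)
  have : |Vb u b x| ≤ √K * ∫ t, |u t| := by
    unfold Vb
    rw [← integral_const_mul, ← Real.norm_eq_abs]
    refine norm_integral_le_of_norm_le (h.integrable.norm.const_mul _) (Eventually.of_forall fun t => ?_)
    rw [norm_mul]
    by_cases hu : u t = 0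
    · simp [hu]
    exact mul_le_mul_of_nonneg_right (Real.abs_le_sqrt (h.QK_sq_bound hb x t hu)) (norm_nonneg _)
  rw [← sq_abs, ← Real.sq_sqrt hK0, ← mul_pow]
  gcongr

lemma BC.Vb_sq_int {u : ℝ → ℝ} {M R : ℝ} (h : BC u M R) {b : ℝ} (hb : 0 < b) :
    Integrable (fun x => Vb u b x ^ 2) := by
  refine ((((integrable_PK one_pos).const_mul (2 + (1 + 2 * R ^ 2) / b ^ 2))).mul_const
    ((∫ t, |u t|) ^ 2)).mono' ((h.Vb_meas b).pow_const 2).aestronglyMeasurable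
    (Eventually.of_forall fun x => ?_)
  rw [Real.norm_eq_abs, abs_of_nonneg (sq_nonneg _)]
  exact h.Vb_abs_le hb x

def Jc (u : ℝ → ℝ) (c : ℝ) : ℝ := ∫ t, (∫ s, PK c (t - s) * u s) * u t

lemma BC.integral_VV {u : ℝ → ℝ} {M R : ℝ} (h : BC u M R) {a b : ℝ} (ha : 0 < a) (hb : 0 < b) :
    ∫ α, Vb u a α * Vb u b α = π * Jc u (a + b) := by
  rw [h.integral_gV hb (h.Vb_meas a) (h.Vb_sq_int ha), Jc, ← integral_const_mul]
  congr 1; ext t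
  rw [← mul_assoc]; congr 1
  have h1 : ∫ α, Vb u a α * QK b (α - t) = ∫ α, QK b (α - t) * Vb u a α := by
    congr 1; ext α; ring
  rw [h1, h.integral_gV (g := fun α => QK b (α - t)) ha ((measurable_QK b).comp (measurable_id.sub_const t))
    ((integrable_QK_sq hb).comp_sub_right t), ← integral_const_mul]
  apply integral_congr_ae
  have : ∀ᵐ s : ℝ, s ≠ t := by simp [ae_iff]
  filter_upwards [this] with s hs
  rw [← mul_assoc]; congr 1
  have e2 : ∫ α, QK b (α - t) * QK a (α - s) = ∫ x, QK b (x - (t - s)) * QK a x := by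
    rw [← integral_sub_right_eq_self (fun x => QK b (x - (t - s)) * QK a x) s]
    congr 1; ext α; congr 2; ring
  rw [e2, integral_QQ hb ha (sub_ne_zero.2 hs.symm), add_comm]

lemma BC.int_PK1 {u : ℝ → ℝ} {M R : ℝ} (h : BC u M R) : Integrable (fun t => u t * PK 1 t) := by
  have := h.integrable_mul (measurable_PK 1) (c := 1⁻¹)
    (fun t => by rw [abs_of_nonneg (PK_nonneg one_pos t)]; exact PK_le one_pos t)
  simpa [mul_comm] using this

lemma BC.Jc_tendsto {u : ℝ → ℝ} {M R : ℝ} (h : BC u M R) :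
    Tendsto (Jc u) (𝓝[>] 0) (𝓝 (π * ∫ t, u t ^ 2)) := by
  unfold Jc
  rw [← integral_const_mul]
  have hm := h.meas
  apply tendsto_integral_filter_of_dominated_convergence (fun t => (π * M) * |u t|)
  · filter_upwards with c
    have : StronglyMeasurable (Function.uncurry fun t s : ℝ => PK c (t - s) * u s) := by
      apply Measurable.stronglyMeasurable; unfold Function.uncurry PK; fun_prop
    exact (this.integral_prod_right.measurable.mul hm).aestronglyMeasurable
  · filter_upwards [self_mem_nhdsWithin] with c hc
    filter_upwards with t
    rw [norm_mul]
    apply mul_le_mul_of_nonneg_right _ (norm_nonneg _)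
    rw [← integral_PK hc, ← integral_sub_left_eq_self (PK c) volume t, ← integral_mul_const]
    refine norm_integral_le_of_norm_le (((integrable_PK hc).comp_sub_left t).mul_const _)
      (Eventually.of_forall fun s => ?_)
    rw [norm_mul, Real.norm_eq_abs, abs_of_nonneg (PK_nonneg hc _)]
    exact mul_le_mul_of_nonneg_left (h.bd s) (PK_nonneg hc _)
  · exact (h.integrable.norm).const_mul _
  · filter_upwards [lebPt_ae h.integrable.locallyIntegrable] with t ht
    have := (LP_poisson hm h.int_PK1 ht).mul_const (u t)
    rw [pow_two, ← mul_assoc]; exact this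

end


section
open scoped ENNReal Topology

lemma sq_memLp {g : ℝ → ℝ} (hg : Measurable g) (h2 : Integrable (fun x => g x ^ 2)) :
    MemLp g 2 volume := (memLp_two_iff_integrable_sq hg.aestronglyMeasurable).2 h2

lemma seqb_pos (n : ℕ) : (0:ℝ) < 1 / ((n:ℝ) + 1) := by positivity

lemma seqb_tendsto : Tendsto (fun n : ℕ => (1:ℝ) / ((n:ℝ) + 1)) atTop (𝓝[>] 0) :=
  tendsto_nhdsWithin_iff.2 ⟨tendsto_one_div_add_atTop_nhds_zero_nat, Eventually.of_forall seqb_pos⟩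

lemma inner_toLp {g k : ℝ → ℝ} (hg : MemLp g 2 volume) (hk : MemLp k 2 volume) :
    inner ℝ (hg.toLp g) (hk.toLp k) = ∫ x, g x * k x := by
  rw [MeasureTheory.L2.inner_def]
  apply integral_congr_ae
  filter_upwards [hg.coeFn_toLp, hk.coeFn_toLp] with x h1 h2
  rw [h1, h2]; simp [mul_comm]

lemma BC.exists_lim {u : ℝ → ℝ} {M R : ℝ} (h : BC u M R) :
    ∃ v : ℝ → ℝ, Measurable v ∧ Integrable (fun x => v x ^ 2) ∧
      (∫ x, v x ^ 2 = π ^ 2 * ∫ x, u x ^ 2) ∧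
      ∀ g : ℝ → ℝ, Measurable g → Integrable (fun x => g x ^ 2) →
        Tendsto (fun n : ℕ => ∫ x, g x * Vb u (1 / ((n:ℝ) + 1)) x) atTop (𝓝 (∫ x, g x * v x)) := by
  have hV : ∀ n : ℕ, MemLp (Vb u (1 / ((n:ℝ) + 1))) 2 volume := fun n =>
    sq_memLp (h.Vb_meas _) (h.Vb_sq_int (seqb_pos n))
  set F : ℕ → Lp ℝ 2 (volume : Measure ℝ) := fun n => (hV n).toLp _ with hF
  have hin : ∀ n m, inner ℝ (F n) (F m) = π * Jc u (1 / ((n:ℝ) + 1) + 1 / ((m:ℝ) + 1)) := by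
    intro n m
    rw [hF, inner_toLp, h.integral_VV (seqb_pos n) (seqb_pos m)]
  set J0 := π * ∫ t, u t ^ 2 with hJ0
  have hC : CauchySeq F := by
    rw [Metric.cauchySeq_iff]
    intro e he
    have hJ := Metric.tendsto_nhds.1 h.Jc_tendsto (e ^ 2 / (8 * π)) (by positivity)
    obtain ⟨c0, hc0, H⟩ := (mem_nhdsGT_iff_exists_Ioc_subset).1 hJ
    obtain ⟨N, hN⟩ := (tendsto_one_div_add_atTop_nhds_zero_nat (𝕜 := ℝ)).eventually
      (gt_mem_nhds (half_pos hc0)) |>.exists_forall_of_atTop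
    have HJ : ∀ n ≥ N, ∀ m ≥ N, |Jc u (1 / ((n:ℝ) + 1) + 1 / ((m:ℝ) + 1)) - J0| < e ^ 2 / (8 * π) := by
      intro n hn m hm
      have := @H (1 / ((n:ℝ) + 1) + 1 / ((m:ℝ) + 1))
        ⟨add_pos (seqb_pos n) (seqb_pos m), by linarith [hN n hn, hN m hm]⟩
      exact this
    refine ⟨N, fun m hm n hn => ?_⟩
    rw [dist_eq_norm]
    have e1 : ‖F m - F n‖ ^ 2 = ‖F m‖ ^ 2 - 2 * inner ℝ (F m) (F n) + ‖F n‖ ^ 2 :=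
      norm_sub_sq_real _ _
    rw [← real_inner_self_eq_norm_sq (F m), ← real_inner_self_eq_norm_sq (F n), hin, hin, hin] at e1
    have h1 := abs_lt.1 (HJ m hm m hm)
    have h2 := abs_lt.1 (HJ m hm n hn)
    have h3 := abs_lt.1 (HJ n hn n hn)
    have h4 : e ^ 2 / (8 * π) * π = e ^ 2 / 8 := by field_simp
    have hpi := Real.pi_pos
    have : ‖F m - F n‖ ^ 2 < e ^ 2 := by
      rw [e1]
      nlinarith
    exact lt_of_pow_lt_pow_left₀ 2 he.le this
  obtain ⟨f, hf⟩ := cauchySeq_tendsto_of_complete hC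
  have hfm : MemLp (f : ℝ → ℝ) 2 volume := Lp.memLp f
  have hfe : hfm.toLp f = f := Lp.toLp_coeFn f hfm
  refine ⟨f, (Lp.stronglyMeasurable f).measurable, hfm.integrable_sq, ?_, ?_⟩
  · have t1 : Tendsto (fun n => inner ℝ (F n) (F n)) atTop (𝓝 (inner ℝ f f)) := hf.inner hf
    have t2 : Tendsto (fun n => inner ℝ (F n) (F n)) atTop (𝓝 (π * J0)) := by
      simp_rw [hin]
      apply Tendsto.const_mul
      refine h.Jc_tendsto.comp ?_
      have := (seqb_tendsto.mono_right nhdsWithin_le_nhds).add (seqb_tendsto.mono_right nhdsWithin_le_nhds)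
      rw [add_zero] at this
      exact tendsto_nhdsWithin_iff.2 ⟨this, Eventually.of_forall fun n => add_pos (seqb_pos n) (seqb_pos n)⟩
    have := tendsto_nhds_unique t1 t2
    rw [← hfe, inner_toLp hfm hfm] at this
    simp_rw [pow_two (f _)]
    rw [this, hJ0]; ring
  · intro g hg hg2
    have hgm := sq_memLp hg hg2
    have t1 : Tendsto (fun n => inner ℝ (hgm.toLp g) (F n)) atTop (𝓝 (inner ℝ (hgm.toLp g) f)) :=
      tendsto_const_nhds.inner hf
    rw [← hfe, inner_toLp hgm hfm] at t1
    refine t1.congr fun n => ?_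
    rw [hF, inner_toLp]

lemma tendsto_PK_QK_add {a : ℝ} (ha : 0 < a) (x : ℝ) :
    Tendsto (fun n : ℕ => QK (a + 1 / ((n:ℝ) + 1)) x) atTop (𝓝 (QK a x)) ∧
    Tendsto (fun n : ℕ => PK (a + 1 / ((n:ℝ) + 1)) x) atTop (𝓝 (PK a x)) := by
  have h1 : Tendsto (fun n : ℕ => a + 1 / ((n:ℝ) + 1)) atTop (𝓝 a) := by
    simpa using (tendsto_one_div_add_atTop_nhds_zero_nat (𝕜 := ℝ)).const_add a
  have h0 := (den_pos ha x).ne'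
  have hq : ContinuousAt (fun c => QK c x) a := by
    unfold QK; fun_prop (disch := exact h0)
  have hp : ContinuousAt (fun c => PK c x) a := by
    unfold PK; fun_prop (disch := exact h0)
  exact ⟨hq.tendsto.comp h1, hp.tendsto.comp h1⟩

lemma BC.tendsto_int {u : ℝ → ℝ} {M R : ℝ} (h : BC u M R) {k : ℕ → ℝ → ℝ} {k0 : ℝ → ℝ} {c : ℝ}
    (hm : ∀ n, Measurable (k n)) (hb : ∀ n t, |k n t| ≤ c)
    (hl : ∀ t, Tendsto (fun n => k n t) atTop (𝓝 (k0 t))) :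
    Tendsto (fun n => ∫ t, (π * k n t) * u t) atTop (𝓝 (π * ∫ t, k0 t * u t)) := by
  have : Tendsto (fun n => ∫ t, k n t * u t) atTop (𝓝 (∫ t, k0 t * u t)) := by
    apply tendsto_integral_of_dominated_convergence (fun t => c * |u t|)
    · exact fun n => ((hm n).mul h.meas).aestronglyMeasurable
    · exact h.integrable.norm.const_mul c
    · intro n; filter_upwards with t
      rw [norm_mul]; exact mul_le_mul_of_nonneg_right (hb n t) (norm_nonneg _)
    · filter_upwards with t
      exact (hl t).mul_const _
  simp_rw [mul_assoc, integral_const_mul]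
  exact this.const_mul π

lemma PK_sq_int {a : ℝ} (ha : 0 < a) : Integrable (fun x => PK a x ^ 2) := by
  refine ((integrable_PK ha).const_mul a⁻¹).mono' ((measurable_PK a).pow_const 2).aestronglyMeasurable
    (Eventually.of_forall fun x => ?_)
  rw [Real.norm_eq_abs, abs_of_nonneg (sq_nonneg _), pow_two]
  exact mul_le_mul_of_nonneg_right (PK_le ha x) (PK_nonneg ha x)

lemma L2_int_PK1 {v : ℝ → ℝ} (hv : Measurable v) (h2 : Integrable (fun x => v x ^ 2)) :
    Integrable (fun t => v t * PK 1 t) := by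
  refine (h2.add (PK_sq_int one_pos)).mono' (hv.mul (measurable_PK 1)).aestronglyMeasurable
    (Eventually.of_forall fun x => ?_)
  simp only [Pi.add_apply]
  rw [Real.norm_eq_abs, abs_le]
  constructor <;> nlinarith [sq_nonneg (v x - PK 1 x), sq_nonneg (v x + PK 1 x)]

lemma L2_locInt {v : ℝ → ℝ} (hv : Measurable v) (h2 : Integrable (fun x => v x ^ 2)) :
    LocallyIntegrable v := (sq_memLp hv h2).locallyIntegrable (by norm_num)

/-- The Hilbert transform of a bounded compactly supported function. -/
theorem BC.hilbert {u : ℝ → ℝ} {M R : ℝ} (h : BC u M R) :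
    ∃ v : ℝ → ℝ, Measurable v ∧ Integrable (fun x => v x ^ 2) ∧
      (∫ x, v x ^ 2 = π ^ 2 * ∫ x, u x ^ 2) ∧
      (∀ᵐ α, Tendsto (fun r => ∫ t in {t : ℝ | r < |α - t|}, u t / (α - t)) (𝓝[>] 0) (𝓝 (v α))) ∧
      (∀ a, 0 < a → ∫ t, PK a t * v t = - (π * ∫ t, QK a t * u t)) ∧
      (∀ a, 0 < a → ∫ t, QK a t * v t = π * ∫ t, PK a t * u t) := by
  obtain ⟨v, hvm, hv2, hvn, hw⟩ := h.exists_lim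
  have hP : ∀ a, 0 < a → ∀ α, ∫ t, PK a (α - t) * v t = π * ∫ t, QK a (α - t) * u t := by
    intro a ha α
    have hmg : Measurable (fun t => PK a (α - t)) := (measurable_PK a).comp (measurable_const.sub measurable_id)
    have hsq : Integrable (fun t => PK a (α - t) ^ 2) := (PK_sq_int ha).comp_sub_left α
    have t1 := hw _ hmg hsq
    have t2 := h.tendsto_int (k := fun n t => QK (a + 1 / ((n:ℝ) + 1)) (α - t)) (c := a⁻¹)
      (k0 := fun t => QK a (α - t))
      (fun n => (measurable_QK _).comp (measurable_const.sub measurable_id))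
      (fun n t => (abs_QK_le (add_pos ha (seqb_pos n)) _).trans (by
        apply inv_anti₀ ha; linarith [seqb_pos n]))
      (fun t => (tendsto_PK_QK_add ha _).1)
    refine tendsto_nhds_unique t1 (t2.congr fun n => ?_)
    rw [h.integral_gV (seqb_pos n) hmg hsq]
    apply integral_congr_ae
    have : ∀ᵐ s : ℝ, s ≠ α := by simp [ae_iff]
    filter_upwards [this] with s hs
    congr 1
    rw [← integral_PQ ha (seqb_pos n) (sub_ne_zero.2 hs.symm),
      ← integral_sub_right_eq_self (fun x => PK a (x - (α - s)) * QK _ x) s]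
    congr 1; ext x; rw [← PK_neg]; congr 2; ring
  refine ⟨v, hvm, hv2, hvn, ?_, ?_, ?_⟩
  · filter_upwards [lebPt_ae h.integrable.locallyIntegrable, lebPt_ae (L2_locInt hvm hv2)] with α h1 h2
    have t1 := LP_trunc h.meas h.int_PK1 (fun a ha α => h.integrable_mul
      ((measurable_QK a).comp (measurable_const.sub measurable_id)) (fun t => abs_QK_le ha _)) h1
    have t2 := (LP_poisson hvm (L2_int_PK1 hvm hv2) h2).const_mul π⁻¹
    rw [← mul_assoc, inv_mul_cancel₀ Real.pi_pos.ne', one_mul] at t2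
    have t3 := t1.add t2
    rw [zero_add] at t3
    refine t3.congr' ?_
    filter_upwards [self_mem_nhdsWithin] with a ha
    rw [hP a ha, ← mul_assoc, inv_mul_cancel₀ Real.pi_pos.ne', one_mul]
    ring
  · intro a ha
    have := hP a ha 0
    simp only [zero_sub, PK_neg, QK_neg] at this
    rw [this, ← mul_neg, ← integral_neg]
    congr 2; ext t; ring
  · intro a ha
    have t1 := hw _ (measurable_QK a) (integrable_QK_sq ha)
    have t2 := h.tendsto_int (k := fun n t => PK (a + 1 / ((n:ℝ) + 1)) t) (c := a⁻¹)
      (k0 := fun t => PK a t) (fun n => measurable_PK _)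
      (fun n t => by
        have hp := add_pos ha (seqb_pos n)
        rw [abs_of_nonneg (PK_nonneg hp _)]
        refine (PK_le hp _).trans (by apply inv_anti₀ ha; linarith [seqb_pos n]))
      (fun t => (tendsto_PK_QK_add ha _).2)
    refine tendsto_nhds_unique t1 (t2.congr fun n => ?_)
    rw [h.integral_gV (seqb_pos n) (measurable_QK a) (integrable_QK_sq ha)]
    apply integral_congr_ae
    have : ∀ᵐ s : ℝ, s ≠ 0 := by simp [ae_iff]
    filter_upwards [this] with s hs
    congr 1
    rw [add_comm, ← integral_QQ (seqb_pos n) ha hs]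
    congr 1; ext x; ring

end


section
structure Par (K ε s L : ℝ) : Prop where
  hK : 1 ≤ K
  hs : 0 < s
  hs1 : s ≤ 1 / 1000
  he : ε = s ^ 2
  hL : L = Real.log (1 / ε)

namespace Par
variable {K ε s L : ℝ}
lemma he0 (h : Par K ε s L) : 0 < ε := by rw [h.he]; exact pow_pos h.hs 2
lemma hes (h : Par K ε s L) : ε ≤ s / 1000 := by rw [h.he]; nlinarith [h.hs, h.hs1]
lemma hL1 (h : Par K ε s L) : 1 ≤ L := by
  rw [h.hL, Real.le_log_iff_exp_le (by have := h.he0; positivity)]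
  have h1 : Real.exp 1 < 3 := Real.exp_one_lt_d9.trans (by norm_num)
  refine h1.le.trans ?_
  rw [le_div_iff₀ h.he0]
  have := h.hes; have := h.hs1; linarith
end Par

structure Fn (K s : ℝ) (f f1 f2 : ℝ → ℝ) : Prop where
  mf : Measurable f
  mf1 : Measurable f1
  mf2 : Measurable f2
  f0 : f 0 = 0
  f1b : ∀ β, |β| < 4 * s → |f1 β| ≤ K * |β|
  f2b : ∀ β, |β| < 4 * s → |f2 β| ≤ K
  lip : ∀ α β, |α| < 4 * s → |β| < 4 * s → |f α - f β| ≤ K * |α - β| * (|α| + |β|)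
  tay : ∀ α β, |α| < 4 * s → |β| < 4 * s →
    |f α - f β - (α - β) * f1 β - (α - β) ^ 2 / 2 * f2 β| ≤ K * |α - β| ^ 3

structure PairFG (K ε s : ℝ) (f g : ℝ → ℝ) : Prop where
  lo : ∀ α β, |α| < 4 * s → |β| < 4 * s → ε ≤ 2 * ε + f α + g β
  hi : ∀ α β, |α| < 4 * s → |β| < 4 * s → 2 * ε + f α + g β ≤ K * ε

lemma PairFG.symm {K ε s : ℝ} {f g : ℝ → ℝ} (h : PairFG K ε s f g) : PairFG K ε s g f :=
  ⟨fun α β ha hb => by linarith [h.lo β α hb ha], fun α β ha hb => by linarith [h.hi β α hb ha]⟩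

structure Cut (K : ℝ) (ψ : ℝ → ℝ) : Prop where
  m : Measurable ψ
  nn : ∀ x, 0 ≤ ψ x
  le1 : ∀ x, ψ x ≤ 1
  supp : ∀ x, 1 ≤ |x| → ψ x = 0
  one : ∀ x, |x| ≤ 1 / 2 → ψ x = 1
  lip : ∀ x y, |ψ x - ψ y| ≤ K * |x - y|

lemma Fn.abs_le {K s : ℝ} {f f1 f2 : ℝ → ℝ} (h : Fn K s f f1 f2) (hs : 0 < s) {β : ℝ} (hb : |β| < 4 * s) :
    |f β| ≤ K * β ^ 2 := by
  have := h.lip β 0 hb (by simpa using hs)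
  rw [h.f0] at this
  simp only [sub_zero, abs_zero, add_zero] at this
  rw [← sq_abs β]; linarith [this]

def qc (ε c β : ℝ) : ℝ := QK c β - QK (c + 2 * ε) β

lemma measurable_qc (ε c : ℝ) : Measurable (qc ε c) := (measurable_QK _).sub (measurable_QK _)

lemma qc_neg (ε c β : ℝ) : qc ε c (-β) = - qc ε c β := by unfold qc; rw [QK_neg, QK_neg]; ring

lemma QK_diff_bound {ε a b β : ℝ} (he : 0 < ε) (ha : ε ≤ a) (hb : ε ≤ b) :
    |QK a β - QK b β| ≤ 4 * |β| * |a - b| * (a + b) / (ε + |β|) ^ 4 := by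
  have ha0 := he.trans_le ha
  have hb0 := he.trans_le hb
  have h1 := den_pos ha0 β
  have h2 := den_pos hb0 β
  have hp : 0 < ε + |β| := by positivity
  have e : QK a β - QK b β = β * (b - a) * (a + b) / ((β ^ 2 + a ^ 2) * (β ^ 2 + b ^ 2)) := by
    unfold QK; field_simp; ring
  rw [e, abs_div, abs_mul, abs_mul, abs_of_pos (mul_pos h1 h2), abs_of_pos (add_pos ha0 hb0), abs_sub_comm,
    div_le_div_iff₀ (by positivity) (by positivity)]
  have k1 : (ε + |β|) ^ 2 ≤ 2 * (β ^ 2 + a ^ 2) := by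
    nlinarith [sq_abs β, sq_nonneg (ε - |β|), abs_nonneg β]
  have k2 : (ε + |β|) ^ 2 ≤ 2 * (β ^ 2 + b ^ 2) := by
    nlinarith [sq_abs β, sq_nonneg (ε - |β|), abs_nonneg β]
  have k3 : (ε + |β|) ^ 4 ≤ 4 * ((β ^ 2 + a ^ 2) * (β ^ 2 + b ^ 2)) := by
    calc (ε + |β|) ^ 4 = (ε + |β|) ^ 2 * (ε + |β|) ^ 2 := by ring
      _ ≤ (2 * (β ^ 2 + a ^ 2)) * (2 * (β ^ 2 + b ^ 2)) := by gcongr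
      _ = _ := by ring
  have := mul_le_mul_of_nonneg_left k3 (show 0 ≤ |β| * |a - b| * (a + b) by positivity)
  linarith

lemma qc_bound {ε c : ℝ} (he : 0 < ε) (hc : ε ≤ c) (hc6 : c ≤ 8 * ε) (β : ℝ) :
    |qc ε c β| ≤ 144 * ε ^ 2 / (ε + |β|) ^ 3 := by
  have h := QK_diff_bound (β := β) he hc (by linarith : ε ≤ c + 2 * ε)
  unfold qc
  refine h.trans ?_
  have hp : 0 < ε + |β| := by positivity
  have e1 : |c - (c + 2 * ε)| = 2 * ε := by rw [abs_sub_comm, abs_of_pos] <;> linarith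
  rw [e1, div_le_div_iff₀ (by positivity) (by positivity)]
  have : 4 * |β| * (2 * ε) * (c + (c + 2 * ε)) ≤ 144 * ε ^ 2 * (ε + |β|) := by
    nlinarith [mul_nonneg (mul_nonneg (abs_nonneg β) he.le) (sub_nonneg.2 hc6), pow_pos he 3]
  calc _ ≤ (144 * ε ^ 2 * (ε + |β|)) * (ε + |β|) ^ 3 := by gcongr
    _ = _ := by ring

lemma qc_bound1 {K ε s L c : ℝ} (hp : Par K ε s L) (hc : ε ≤ c) (hc6 : c ≤ 8 * ε) {β : ℝ} (hβ : s / 256 ≤ |β|) :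
    |qc ε c β| ≤ 10 ^ 7 * ε / (ε + |β|) := by
  have he := hp.he0
  have h := qc_bound he hc hc6 β
  have hr : 0 < ε + |β| := by positivity
  refine h.trans ?_
  rw [div_le_div_iff₀ (by positivity) hr]
  have : ε ≤ 65536 * (ε + |β|) ^ 2 := by
    rw [hp.he]
    have h1 : s ≤ 256 * (ε + |β|) := by linarith
    have := hp.hs
    rw [hp.he] at h1
    nlinarith
  calc 144 * ε ^ 2 * (ε + |β|) ≤ 144 * (ε * (65536 * (ε + |β|) ^ 2)) * (ε + |β|) := by
        rw [pow_two ε]; gcongr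
    _ ≤ 10 ^ 7 * ε * (ε + |β|) ^ 3 := by nlinarith [mul_pos he (pow_pos hr 3)]

lemma QX_bound {K ε s c X β : ℝ} (hK : 1 ≤ K) (he : 0 < ε) (hc : ε ≤ c) (hc6 : c ≤ 8 * ε) (hX : ε ≤ X)
    (hX2 : X ≤ K * ε) (hXb : |X - 2 * ε| ≤ 2 * K * β ^ 2) :
    |QK (c + X) β - QK (c + 2 * ε) β| ≤ 160 * K ^ 2 * ε / (ε + |β|) := by
  have h := QK_diff_bound (β := β) he (by linarith : ε ≤ c + X) (by linarith : ε ≤ c + 2 * ε)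
  refine h.trans ?_
  have hp : 0 < ε + |β| := by positivity
  have e1 : c + X - (c + 2 * ε) = X - 2 * ε := by ring
  rw [e1, div_le_div_iff₀ (by positivity) hp]
  have hb0 := abs_nonneg β
  have k1 : c + X + (c + 2 * ε) ≤ 20 * K * ε := by nlinarith
  have k2 : |X - 2 * ε| ≤ 2 * K * |β| ^ 2 := by rwa [sq_abs]
  have k3 : |β| ^ 3 ≤ (ε + |β|) ^ 3 := by gcongr; linarith
  have : 0 ≤ c + X + (c + 2 * ε) := by linarith
  calc 4 * |β| * |X - 2 * ε| * (c + X + (c + 2 * ε)) * (ε + |β|)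
      ≤ 4 * |β| * (2 * K * |β| ^ 2) * (20 * K * ε) * (ε + |β|) := by gcongr
    _ = 160 * K ^ 2 * ε * (|β| ^ 3 * (ε + |β|)) := by ring
    _ ≤ 160 * K ^ 2 * ε * ((ε + |β|) ^ 3 * (ε + |β|)) := by gcongr
    _ = _ := by ring

lemma integral_rho {ε r : ℝ} (he : 0 < ε) (hr : 0 < r) :
    IntegrableOn (fun x => (ε + |x|)⁻¹) (Ioo (-r) r) ∧
    ∫ x in Ioo (-r) r, (ε + |x|)⁻¹ = 2 * Real.log ((ε + r) / ε) := by
  have hcont : Continuous (fun x : ℝ => (ε + |x|)⁻¹) := by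
    apply Continuous.inv₀ (by fun_prop); intro x; positivity
  refine ⟨(hcont.integrableOn_Icc).mono_set Ioo_subset_Icc_self, ?_⟩
  have e1 : ∫ x in Ioo (-r) r, (ε + |x|)⁻¹ = ∫ x, (fun y => (Iio r).indicator (fun y => (ε + y)⁻¹) y) |x| := by
    rw [← integral_indicator measurableSet_Ioo]
    congr 1; ext x
    simp only [Set.indicator, Set.mem_Ioo, Set.mem_Iio, abs_lt]
  rw [e1, integral_comp_abs, setIntegral_indicator measurableSet_Iio]
  congr 1
  have : Ioi (0:ℝ) ∩ Iio r = Ioo 0 r := rfl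
  rw [this, ← integral_Ioc_eq_integral_Ioo, ← intervalIntegral.integral_of_le hr.le]
  have h2 : ∫ y in (0:ℝ)..r, (ε + y)⁻¹ = ∫ y in (ε + 0)..(ε + r), y⁻¹ := by
    rw [intervalIntegral.integral_comp_add_left (fun y => y⁻¹)]
  rw [h2, integral_inv]
  · simp
  · rw [Set.uIcc_of_le (by linarith)]; simp; intro h; linarith

lemma integral_rho_le {K ε s L : ℝ} (hp : Par K ε s L) :
    ∫ x in Ioo (-(3 * s)) (3 * s), (ε + |x|)⁻¹ ≤ 2 * L := by
  have he := hp.he0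
  have hs := hp.hs
  rw [(integral_rho he (by linarith)).2, hp.hL]
  gcongr
  rw [hp.he]
  have := hp.hs1
  nlinarith

lemma integral_rho2 {ε : ℝ} (he : 0 < ε) :
    Integrable (fun x => ((ε + |x|) ^ 2)⁻¹) ∧ ∫ x, ((ε + |x|) ^ 2)⁻¹ = 2 / ε := by
  have hd : ∀ x ∈ Ici (0:ℝ), HasDerivAt (fun y => -(ε + y)⁻¹) (((ε + x) ^ 2)⁻¹) x := by
    intro x hx
    have hx : 0 ≤ x := hx
    have := (((hasDerivAt_id x).const_add ε).inv (by simp; linarith)).neg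
    refine this.congr_deriv ?_
    simp; ring
  have hn : ∀ x ∈ Ioi (0:ℝ), 0 ≤ ((ε + x) ^ 2)⁻¹ := fun x _ => by positivity
  have hl : Tendsto (fun y => -(ε + y)⁻¹) atTop (nhds 0) := by
    have : Tendsto (fun y : ℝ => ε + y) atTop atTop := tendsto_atTop_add_const_left _ _ tendsto_id
    simpa using this.inv_tendsto_atTop.neg
  constructor
  · have h1 : Integrable (fun x => 2 * (ε⁻¹ * PK ε x)) := ((integrable_PK he).const_mul _).const_mul _
    refine h1.mono' (by fun_prop : Measurable _).aestronglyMeasurable (Eventually.of_forall fun x => ?_)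
    rw [Real.norm_eq_abs, abs_of_nonneg (by positivity)]
    unfold PK
    have : 2 * (ε⁻¹ * (ε / (x ^ 2 + ε ^ 2))) = 2 / (x ^ 2 + ε ^ 2) := by field_simp
    rw [this, inv_eq_one_div, div_le_div_iff₀ (by positivity) (by positivity)]
    nlinarith [sq_abs x, sq_nonneg (ε - |x|), abs_nonneg x]
  · rw [integral_comp_abs (f := fun x => ((ε + x) ^ 2)⁻¹), integral_Ioi_of_hasDerivAt_of_nonneg' hd hn hl]
    simp; ring

end


section
open scoped ENNReal Topology

lemma continuous_PK {c : ℝ} (hc : 0 < c) : Continuous (PK c) := by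
  unfold PK
  exact continuous_const.div (by fun_prop) (fun x => (den_pos hc x).ne')

lemma continuous_QK {c : ℝ} (hc : 0 < c) : Continuous (QK c) := by
  unfold QK
  exact continuous_id.div (by fun_prop) (fun x => (den_pos hc x).ne')

lemma PK_comp {ε c : ℝ} (he : 0 < ε) (hc : ε ≤ c) (hc8 : c ≤ 8 * ε) (α : ℝ) : PK c α ≤ 8 * PK ε α := by
  have hc0 := he.trans_le hc
  unfold PK
  rw [← mul_div_assoc, div_le_div_iff₀ (den_pos hc0 _) (den_pos he _)]
  have : ε ^ 2 ≤ c ^ 2 := by gcongr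
  have h2 : 0 ≤ α ^ 2 := sq_nonneg α
  nlinarith [mul_nonneg (sub_nonneg.2 hc8) h2, mul_nonneg hc0.le (sub_nonneg.2 hc), mul_nonneg (sub_nonneg.2 this) he.le,
    mul_nonneg (mul_nonneg hc0.le (sub_nonneg.2 hc)) he.le]

lemma PM {ε c : ℝ} (he : 0 < ε) (hc : ε ≤ c) (hc8 : c ≤ 8 * ε) (α β : ℝ) :
    PK c α * ((|α| + |β|) * PK ε (α - β)) ≤ 64 * (ε / (ε + |β|)) * (PK ε α + PK ε (α - β)) := by
  have h1 := PK_comp he hc hc8 α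
  have hp : 0 ≤ (|α| + |β|) * PK ε (α - β) := by have := PK_nonneg he (α - β); positivity
  refine (mul_le_mul_of_nonneg_right h1 hp).trans ?_
  have hr : 0 < ε + |β| := by positivity
  have ha := den_pos he α
  have hb := den_pos he (α - β)
  have key : (|α| + |β|) * (ε + |β|) ≤ 8 * ((α ^ 2 + ε ^ 2) + ((α - β) ^ 2 + ε ^ 2)) := by
    have h3 : |β| ≤ |α| + |α - β| := by
      have := abs_sub_abs_le_abs_sub β α
      rw [abs_sub_comm β α] at this; linarith
    rw [← sq_abs α, ← sq_abs (α - β)]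
    have := abs_nonneg α
    have := abs_nonneg β
    have := abs_nonneg (α - β)
    calc (|α| + |β|) * (ε + |β|) ≤ (|α| + (|α| + |α - β|)) * (ε + (|α| + |α - β|)) := by gcongr
      _ ≤ _ := by nlinarith [sq_nonneg (|α| - |α - β|), sq_nonneg (|α| - ε), sq_nonneg (|α - β| - ε)]
  have e1 : 8 * PK ε α * ((|α| + |β|) * PK ε (α - β))
      = (8 * ε ^ 2 / ((α ^ 2 + ε ^ 2) * ((α - β) ^ 2 + ε ^ 2) * (ε + |β|))) * ((|α| + |β|) * (ε + |β|)) := by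
    unfold PK; field_simp
  have e2 : 64 * (ε / (ε + |β|)) * (PK ε α + PK ε (α - β))
      = (8 * ε ^ 2 / ((α ^ 2 + ε ^ 2) * ((α - β) ^ 2 + ε ^ 2) * (ε + |β|))) *
        (8 * ((α ^ 2 + ε ^ 2) + ((α - β) ^ 2 + ε ^ 2))) := by
    unfold PK; field_simp; ring
  rw [e1, e2]
  exact mul_le_mul_of_nonneg_left key (by positivity)

lemma Cut.abs_sub_le {K : ℝ} {ψ : ℝ → ℝ} (h : Cut K ψ) {r : ℝ} (hr : 0 < r) (x y : ℝ) :
    |ψ (x / r) - ψ (y / r)| ≤ K * |x - y| / r := by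
  have := h.lip (x / r) (y / r)
  rwa [← sub_div, abs_div, abs_of_pos hr, ← mul_div_assoc] at this

lemma cut_diff {K ε s L : ℝ} (hp : Par K ε s L) {ψ : ℝ → ℝ} (h : Cut K ψ) {r : ℝ} (hr : s / 64 ≤ r)
    (α β : ℝ) : |ψ (α / (s / 128)) * ψ ((α - β) / r) - ψ (β / (s / 128))|
      ≤ 65536 * K * (|α - β| * (|α| + |β|)) / ε := by
  have hs := hp.hs
  have hK := hp.hK
  have he := hp.he0
  have hr0 : 0 < r := by linarith
  have hx0 := abs_nonneg (α - β)
  have ha0 := abs_nonneg α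
  have hb0 := abs_nonneg β
  have tri : |α - β| ≤ |α| + |β| := abs_sub α β
  by_cases hsm : |α| + |β| ≤ s / 256
  · have w : ∀ y : ℝ, ∀ t, 0 < t → |y| ≤ s / 256 → s / 256 ≤ t / 2 → ψ (y / t) = 1 := by
      intro y t ht hy h2
      apply h.one; rw [abs_div, abs_of_pos ht, div_le_iff₀ ht]; linarith
    rw [w α _ (by positivity) (by linarith) (by linarith), w β _ (by positivity) (by linarith) (by linarith),
      w (α - β) r hr0 (by linarith) (by linarith)]
    simp; positivity
  · push Not at hsm
    have h1 := h.abs_sub_le (r := s / 128) (by positivity) α β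
    have h2 := h.abs_sub_le hr0 (α - β) 0
    rw [zero_div, h.one 0 (by norm_num), sub_zero] at h2
    have h3 : K * |α - β| / r ≤ 64 * K * |α - β| / s := by
      rw [div_le_div_iff₀ hr0 hs]
      have : s ≤ 64 * r := by linarith
      calc K * |α - β| * s ≤ K * |α - β| * (64 * r) := by gcongr
        _ = _ := by ring
    have h4 : K * |α - β| / (s / 128) = 128 * K * |α - β| / s := by field_simp
    have h5 : |ψ (α / (s / 128)) * ψ ((α - β) / r) - ψ (β / (s / 128))| ≤ 192 * K * |α - β| / s := by
      have e : ψ (α / (s / 128)) * ψ ((α - β) / r) - ψ (β / (s / 128)) =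
        ψ (α / (s / 128)) * (ψ ((α - β) / r) - 1) + (ψ (α / (s / 128)) - ψ (β / (s / 128))) := by ring
      rw [e]
      refine (abs_add_le _ _).trans ?_
      rw [abs_mul, abs_of_nonneg (h.nn _)]
      have : ψ (α / (s / 128)) * |ψ ((α - β) / r) - 1| ≤ 1 * (64 * K * |α - β| / s) :=
        mul_le_mul (h.le1 _) (h2.trans h3) (abs_nonneg _) zero_le_one
      rw [h4] at h1
      calc _ ≤ 1 * (64 * K * |α - β| / s) + 128 * K * |α - β| / s := by linarith
        _ = _ := by ring
    refine h5.trans ?_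
    rw [hp.he, div_le_div_iff₀ hs (by positivity)]
    have : s ≤ 256 * (|α| + |β|) := by linarith
    calc 192 * K * |α - β| * s ^ 2 = 192 * K * |α - β| * s * s := by ring
      _ ≤ 192 * K * |α - β| * s * (256 * (|α| + |β|)) := by gcongr
      _ = 49152 * (K * |α - β| * s * (|α| + |β|)) := by ring
      _ ≤ 65536 * (K * |α - β| * s * (|α| + |β|)) := by gcongr; norm_num
      _ = _ := by ring

lemma wdiff {K ε x X Y m n D : ℝ} (hK : 1 ≤ K) (he : 0 < ε) (hX : ε ≤ X) (hX2 : X ≤ K * ε) (hD : 0 ≤ D)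
    (hm0 : 0 ≤ m) (hm1 : m ≤ 1) (hmn : |m - n| ≤ 65536 * K * D / ε)
    (hY : m ≠ 0 → ε ≤ Y ∧ Y ≤ K * ε ∧ |Y - X| ≤ 2 * K * D) :
    |m * (Y ^ 2 / (x ^ 2 + Y ^ 2)) - n * (X ^ 2 / (x ^ 2 + X ^ 2))| ≤ 10 ^ 5 * K ^ 3 * (D * PK ε x) := by
  have hX0 := he.trans_le hX
  have hdx := den_pos hX0 x
  have hde := den_pos he x
  have hP := PK_nonneg he x
  have b2 : |(m - n) * (X ^ 2 / (x ^ 2 + X ^ 2))| ≤ 65536 * K ^ 3 * (D * PK ε x) := by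
    rw [abs_mul, abs_of_nonneg (show 0 ≤ X ^ 2 / (x ^ 2 + X ^ 2) by positivity)]
    have : X ^ 2 / (x ^ 2 + X ^ 2) ≤ K ^ 2 * ε ^ 2 / (x ^ 2 + ε ^ 2) := by
      apply div_le_div₀ (by positivity) _ hde (by gcongr)
      rw [← mul_pow]; gcongr
    calc |m - n| * (X ^ 2 / (x ^ 2 + X ^ 2)) ≤ (65536 * K * D / ε) * (K ^ 2 * ε ^ 2 / (x ^ 2 + ε ^ 2)) := by gcongr
      _ = _ := by unfold PK; field_simp
  have b1 : |m * (Y ^ 2 / (x ^ 2 + Y ^ 2) - X ^ 2 / (x ^ 2 + X ^ 2))| ≤ 4 * K ^ 2 * (D * PK ε x) := by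
    by_cases hm : m = 0
    · rw [hm]; simp; positivity
    obtain ⟨hY1, hY2, hYX⟩ := hY hm
    have hY0 := he.trans_le hY1
    have hdy := den_pos hY0 x
    have e : Y ^ 2 / (x ^ 2 + Y ^ 2) - X ^ 2 / (x ^ 2 + X ^ 2)
        = (x ^ 2 / (x ^ 2 + X ^ 2)) * ((Y - X) * (Y + X) / (x ^ 2 + Y ^ 2)) := by field_simp; ring
    rw [e, abs_mul, abs_mul, abs_of_nonneg hm0, abs_of_nonneg (show 0 ≤ x ^ 2 / (x ^ 2 + X ^ 2) by positivity),
      abs_div, abs_mul, abs_of_pos (show 0 < Y + X by positivity), abs_of_pos hdy]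
    have c1 : x ^ 2 / (x ^ 2 + X ^ 2) ≤ 1 := by rw [div_le_one hdx]; nlinarith
    have c2 : |Y - X| * (Y + X) / (x ^ 2 + Y ^ 2) ≤ (2 * K * D) * (2 * K * ε) / (x ^ 2 + ε ^ 2) := by
      apply div_le_div₀ (by positivity) _ hde (by gcongr)
      gcongr; linarith
    calc _ ≤ 1 * (1 * ((2 * K * D) * (2 * K * ε) / (x ^ 2 + ε ^ 2))) := by gcongr
      _ = _ := by unfold PK; field_simp; ring
  have e : m * (Y ^ 2 / (x ^ 2 + Y ^ 2)) - n * (X ^ 2 / (x ^ 2 + X ^ 2)) =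
    m * (Y ^ 2 / (x ^ 2 + Y ^ 2) - X ^ 2 / (x ^ 2 + X ^ 2)) + (m - n) * (X ^ 2 / (x ^ 2 + X ^ 2)) := by ring
  rw [e]
  refine (abs_add_le _ _).trans ((add_le_add b1 b2).trans ?_)
  have : K ^ 2 ≤ K ^ 3 := pow_le_pow_right₀ hK (by norm_num)
  have h0 : 0 ≤ D * PK ε x := by positivity
  have hK3 : 0 ≤ K ^ 3 := by positivity
  nlinarith [mul_nonneg (sub_nonneg.2 this) h0, mul_nonneg hK3 h0]

lemma trunc_PK {c β : ℝ} (hc : 0 < c) (hβ : β ≠ 0) :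
    Tendsto (fun r => ∫ t in {t : ℝ | r < |β - t|}, PK c t / (β - t)) (𝓝[>] 0) (𝓝 (π * QK c β)) := by
  have i1 : ∀ {g : ℝ → ℝ}, Measurable g → (∃ C, ∀ t, |g t| ≤ C) → Integrable (fun t => g t * PK c t) := by
    rintro g hg ⟨C, hC⟩
    exact (integrable_PK hc).bdd_mul hg.aestronglyMeasurable (Eventually.of_forall hC)
  have h := LP_trunc (u := PK c) (α := β) (measurable_PK c)
    (by
      have := i1 (measurable_PK 1) ⟨1, fun t => by
        rw [abs_of_nonneg (PK_nonneg one_pos t)]; simpa using PK_le one_pos t⟩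
      refine this.congr (Eventually.of_forall fun t => mul_comm _ _))
    (fun a ha α => i1 ((measurable_QK a).comp (by fun_prop)) ⟨a⁻¹, fun t => abs_QK_le ha _⟩)
    (lebPt_of_continuousAt (continuous_PK hc).continuousAt)
  have h2 : Tendsto (fun a => ∫ t, QK a (β - t) * PK c t) (𝓝[>] 0) (𝓝 (π * QK c β)) := by
    have e : ∀ a ∈ Ioi (0:ℝ), π * QK (c + a) β = ∫ t, QK a (β - t) * PK c t := by
      intro a ha
      rw [← integral_PQ hc ha hβ, ← integral_sub_left_eq_self _ _ β]
      congr 1; ext t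
      rw [show β - t - β = -t by ring, PK_neg, mul_comm]
    refine Tendsto.congr' (eventually_nhdsWithin_of_forall e) ?_
    have : ContinuousAt (fun a => π * QK (c + a) β) 0 := by
      unfold QK
      refine ContinuousAt.mul continuousAt_const (ContinuousAt.div continuousAt_const (by fun_prop) ?_)
      have := den_pos hc β; simp; positivity
    have h3 := this.tendsto.mono_left (nhdsWithin_le_nhds (s := Ioi 0))
    simpa using h3
  simpa using h.add h2

lemma integral_PQ2 {c X β : ℝ} (hc : 0 < c) (hX : 0 < X) (hβ : β ≠ 0) :
    Integrable (fun α => QK X (α - β) * PK c α) ∧ ∫ α, QK X (α - β) * PK c α = -(π * QK (c + X) β) := by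
  constructor
  · exact (integrable_PK hc).bdd_mul ((measurable_QK X).comp (by fun_prop)).aestronglyMeasurable
      (c := X⁻¹) (Eventually.of_forall fun t => by simpa using abs_QK_le hX _)
  · have h := integral_PQ hc hX (neg_ne_zero.2 hβ)
    rw [QK_neg] at h
    rw [← integral_add_right_eq_self _ β]
    have : ∫ x, QK X (x + β - β) * PK c (x + β) = ∫ x, PK c (x - -β) * QK X x := by
      congr 1; ext x; rw [show x + β - β = x by ring, show x - -β = x + β by ring, mul_comm]
    rw [this, h]; ring

lemma trunc_integrable {R : ℝ → ℝ} (hR : Integrable R) (β : ℝ) :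
    Tendsto (fun r => ∫ t in {t : ℝ | r < |β - t|}, R t) (𝓝[>] 0) (𝓝 (∫ t, R t)) := by
  have hm : ∀ r : ℝ, MeasurableSet {t : ℝ | r < |β - t|} := fun r =>
    measurableSet_lt measurable_const (by fun_prop)
  have e : ∀ r, ∫ t in {t : ℝ | r < |β - t|}, R t = ∫ t, ({t : ℝ | r < |β - t|}).indicator R t := fun r =>
    (integral_indicator (hm r)).symm
  simp_rw [e]
  refine tendsto_integral_filter_of_dominated_convergence (fun t => |R t|) ?_ ?_ hR.abs ?_
  · exact Eventually.of_forall fun r => hR.aestronglyMeasurable.indicator (hm r)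
  · refine Eventually.of_forall fun r => Eventually.of_forall fun t => ?_
    exact norm_indicator_le_norm_self _ _
  · have : ∀ᵐ t : ℝ, t ≠ β := by simp [ae_iff]
    filter_upwards [this] with t ht
    have hpos : 0 < |β - t| := abs_pos.2 (sub_ne_zero.2 ht.symm)
    refine tendsto_const_nhds.congr' ?_
    filter_upwards [nhdsWithin_le_nhds (Iio_mem_nhds hpos)] with r hr
    rw [Set.indicator_of_mem]; exact hr

end


section
open scoped ENNReal Topology

structure HH (ε s c C1 : ℝ) (H : ℝ → ℝ) : Prop where
  meas : Measurable H
  bd : ∀ β, |H β + π * qc ε c β| ≤ C1 * ε / (ε + |β|)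
  supp : ∀ β, s ≤ |β| → H β = 0

lemma pvI_eq {F : ℝ → ℝ} {α l : ℝ}
    (h : Tendsto (fun r => ∫ β in {β : ℝ | r < |α - β|}, F β) (𝓝[>] 0) (𝓝 l)) : pvI F α = l :=
  h.limUnder_eq

def RH (ψ : ℝ → ℝ) (ε s c : ℝ) (f g : ℝ → ℝ) (α β : ℝ) : ℝ :=
  (α - β)⁻¹ * (ψ (α / (s / 128)) * ψ ((α - β) / (s / 64)) * ((2 * ε + f α + g α) ^ 2 / ((α - β) ^ 2 + (2 * ε + f α + g α) ^ 2))
    - ψ (β / (s / 128)) * ((2 * ε + f β + g β) ^ 2 / ((α - β) ^ 2 + (2 * ε + f β + g β) ^ 2))) * PK c α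

lemma measurable_RH {ψ : ℝ → ℝ} {ε s c : ℝ} {f g : ℝ → ℝ} (hψ : Measurable ψ) (hf : Measurable f) (hg : Measurable g) :
    Measurable (fun p : ℝ × ℝ => RH ψ ε s c f g p.2 p.1) := by
  unfold RH PK
  fun_prop

lemma Cut.of_ne {K : ℝ} {ψ : ℝ → ℝ} (h : Cut K ψ) {r x : ℝ} (hr : 0 < r) (hx : ψ (x / r) ≠ 0) : |x| < r := by
  by_contra hc
  push Not at hc
  apply hx; apply h.supp
  rw [abs_div, abs_of_pos hr, le_div_iff₀ hr]; linarith

lemma PK_pair_int {ε : ℝ} (he : 0 < ε) (β : ℝ) : Integrable (fun α => PK ε α + PK ε (α - β)) ∧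
    ∫ α, (PK ε α + PK ε (α - β)) = 2 * π := by
  have h1 := integrable_PK he
  have h2 : Integrable (fun α => PK ε (α - β)) := h1.comp_sub_right β
  refine ⟨h1.add h2, ?_⟩
  rw [integral_add h1 h2, integral_sub_right_eq_self (PK ε) β, integral_PK he]; ring

lemma RH_bound {K ε s L c : ℝ} (hp : Par K ε s L) {ψ f g f1 f2 g1 g2 : ℝ → ℝ} (hψ : Cut K ψ)
    (hf : Fn K s f f1 f2) (hg : Fn K s g g1 g2) (hfg : PairFG K ε s f g) (hc : ε ≤ c) (hc8 : c ≤ 8 * ε)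
    {β : ℝ} (hβ : |β| < 4 * s) (α : ℝ) :
    |RH ψ ε s c f g α β| ≤ 64 * 10 ^ 5 * K ^ 3 * (ε / (ε + |β|)) * (PK ε α + PK ε (α - β)) := by
  have he := hp.he0
  have hs := hp.hs
  have hK := hp.hK
  have hPc := PK_nonneg (he.trans_le hc) α
  have hPx := PK_nonneg he (α - β)
  have h := wdiff (x := α - β) (Y := 2 * ε + f α + g α) hK he (hfg.lo β β hβ hβ) (hfg.hi β β hβ hβ)
    (D := |α - β| * (|α| + |β|)) (m := ψ (α / (s / 128)) * ψ ((α - β) / (s / 64))) (n := ψ (β / (s / 128)))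
    (by positivity) (mul_nonneg (hψ.nn _) (hψ.nn _)) (mul_le_one₀ (hψ.le1 _) (hψ.nn _) (hψ.le1 _))
    (cut_diff hp hψ le_rfl α β) (by
      intro hm
      have ha : |α| < 4 * s := by
        have := hψ.of_ne (by positivity) (left_ne_zero_of_mul hm); linarith
      refine ⟨hfg.lo α α ha ha, hfg.hi α α ha ha, ?_⟩
      have h1 := hf.lip α β ha hβ
      have h2 := hg.lip α β ha hβ
      rw [show 2 * ε + f α + g α - (2 * ε + f β + g β) = (f α - f β) + (g α - g β) by ring]
      refine (abs_add_le _ _).trans ?_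
      linarith)
  unfold RH
  rw [abs_mul, abs_mul, abs_inv, abs_of_nonneg hPc]
  by_cases hx : α - β = 0
  · rw [hx]; simp only [abs_zero, inv_zero, zero_mul]
    have := PK_nonneg he α; have := PK_nonneg he 0; positivity
  have hxa : 0 < |α - β| := abs_pos.2 hx
  calc _ ≤ |α - β|⁻¹ * (10 ^ 5 * K ^ 3 * (|α - β| * (|α| + |β|) * PK ε (α - β))) * PK c α := by gcongr
    _ = 10 ^ 5 * K ^ 3 * (PK c α * ((|α| + |β|) * PK ε (α - β))) := by field_simp
    _ ≤ 10 ^ 5 * K ^ 3 * (64 * (ε / (ε + |β|)) * (PK ε α + PK ε (α - β))) :=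
      mul_le_mul_of_nonneg_left (PM he hc hc8 α β) (by positivity)
    _ = _ := by ring

theorem Hstar_HH {K ε s L c : ℝ} (hp : Par K ε s L) {ψ f g f1 f2 g1 g2 : ℝ → ℝ} (hψ : Cut K ψ)
    (hf : Fn K s f f1 f2) (hg : Fn K s g g1 g2) (hfg : PairFG K ε s f g) (hc : ε ≤ c) (hc8 : c ≤ 8 * ε) :
    ∃ H, HH ε s c (10 ^ 9 * K ^ 3) H ∧ ∀ κ : ℝ, ∀ᵐ β,
      Hstar ψ ε f g (fun α => κ * (ψ (α / (s / 128)) * PK c α)) β = (2 * π)⁻¹ * (κ * H β) := by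
  have he := hp.he0
  have hs := hp.hs
  have hK := hp.hK
  have hc0 := he.trans_le hc
  have hss : Real.sqrt ε = s := by rw [hp.he]; exact Real.sqrt_sq hs.le
  have e26 : ∀ x : ℝ, x / (s / 2 ^ 6) = x / (s / 64) := fun x => by norm_num
  have hmR := measurable_RH (ε := ε) (s := s) (c := c) hψ.m hf.mf hg.mf
  have hRi : ∀ β, |β| < 4 * s → Integrable (fun α => RH ψ ε s c f g α β) ∧
      |∫ α, RH ψ ε s c f g α β| ≤ 64 * 10 ^ 5 * K ^ 3 * (ε / (ε + |β|)) * (2 * π) := by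
    intro β hβ
    have hb := RH_bound hp hψ hf hg hfg hc hc8 hβ
    obtain ⟨i1, i2⟩ := PK_pair_int he β
    refine ⟨(i1.const_mul _).mono' (hmR.comp (measurable_const.prodMk measurable_id)).aestronglyMeasurable
      (Eventually.of_forall hb), ?_⟩
    rw [← i2, ← integral_const_mul, ← Real.norm_eq_abs]
    exact norm_integral_le_of_norm_le (i1.const_mul _) (Eventually.of_forall hb)
  have hpi := Real.pi_pos
  have hpi4 := Real.pi_lt_four
  have hK23 : K ^ 2 ≤ K ^ 3 := pow_le_pow_right₀ hK (by norm_num)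
  have hK3 : 1 ≤ K ^ 3 := one_le_pow₀ hK
  let H0 : ℝ → ℝ := fun β => ψ (β / (s / 128)) * (-(π * (QK c β - QK (c + (2 * ε + f β + g β)) β)))
    + ∫ α, RH ψ ε s c f g α β
  have hH0m : Measurable H0 := by
    have h1 : Measurable (fun β => ∫ α, RH ψ ε s c f g α β) :=
      (hmR.stronglyMeasurable.integral_prod_right').measurable
    have h2 : Measurable (fun β => ψ (β / (s / 128)) * (-(π * (QK c β - QK (c + (2 * ε + f β + g β)) β)))) := by
      have := hf.mf; have := hg.mf; have := hψ.m
      unfold QK; fun_prop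
    exact h2.add h1
  have hms : MeasurableSet {β : ℝ | |β| < s} := measurableSet_lt (by fun_prop) measurable_const
  refine ⟨fun β => ({β : ℝ | |β| < s}).indicator H0 β, ⟨hH0m.indicator hms, ?_, ?_⟩, ?_⟩
  · intro β
    have hr : 0 < ε + |β| := by positivity
    have t0 : 0 ≤ ε / (ε + |β|) := by positivity
    by_cases hβ : |β| < s
    · rw [Set.indicator_of_mem (show β ∈ {β : ℝ | |β| < s} from hβ)]
      have hβ4 : |β| < 4 * s := by linarith
      have hX1 := hfg.lo β β hβ4 hβ4
      have hX2 := hfg.hi β β hβ4 hβ4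
      have hXb : |2 * ε + f β + g β - 2 * ε| ≤ 2 * K * β ^ 2 := by
        rw [show 2 * ε + f β + g β - 2 * ε = f β + g β by ring]
        refine (abs_add_le _ _).trans ?_
        linarith [hf.abs_le hs hβ4, hg.abs_le hs hβ4]
      have b1 := QX_bound (s := s) hK he hc hc8 hX1 hX2 hXb
      have b3 := (hRi β hβ4).2
      have b2 : |(1 - ψ (β / (s / 128))) * (π * qc ε c β)| ≤ 4 * 10 ^ 7 * (ε / (ε + |β|)) := by
        by_cases hb2 : s / 256 ≤ |β|
        · have := qc_bound1 hp hc hc8 hb2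
          rw [abs_mul, abs_mul, abs_of_pos hpi, abs_of_nonneg (by linarith [hψ.le1 (β / (s / 128))])]
          have h0 := hψ.nn (β / (s / 128))
          calc _ ≤ 1 * (4 * (10 ^ 7 * ε / (ε + |β|))) := by gcongr; linarith
            _ = _ := by ring
        · rw [hψ.one]
          · simp; positivity
          · push Not at hb2
            rw [abs_div, abs_of_pos (by positivity : 0 < s / 128), div_le_iff₀ (by positivity)]; linarith
      have e : H0 β + π * qc ε c β = ψ (β / (s / 128)) * (π * (QK (c + (2 * ε + f β + g β)) β - QK (c + 2 * ε) β))
          + (1 - ψ (β / (s / 128))) * (π * qc ε c β) + ∫ α, RH ψ ε s c f g α β := by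
        simp only [H0, qc]; ring
      rw [e]
      have b1' : |ψ (β / (s / 128)) * (π * (QK (c + (2 * ε + f β + g β)) β - QK (c + 2 * ε) β))|
          ≤ 640 * K ^ 2 * (ε / (ε + |β|)) := by
        rw [abs_mul, abs_mul, abs_of_pos hpi, abs_of_nonneg (hψ.nn _)]
        calc _ ≤ 1 * (4 * (160 * K ^ 2 * ε / (ε + |β|))) := by gcongr; exact hψ.le1 _
          _ = _ := by ring
      refine (abs_add_three _ _ _).trans ?_
      have b3' : 64 * 10 ^ 5 * K ^ 3 * (ε / (ε + |β|)) * (2 * π) ≤ 64 * 10 ^ 5 * K ^ 3 * (ε / (ε + |β|)) * 8 := by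
        gcongr; linarith
      have e4 : 10 ^ 9 * K ^ 3 * ε / (ε + |β|) = 10 ^ 9 * K ^ 3 * (ε / (ε + |β|)) := by ring
      rw [e4]
      have h5 := mul_le_mul_of_nonneg_right hK23 t0
      have h6 := mul_le_mul_of_nonneg_right hK3 t0
      linarith
    · rw [Set.indicator_of_notMem (by simpa using hβ), zero_add, abs_mul, abs_of_pos hpi]
      push Not at hβ
      have := qc_bound1 hp hc hc8 (by linarith : s / 256 ≤ |β|)
      calc π * |qc ε c β| ≤ 4 * (10 ^ 7 * ε / (ε + |β|)) := by gcongr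
        _ = 4 * 10 ^ 7 * (1 * (ε / (ε + |β|))) := by ring
        _ ≤ 4 * 10 ^ 7 * (K ^ 3 * (ε / (ε + |β|))) := by gcongr
        _ ≤ 10 ^ 9 * (K ^ 3 * (ε / (ε + |β|))) := by gcongr; norm_num
        _ = _ := by ring
  · intro β hβ
    exact Set.indicator_of_notMem (by simpa using hβ) _
  · intro κ
    have hne : ∀ᵐ β : ℝ, β ≠ 0 := by simp [ae_iff]
    filter_upwards [hne] with β hβ0
    unfold Hstar
    congr 1
    by_cases hβ : |β| < s
    · rw [Set.indicator_of_mem (show β ∈ {β : ℝ | |β| < s} from hβ)]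
      have hβ4 : |β| < 4 * s := by linarith
      have hX0 := he.trans_le (hfg.lo β β hβ4 hβ4)
      apply pvI_eq
      have t1 := (trunc_PK hc0 hβ0).neg
      obtain ⟨q1, q2⟩ := integral_PQ2 hc0 hX0 hβ0
      have t2 := trunc_integrable q1 β
      rw [q2] at t2
      have t3 := trunc_integrable (hRi β hβ4).1 β
      have t := (((t1.sub t2).const_mul (ψ (β / (s / 128)))).add t3).const_mul κ
      have el : κ * (ψ (β / (s / 128)) * (-(π * QK c β) - -(π * QK (c + (2 * ε + f β + g β)) β)) +
          ∫ α, RH ψ ε s c f g α β) = κ * H0 β := by simp only [H0]; ring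
      rw [el] at t
      refine t.congr' ?_
      refine eventually_nhdsWithin_of_forall fun r hr => ?_
      have hr : 0 < r := hr
      have hmr : MeasurableSet {t : ℝ | r < |β - t|} := measurableSet_lt measurable_const (by fun_prop)
      have i1 : IntegrableOn (fun t => PK c t / (β - t)) {t : ℝ | r < |β - t|} := by
        have hb : Integrable (fun t => ({t : ℝ | r < |β - t|}).indicator (fun t => (β - t)⁻¹) t * PK c t) := by
          refine (integrable_PK hc0).bdd_mul (c := r⁻¹) ((by fun_prop : Measurable fun t : ℝ => (β - t)⁻¹).indicator hmr).aestronglyMeasurable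
            (Eventually.of_forall fun t => ?_)
          rw [Set.indicator_apply]
          split_ifs with h
          · rw [norm_inv]; exact inv_anti₀ hr (le_of_lt h)
          · simp; exact hr.le
        refine (integrable_indicator_iff hmr).1 (hb.congr (Eventually.of_forall fun t => ?_))
        simp only [Set.indicator_apply]
        split_ifs
        · rw [div_eq_mul_inv, mul_comm]
        · simp
      beta_reduce
      have i1n : IntegrableOn (fun t => -(PK c t / (β - t))) {t : ℝ | r < |β - t|} := i1.neg
      have i2 : IntegrableOn (fun t => ψ (β / (s / 128)) * (-(PK c t / (β - t)) - QK (2 * ε + f β + g β) (t - β) * PK c t))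
        {t : ℝ | r < |β - t|} := (i1n.sub q1.integrableOn).const_mul _
      rw [← integral_neg, ← integral_sub i1n q1.integrableOn, ← integral_const_mul,
        ← integral_add i2 (hRi β hβ4).1.integrableOn, ← integral_const_mul]
      refine setIntegral_congr_fun hmr fun α hα => ?_
      have hx : α - β ≠ 0 := by
        intro h0
        have : r < |β - α| := hα
        rw [abs_sub_comm, h0, abs_zero] at this; linarith
      have hx' : β - α ≠ 0 := by intro h0; apply hx; linarith
      have hd := den_pos hX0 (α - β)
      simp only [Hker, Xt, scut, hss, e26, RH]
      have hcut : ψ (α / (s / 64)) * ψ (α / (s / 128)) = ψ (α / (s / 128)) := by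
        by_cases h0 : ψ (α / (s / 128)) = 0
        · rw [h0, mul_zero]
        · have := hψ.of_ne (by positivity) h0
          rw [hψ.one (α / (s / 64)), one_mul]
          rw [abs_div, abs_of_pos (by positivity : 0 < s / 64), div_le_iff₀ (by positivity)]; linarith
      have hw : (α - β)⁻¹ * ((2 * ε + f β + g β) ^ 2 / ((α - β) ^ 2 + (2 * ε + f β + g β) ^ 2))
          = (α - β)⁻¹ - QK (2 * ε + f β + g β) (α - β) := by
        unfold QK; field_simp; ring
      have hinv : PK c α / (β - α) = -((α - β)⁻¹ * PK c α) := by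
        rw [show β - α = -(α - β) by ring, div_neg, div_eq_mul_inv, mul_comm]
      generalize hW : (2 * ε + f α + g α) ^ 2 / ((α - β) ^ 2 + (2 * ε + f α + g α) ^ 2) = W at *
      generalize hV : (2 * ε + f β + g β) ^ 2 / ((α - β) ^ 2 + (2 * ε + f β + g β) ^ 2) = V at *
      rw [hinv]
      linear_combination (-κ * ψ (β / (s / 128)) * PK c α) * hw - κ * (α - β)⁻¹ * W * ψ ((α - β) / (s / 64)) * PK c α * hcut
    · rw [Set.indicator_of_notMem (by simpa using hβ), mul_zero]
      apply pvI_eq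
      refine tendsto_const_nhds.congr fun r => ?_
      have : ∀ α, Hker ψ ε f g α β * (κ * (ψ (α / (s / 128)) * PK c α)) = 0 := by
        intro α
        simp only [Hker, scut, hss, e26]
        by_cases h0 : ψ (α / (s / 128)) = 0
        · rw [h0]; ring
        · have h1 := hψ.of_ne (by positivity) h0
          have h2 : ψ ((α - β) / (s / 64)) = 0 := by
            by_contra h3
            have h4 := hψ.of_ne (by positivity) h3
            apply hβ
            have := abs_sub_abs_le_abs_sub β α
            rw [abs_sub_comm β α] at this; linarith
          rw [h2]; ring
      simp [this]

end


section
open scoped ENNReal Topology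

lemma BC.int_le {u : ℝ → ℝ} {M R : ℝ} (h : BC u M R) {g G : ℝ → ℝ} (hg : Measurable g)
    (hG : IntegrableOn G (Icc (-R) R)) (hb : ∀ᵐ t, |t| ≤ R → |g t| ≤ G t) :
    Integrable (fun t => g t * u t) ∧ |∫ t, g t * u t| ≤ M * ∫ t in Icc (-R) R, G t := by
  have hM := h.M_nonneg
  have hi : Integrable (fun t => M * (Icc (-R) R).indicator G t) :=
    ((integrable_indicator_iff measurableSet_Icc).2 hG).const_mul M
  have hle : ∀ᵐ t, ‖g t * u t‖ ≤ M * (Icc (-R) R).indicator G t := by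
    filter_upwards [hb] with t ht
    by_cases hR : |t| ≤ R
    · rw [Set.indicator_of_mem (show t ∈ Icc (-R) R from abs_le.1 hR), norm_mul, mul_comm]
      exact mul_le_mul (h.bd t) (ht hR) (abs_nonneg _) hM
    · rw [Set.indicator_of_notMem (show t ∉ Icc (-R) R from fun hc => hR (abs_le.2 hc)), h.supp t (by linarith)]; simp
  refine ⟨hi.mono' (hg.mul h.meas).aestronglyMeasurable hle, ?_⟩
  rw [← Real.norm_eq_abs]
  refine (norm_integral_le_of_norm_le hi hle).trans_eq ?_
  rw [integral_const_mul, integral_indicator measurableSet_Icc]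

lemma BC.int_const {u : ℝ → ℝ} {M R : ℝ} (h : BC u M R) (hR : 0 ≤ R) {g : ℝ → ℝ} {c : ℝ} (hg : Measurable g)
    (hb : ∀ᵐ t, |t| ≤ R → |g t| ≤ c) :
    Integrable (fun t => g t * u t) ∧ |∫ t, g t * u t| ≤ M * (c * (2 * R)) := by
  have := h.int_le (G := fun _ => c) hg (by simp) hb
  refine ⟨this.1, this.2.trans_eq ?_⟩
  rw [setIntegral_const, smul_eq_mul, measureReal_def, Real.volume_Icc, ENNReal.toReal_ofReal (by linarith)]
  ring

lemma rho_2s {K ε s L : ℝ} (hp : Par K ε s L) : IntegrableOn (fun x => (ε + |x|)⁻¹) (Icc (-(2 * s)) (2 * s)) ∧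
    ∫ x in Icc (-(2 * s)) (2 * s), (ε + |x|)⁻¹ ≤ 2 * L := by
  have he := hp.he0
  have hs := hp.hs
  have h := (integral_rho he (by linarith : 0 < 3 * s)).1
  have hsub : Icc (-(2 * s)) (2 * s) ⊆ Ioo (-(3 * s)) (3 * s) := fun x hx => ⟨by linarith [hx.1], by linarith [hx.2]⟩
  refine ⟨h.mono_set hsub, (setIntegral_mono_set h ?_ (LE.le.eventuallyLE hsub)).trans (integral_rho_le hp)⟩
  exact Eventually.of_forall fun x => by simp only [Pi.zero_apply]; positivity

lemma BC.int_rho {K ε s L : ℝ} (hp : Par K ε s L) {u : ℝ → ℝ} {M : ℝ} (h : BC u M (2 * s)) {g : ℝ → ℝ} {c : ℝ}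
    (hc : 0 ≤ c) (hg : Measurable g) (hb : ∀ᵐ t, |t| ≤ 2 * s → |g t| ≤ c * (ε + |t|)⁻¹) :
    Integrable (fun t => g t * u t) ∧ |∫ t, g t * u t| ≤ 2 * c * M * L := by
  obtain ⟨r1, r2⟩ := rho_2s hp
  have := h.int_le (G := fun t => c * (ε + |t|)⁻¹) hg (r1.const_mul c) hb
  refine ⟨this.1, this.2.trans ?_⟩
  rw [integral_const_mul]
  have hM := h.M_nonneg
  calc M * (c * _) ≤ M * (c * (2 * L)) := by gcongr
    _ = _ := by ring

lemma BC.mono_R {u : ℝ → ℝ} {M R R' : ℝ} (h : BC u M R) (hR : R ≤ R') : BC u M R' :=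
  ⟨h.meas, h.bd, fun t ht => h.supp t (by linarith)⟩

lemma measurable_iG {G : ℝ × ℝ → ℝ} (hG : Measurable G) : Measurable (fun α => ∫ β, G (α, β)) :=
  (hG.stronglyMeasurable.integral_prod_right').measurable

lemma AMGM {e v : ℝ → ℝ} (he : Measurable e) (hv : Measurable v) (he2 : Integrable (fun x => e x ^ 2))
    (hv2 : Integrable (fun x => v x ^ 2)) : Integrable (fun x => e x * v x) ∧
      |∫ x, e x * v x| ≤ (∫ x, e x ^ 2) + ∫ x, v x ^ 2 := by
  have hi := he2.add hv2
  have hb : ∀ᵐ x, ‖e x * v x‖ ≤ e x ^ 2 + v x ^ 2 := Eventually.of_forall fun x => by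
    rw [Real.norm_eq_abs, abs_le]
    constructor <;> nlinarith [sq_nonneg (e x - v x), sq_nonneg (e x + v x)]
  refine ⟨hi.mono' (he.mul hv).aestronglyMeasurable hb, ?_⟩
  rw [← Real.norm_eq_abs, ← integral_add he2 hv2]
  exact norm_integral_le_of_norm_le hi hb

section
variable {K ε s L c C1 : ℝ} {H : ℝ → ℝ}

lemma qc_abs (he : 0 < ε) (hc : ε ≤ c) (hc8 : c ≤ 8 * ε) (β : ℝ) :
    |qc ε c β| ≤ 144 / ε := by
  refine (qc_bound he hc hc8 β).trans ?_
  rw [div_le_div_iff₀ (by positivity) he]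
  have : ε ^ 3 ≤ (ε + |β|) ^ 3 := by gcongr; linarith [abs_nonneg β]
  nlinarith

lemma HH.C1_nonneg (h : HH ε s c C1 H) (he : 0 < ε) : 0 ≤ C1 := by
  have := (abs_nonneg _).trans (h.bd 0)
  rw [abs_zero, add_zero, mul_div_assoc, div_self he.ne', mul_one] at this; exact this

lemma HH.toBC (h : HH ε s c C1 H) (he : 0 < ε) (hc : ε ≤ c) (hc8 : c ≤ 8 * ε) :
    BC H (π * (144 / ε) + C1) s := by
  refine ⟨h.meas, fun t => ?_, fun t ht => h.supp t ht.le⟩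
  have h1 := h.bd t
  have h2 := qc_abs he hc hc8 t
  have h0 := h.C1_nonneg he
  have h3 : C1 * ε / (ε + |t|) ≤ C1 := by
    rw [div_le_iff₀ (by positivity)]; nlinarith [abs_nonneg t, mul_nonneg h0 (abs_nonneg t)]
  have h4 : |π * qc ε c t| ≤ π * (144 / ε) := by
    rw [abs_mul, abs_of_pos Real.pi_pos]; exact mul_le_mul_of_nonneg_left h2 Real.pi_pos.le
  calc |H t| = |(H t + π * qc ε c t) - π * qc ε c t| := by congr 1; ring
    _ ≤ _ := abs_sub _ _
    _ ≤ _ := by linarith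

/-- critical lemma -/
lemma CRIT (hp : Par K ε s L) (h : HH ε s c C1 H) (hc : ε ≤ c) (hc8 : c ≤ 8 * ε) {Θ : ℝ → ℝ} {M Λ : ℝ}
    (hΘ : Measurable Θ) (hM : ∀ α, |α| < s → |Θ α| ≤ M) (hΛ : ∀ α, |α| < s → |Θ α - Θ 0| ≤ Λ * (|α| + ε)) :
    Integrable (fun α => H α * Θ α) ∧ |∫ α, H α * Θ α| ≤ 1152 * Λ * ε + 2 * C1 * M * (ε * L) := by
  have he := hp.he0
  have hs := hp.hs
  have hB := h.toBC he hc hc8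
  have hC1 := h.C1_nonneg he
  have hM0 : 0 ≤ M := (abs_nonneg _).trans (hM 0 (by simpa using hs))
  have hΛ0 : 0 ≤ Λ := by
    have := (abs_nonneg _).trans (hΛ 0 (by simpa using hs))
    rw [abs_zero, zero_add] at this
    exact nonneg_of_mul_nonneg_left this he
  set I : Set ℝ := Ioo (-s) s with hI
  have mI : MeasurableSet I := measurableSet_Ioo
  have memI : ∀ {x}, x ∈ I ↔ |x| < s := fun {x} => by rw [hI, Set.mem_Ioo, abs_lt]
  -- Θ restricted
  have bΘ : BC (I.indicator Θ) M s := by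
    refine ⟨hΘ.indicator mI, fun t => ?_, fun t ht => ?_⟩
    · by_cases ht : t ∈ I
      · rw [Set.indicator_of_mem ht]; exact hM t (memI.1 ht)
      · rw [Set.indicator_of_notMem ht, abs_zero]; exact hM0
    · rw [Set.indicator_of_notMem (fun hc => by have := memI.1 hc; linarith)]
  have e0 : ∀ α, H α * Θ α = H α * I.indicator Θ α := by
    intro α
    by_cases ht : α ∈ I
    · rw [Set.indicator_of_mem ht]
    · rw [h.supp α (not_lt.1 fun hc => ht (memI.2 hc))]; ring
  have i0 : Integrable (fun α => H α * I.indicator Θ α) :=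
    (bΘ.int_const hs.le h.meas (Eventually.of_forall fun t _ => hB.bd t)).1
  simp_rw [e0]
  refine ⟨i0, ?_⟩
  -- decomposition
  have me : Measurable (fun α => H α + π * qc ε c α) := h.meas.add ((measurable_qc ε c).const_mul _)
  have p1 := (bΘ.mono_R (by linarith : s ≤ 2 * s)).int_rho hp (c := C1 * ε) (by positivity) me
    (Eventually.of_forall fun t _ => by have := h.bd t; rwa [div_eq_mul_inv] at this)
  have i2 : Integrable (fun α => qc ε c α * I.indicator Θ α) :=
    (bΘ.int_const hs.le (measurable_qc ε c) (Eventually.of_forall fun t _ => qc_abs he hc hc8 t)).1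
  have e1 : ∫ α, H α * I.indicator Θ α = (∫ α, (H α + π * qc ε c α) * I.indicator Θ α)
      - π * ∫ α, qc ε c α * I.indicator Θ α := by
    rw [← integral_const_mul, ← integral_sub p1.1 (i2.const_mul _)]
    congr 1; ext α; ring
  -- the odd part
  have iq : Integrable (fun α => I.indicator (qc ε c) α) := by
    have b1 : BC (I.indicator (fun _ => (1:ℝ))) 1 s := by
      refine ⟨measurable_const.indicator mI, fun t => ?_, fun t ht => ?_⟩
      · by_cases ht : t ∈ I
        · rw [Set.indicator_of_mem ht]; simp
        · rw [Set.indicator_of_notMem ht]; simp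
      · rw [Set.indicator_of_notMem (fun hc => by have := memI.1 hc; linarith)]
    refine (b1.int_const hs.le (measurable_qc ε c) (Eventually.of_forall fun t _ => qc_abs he hc hc8 t)).1.congr
      (Eventually.of_forall fun t => ?_)
    by_cases ht : t ∈ I
    · simp [ht]
    · simp [ht]
  have iq0 : ∫ α, I.indicator (qc ε c) α = 0 := by
    have h1 : ∫ α, I.indicator (qc ε c) (-α) = ∫ α, I.indicator (qc ε c) α := integral_neg_eq_self _ _
    have h2 : ∀ α, I.indicator (qc ε c) (-α) = - I.indicator (qc ε c) α := by
      intro α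
      by_cases ht : α ∈ I
      · rw [Set.indicator_of_mem ht, Set.indicator_of_mem (memI.2 (by rw [abs_neg]; exact memI.1 ht)), qc_neg]
      · rw [Set.indicator_of_notMem ht, Set.indicator_of_notMem (fun hc => ht (memI.2 (by rw [← abs_neg]; exact memI.1 hc))), neg_zero]
    simp_rw [h2, integral_neg] at h1
    linarith
  obtain ⟨j1, j2⟩ := integral_rho2 he
  have e2 : ∫ α, qc ε c α * I.indicator Θ α = ∫ α, (qc ε c α * I.indicator Θ α - I.indicator (qc ε c) α * Θ 0) := by
    rw [integral_sub i2 (iq.mul_const _), integral_mul_const, iq0]; ring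
  have b2 : |∫ α, qc ε c α * I.indicator Θ α| ≤ 144 * ε ^ 2 * Λ * (2 / ε) := by
    rw [e2, ← j2, ← integral_const_mul, ← Real.norm_eq_abs]
    refine norm_integral_le_of_norm_le (j1.const_mul _) (Eventually.of_forall fun α => ?_)
    by_cases ht : α ∈ I
    · rw [Set.indicator_of_mem ht, Set.indicator_of_mem ht, ← mul_sub, norm_mul, Real.norm_eq_abs, Real.norm_eq_abs]
      calc _ ≤ (144 * ε ^ 2 / (ε + |α|) ^ 3) * (Λ * (|α| + ε)) :=
            mul_le_mul (qc_bound he hc hc8 α) (hΛ α (memI.1 ht)) (abs_nonneg _) (by positivity)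
        _ = _ := by
            have : ε + |α| ≠ 0 := by positivity
            rw [add_comm |α| ε]; field_simp
    · rw [Set.indicator_of_notMem ht, Set.indicator_of_notMem ht]; simp; positivity
  have e3 : 144 * ε ^ 2 * Λ * (2 / ε) = 288 * Λ * ε := by field_simp; ring
  rw [e3] at b2
  rw [e1]
  refine (abs_sub _ _).trans ?_
  rw [abs_mul, abs_of_pos Real.pi_pos]
  have b3 : π * |∫ α, qc ε c α * I.indicator Θ α| ≤ 4 * (288 * Λ * ε) :=
    mul_le_mul Real.pi_lt_four.le b2 (abs_nonneg _) (by norm_num)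
  linarith [p1.2]

/-- pairing with bounded functions -/
lemma HH.pair (hp : Par K ε s L) (h : HH ε s c C1 H) (hc : ε ≤ c) (hc8 : c ≤ 8 * ε) {u : ℝ → ℝ} {M : ℝ}
    (hu : BC u M (2 * s)) : Integrable (fun α => H α * u α) ∧ 
      |(∫ α, H α * u α) + π * ∫ α, qc ε c α * u α| ≤ 2 * C1 * M * (ε * L) := by
  have he := hp.he0
  have hs := hp.hs
  have hC1 := h.C1_nonneg he
  have i1 := (hu.int_const (by linarith) h.meas (Eventually.of_forall fun t _ => (h.toBC he hc hc8).bd t)).1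
  have i2 := (hu.int_const (by linarith) (measurable_qc ε c) (Eventually.of_forall fun t _ => qc_abs he hc hc8 t)).1
  have me : Measurable (fun α => H α + π * qc ε c α) := h.meas.add ((measurable_qc ε c).const_mul _)
  have p1 := hu.int_rho hp (c := C1 * ε) (by positivity) me
    (Eventually.of_forall fun t _ => by have := h.bd t; rwa [div_eq_mul_inv] at this)
  refine ⟨i1, ?_⟩
  rw [← integral_const_mul, ← integral_add i1 (i2.const_mul _)]
  have : ∀ α, H α * u α + π * (qc ε c α * u α) = (H α + π * qc ε c α) * u α := fun α => by ring
  simp_rw [this]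
  linarith [p1.2]

/-- pairing with L2 functions -/
lemma HH.pair2 (hp : Par K ε s L) (h : HH ε s c C1 H) (hc : ε ≤ c) (hc8 : c ≤ 8 * ε) {v : ℝ → ℝ}
    (hv : Measurable v) (hv2 : Integrable (fun x => v x ^ 2)) : Integrable (fun α => H α * v α) ∧ 
      |(∫ α, H α * v α) + π * ∫ α, qc ε c α * v α| ≤ 2 * C1 ^ 2 * ε + ∫ x, v x ^ 2 := by
  have he := hp.he0
  have hs := hp.hs
  have hC1 := h.C1_nonneg he
  obtain ⟨j1, j2⟩ := integral_rho2 he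
  have i1 := (AMGM h.meas hv (h.toBC he hc hc8).integrable_sq hv2).1
  have mq := measurable_qc ε c
  have hQ : Integrable (fun x => qc ε c x ^ 2) := by
    refine (j1.const_mul ((144:ℝ) ^ 2)).mono' (mq.pow_const 2).aestronglyMeasurable (Eventually.of_forall fun t => ?_)
    rw [Real.norm_eq_abs, abs_pow]
    have h1 := qc_bound he hc hc8 t
    have h2 : 144 * ε ^ 2 / (ε + |t|) ^ 3 ≤ 144 / (ε + |t|) := by
      rw [div_le_div_iff₀ (by positivity) (by positivity)]
      have : ε ^ 2 ≤ (ε + |t|) ^ 2 := by gcongr; linarith [abs_nonneg t]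
      calc _ ≤ 144 * (ε + |t|) ^ 2 * (ε + |t|) := by gcongr
        _ = _ := by ring
    calc _ ≤ (144 / (ε + |t|)) ^ 2 := by gcongr; exact h1.trans h2
      _ = _ := by rw [div_pow, div_eq_mul_inv]
  have i2 := (AMGM mq hv hQ hv2).1
  have me : Measurable (fun α => H α + π * qc ε c α) := h.meas.add (mq.const_mul _)
  have hb : ∀ t, ‖(H t + π * qc ε c t) ^ 2‖ ≤ C1 ^ 2 * ε ^ 2 * ((ε + |t|) ^ 2)⁻¹ := by
    intro t
    rw [Real.norm_eq_abs, abs_pow]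
    have := h.bd t
    calc _ ≤ (C1 * ε / (ε + |t|)) ^ 2 := by gcongr
      _ = _ := by rw [div_pow, div_eq_mul_inv, mul_pow]
  have ie : Integrable (fun x => (H x + π * qc ε c x) ^ 2) :=
    (j1.const_mul _).mono' (me.pow_const 2).aestronglyMeasurable (Eventually.of_forall hb)
  have p := AMGM me hv ie hv2
  refine ⟨i1, ?_⟩
  rw [← integral_const_mul, ← integral_add i1 (i2.const_mul _)]
  have : ∀ α, H α * v α + π * (qc ε c α * v α) = (H α + π * qc ε c α) * v α := fun α => by ring
  simp_rw [this]
  refine p.2.trans ?_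
  have q := norm_integral_le_of_norm_le (j1.const_mul _) (Eventually.of_forall hb)
  rw [integral_const_mul, j2, Real.norm_eq_abs] at q
  have e3 : C1 ^ 2 * ε ^ 2 * (2 / ε) = 2 * C1 ^ 2 * ε := by field_simp
  rw [e3] at q
  linarith [le_abs_self (∫ x, (H x + π * qc ε c x) ^ 2)]
end

end


section
open scoped ENNReal Topology

lemma Cut.j_bd {K : ℝ} {ψ : ℝ → ℝ} (h : Cut K ψ) (t : ℝ) : |(1 - ψ t) / t| ≤ 2 := by
  by_cases ht : |t| ≤ 1 / 2
  · rw [h.one t ht]; simp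
  · push Not at ht
    rw [abs_div, abs_of_nonneg (by linarith [h.le1 t]), div_le_iff₀ (by linarith)]
    linarith [h.nn t]

lemma Cut.j_lip {K : ℝ} {ψ : ℝ → ℝ} (h : Cut K ψ) (hK : 1 ≤ K) (t t' : ℝ) :
    |(1 - ψ t) / t - (1 - ψ t') / t'| ≤ 6 * K * |t - t'| := by
  have key : ∀ t t' : ℝ, 1 / 2 < |t| → |(1 - ψ t) / t - (1 - ψ t') / t'| ≤ 6 * K * |t - t'| := by
    intro t t' ht
    have ht0 : t ≠ 0 := by intro h0; rw [h0, abs_zero] at ht; linarith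
    have hl := h.lip t t'
    have b1 : |(ψ t' - ψ t) / t| ≤ 2 * K * |t - t'| := by
      rw [abs_div, div_le_iff₀ (by linarith), abs_sub_comm]
      have : 0 ≤ K * |t - t'| := by positivity
      nlinarith
    by_cases ht' : |t'| ≤ 1 / 2
    · rw [h.one t' ht', sub_self, zero_div, sub_zero]
      rw [h.one t' ht'] at b1
      refine b1.trans ?_
      have : 0 ≤ K * |t - t'| := by positivity
      linarith
    · push Not at ht'
      have ht0' : t' ≠ 0 := by intro h0; rw [h0, abs_zero] at ht'; linarith
      have e : (1 - ψ t) / t - (1 - ψ t') / t' = (ψ t' - ψ t) / t + (1 - ψ t') * ((t' - t) / (t * t')) := by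
        field_simp; ring
      have b2 : |(1 - ψ t') * ((t' - t) / (t * t'))| ≤ 4 * |t - t'| := by
        rw [abs_mul, abs_of_nonneg (by linarith [h.le1 t']), abs_div, abs_mul, abs_sub_comm t' t]
        have h4 : |t - t'| / (|t| * |t'|) ≤ 4 * |t - t'| := by
          rw [div_le_iff₀ (by positivity)]
          have : 1 / 4 ≤ |t| * |t'| := by nlinarith
          nlinarith [abs_nonneg (t - t')]
        calc _ ≤ 1 * (4 * |t - t'|) := by gcongr; linarith [h.nn t']
          _ = _ := one_mul _
      rw [e]
      refine (abs_add_le _ _).trans ?_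
      nlinarith [abs_nonneg (t - t')]
  by_cases ht : |t| ≤ 1 / 2
  · by_cases ht' : |t'| ≤ 1 / 2
    · rw [h.one t ht, h.one t' ht']; simp; positivity
    · push Not at ht'
      have := key t' t ht'
      rwa [abs_sub_comm, abs_sub_comm t' t] at this
  · push Not at ht
    exact key t t' ht

lemma A_bound {K s x p r f2 : ℝ} (hK : 1 ≤ K) (hs : 0 < s) (hs1 : s ≤ 1) (hx : x ≠ 0) (hx3 : |x| ≤ 3 * s)
    (hr : |r| ≤ 3 * K * s) (hp : |p| ≤ 2 * K * s) (hf2 : |f2| ≤ K) (ht : |r - p - x / 2 * f2| ≤ K * x ^ 2) :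
    |(r / (1 + r ^ 2) - p / (1 + p ^ 2)) / x - f2 / 2| ≤ 300 * K ^ 5 * s := by
  have hxa : 0 < |x| := abs_pos.2 hx
  have hr1 : 0 < 1 + r ^ 2 := by positivity
  have hp1 : 0 < 1 + p ^ 2 := by positivity
  set E := (1 - r * p) / ((1 + r ^ 2) * (1 + p ^ 2)) with hE
  set τ := (r - p - x / 2 * f2) / x with hτ
  have e : (r / (1 + r ^ 2) - p / (1 + p ^ 2)) / x - f2 / 2 = τ * E + f2 / 2 * (E - 1) := by
    rw [hτ, hE]; field_simp; ring
  have bτ : |τ| ≤ 3 * K * s := by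
    rw [hτ, abs_div, div_le_iff₀ hxa]
    refine ht.trans ?_
    rw [← sq_abs]
    have : K * |x| * |x| ≤ K * |x| * (3 * s) := by gcongr
    linarith
  have br : r ^ 2 ≤ 9 * K ^ 2 * s ^ 2 := by
    rw [← sq_abs]; calc |r| ^ 2 ≤ (3 * K * s) ^ 2 := by gcongr
      _ = _ := by ring
  have bp : p ^ 2 ≤ 4 * K ^ 2 * s ^ 2 := by
    rw [← sq_abs]; calc |p| ^ 2 ≤ (2 * K * s) ^ 2 := by gcongr
      _ = _ := by ring
  have brp : |r * p| ≤ 6 * K ^ 2 * s ^ 2 := by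
    rw [abs_mul]; calc |r| * |p| ≤ (3 * K * s) * (2 * K * s) := by gcongr
      _ = _ := by ring
  have bE : |E - 1| ≤ 60 * K ^ 4 * s := by
    have e1 : E - 1 = (-(r * p) - r ^ 2 - p ^ 2 - r ^ 2 * p ^ 2) / ((1 + r ^ 2) * (1 + p ^ 2)) := by
      rw [hE]; field_simp; ring
    rw [e1, abs_div, abs_of_pos (mul_pos hr1 hp1), div_le_iff₀ (mul_pos hr1 hp1)]
    have h1 : 1 ≤ (1 + r ^ 2) * (1 + p ^ 2) := by nlinarith [sq_nonneg r, sq_nonneg p, mul_nonneg (sq_nonneg r) (sq_nonneg p)]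
    have h2 : r ^ 2 * p ^ 2 ≤ 36 * K ^ 4 * s ^ 4 := by
      calc r ^ 2 * p ^ 2 ≤ (9 * K ^ 2 * s ^ 2) * (4 * K ^ 2 * s ^ 2) := by gcongr
        _ = _ := by ring
    have h3 : |-(r * p) - r ^ 2 - p ^ 2 - r ^ 2 * p ^ 2| ≤ |r * p| + r ^ 2 + p ^ 2 + r ^ 2 * p ^ 2 := by
      rw [abs_le]
      have := neg_abs_le (r * p); have := le_abs_self (r * p)
      have := sq_nonneg r; have := sq_nonneg p; have := mul_nonneg (sq_nonneg r) (sq_nonneg p)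
      constructor <;> linarith
    have h4 : s ^ 2 ≤ s := by nlinarith
    have h5 : s ^ 4 ≤ s := by calc s ^ 4 = s ^ 2 * s ^ 2 := by ring
                                _ ≤ s * 1 := by gcongr; nlinarith
                                _ = s := mul_one _
    have hK24 : K ^ 2 ≤ K ^ 4 := pow_le_pow_right₀ hK (by norm_num)
    have h6 : K ^ 2 * s ^ 2 ≤ K ^ 4 * s := by gcongr
    have h7 : K ^ 4 * s ^ 4 ≤ K ^ 4 * s := by gcongr
    have h8 : 0 ≤ K ^ 4 * s := by positivity
    calc _ ≤ 60 * K ^ 4 * s * 1 := by linarith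
      _ ≤ _ := by gcongr
  have bE1 : |E| ≤ 61 * K ^ 4 := by
    have h1 : |E| ≤ |E - 1| + 1 := by
      have := abs_add_le (E - 1) 1; simpa using this
    have : K ^ 4 * s ≤ K ^ 4 * 1 := by gcongr
    have : 1 ≤ K ^ 4 := one_le_pow₀ hK
    linarith
  rw [e]
  refine (abs_add_le _ _).trans ?_
  rw [abs_mul, abs_mul, abs_div f2, abs_two]
  calc |τ| * |E| + |f2| / 2 * |E - 1| ≤ (3 * K * s) * (61 * K ^ 4) + K / 2 * (60 * K ^ 4 * s) := by gcongr
    _ = 213 * (K ^ 5 * s) := by ring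
    _ ≤ 300 * (K ^ 5 * s) := by gcongr; norm_num
    _ = _ := by ring

def R1 (ψ : ℝ → ℝ) (s : ℝ) (f f1 : ℝ → ℝ) (α β : ℝ) : ℝ :=
  (f α - f β) / ((α - β) ^ 2 + (f α - f β) ^ 2) * ψ ((α - β) / s) - f1 β / (1 + f1 β ^ 2) / (α - β)

lemma measurable_R1 {ψ f f1 : ℝ → ℝ} {s : ℝ} (hψ : Measurable ψ) (hf : Measurable f) (hf1 : Measurable f1) :
    Measurable (fun p : ℝ × ℝ => R1 ψ s f f1 p.1 p.2) := by
  unfold R1; fun_prop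

lemma S_le (p : ℝ) : |p / (1 + p ^ 2)| ≤ |p| := by
  rw [abs_div, abs_of_pos (by positivity : 0 < 1 + p ^ 2)]
  exact div_le_self (abs_nonneg _) (by nlinarith [sq_nonneg p])

section
variable {K ε s L : ℝ} {ψ f f1 f2 : ℝ → ℝ}

lemma R1_form (hp : Par K ε s L) (hψ : Cut K ψ) (hf : Fn K s f f1 f2) {α β : ℝ} (ha : |α| < s) (hb : |β| ≤ 2 * s)
    (hx : α - β ≠ 0) : ∃ A, |A - f2 β / 2| ≤ 300 * K ^ 5 * s ∧
      R1 ψ s f f1 α β = ψ ((α - β) / s) * A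
        - f1 β / (1 + f1 β ^ 2) * ((1 - ψ ((α - β) / s)) / ((α - β) / s) / s) := by
  have hs := hp.hs
  have hK := hp.hK
  have ha4 : |α| < 4 * s := by linarith
  have hb4 : |β| < 4 * s := by linarith
  set x := α - β with hxd
  set p := f1 β with hpd
  set r := (f α - f β) / x with hr
  have hxa : 0 < |x| := abs_pos.2 hx
  have hx3 : |x| ≤ 3 * s := (abs_sub α β).trans (by linarith)
  refine ⟨(r / (1 + r ^ 2) - p / (1 + p ^ 2)) / x, ?_, ?_⟩
  · apply A_bound hK hs (by linarith [hp.hs1]) hx hx3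
    · rw [hr, abs_div, div_le_iff₀ hxa]
      have := hf.lip α β ha4 hb4
      refine this.trans ?_
      have : K * |x| * (|α| + |β|) ≤ K * |x| * (3 * s) := by gcongr; linarith
      linarith
    · have := hf.f1b β hb4
      have h2 : K * |β| ≤ K * (2 * s) := by gcongr
      linarith
    · exact hf.f2b β hb4
    · have := hf.tay α β ha4 hb4
      have e : r - p - x / 2 * f2 β = (f α - f β - x * p - x ^ 2 / 2 * f2 β) / x := by rw [hr]; field_simp
      rw [e, abs_div, div_le_iff₀ hxa]
      have e2 : K * x ^ 2 * |x| = K * |x| ^ 3 := by rw [← sq_abs x]; ring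
      rw [e2]; exact this
  · have e1 : (f α - f β) / (x ^ 2 + (f α - f β) ^ 2) = r / (1 + r ^ 2) / x := by
      have h2 : 0 < x ^ 2 + (f α - f β) ^ 2 := by positivity
      rw [hr]; field_simp
    unfold R1
    rw [← hxd, e1, ← hpd]
    have hp1 : 0 < 1 + p ^ 2 := by positivity
    have hr1 : 0 < 1 + r ^ 2 := by positivity
    generalize ψ (x / s) = y
    clear_value r p x
    field_simp; ring

lemma R1_bd (hp : Par K ε s L) (hψ : Cut K ψ) (hf : Fn K s f f1 f2) {α β : ℝ} (ha : |α| < s) (hb : |β| ≤ 2 * s)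
    (hx : α - β ≠ 0) : |R1 ψ s f f1 α β| ≤ 400 * K ^ 5 := by
  have hs := hp.hs
  have hs1 := hp.hs1
  have hK := hp.hK
  have hb4 : |β| < 4 * s := by linarith
  obtain ⟨A, hA, e⟩ := R1_form hp hψ hf ha hb hx
  have hf2 := hf.f2b β hb4
  have hf1 := hf.f1b β hb4
  have hK5 : K ≤ K ^ 5 := le_self_pow₀ hK (by norm_num)
  have hA2 : |A| ≤ K ^ 5 := by
    have h1 : |A| ≤ |A - f2 β / 2| + |f2 β / 2| := by
      have := abs_add_le (A - f2 β / 2) (f2 β / 2); simpa using this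
    rw [abs_div, abs_two] at h1
    have : K ^ 5 * s ≤ K ^ 5 * (1 / 1000) := by gcongr
    linarith
  have hS : |f1 β / (1 + f1 β ^ 2)| ≤ 2 * K * s := (S_le _).trans (hf1.trans (by
    have : K * |β| ≤ K * (2 * s) := by gcongr
    linarith))
  rw [e]
  refine (abs_sub _ _).trans ?_
  rw [abs_mul, abs_mul, abs_div _ s, abs_of_pos hs, abs_of_nonneg (hψ.nn _)]
  calc _ ≤ 1 * K ^ 5 + (2 * K * s) * (2 / s) := by gcongr; exact hψ.le1 _; exact hψ.j_bd _
    _ = K ^ 5 + 4 * K := by field_simp; ring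
    _ ≤ _ := by linarith

lemma R1_lip (hp : Par K ε s L) (hψ : Cut K ψ) (hf : Fn K s f f1 f2) {α β : ℝ} (ha : |α| < s) (hb : |β| ≤ 2 * s)
    (hx : α - β ≠ 0) (hx0 : 0 - β ≠ 0) : |R1 ψ s f f1 α β - R1 ψ s f f1 0 β| ≤ 700 * K ^ 5 * (|α| / s + s) := by
  have hs := hp.hs
  have hs1 := hp.hs1
  have hK := hp.hK
  have hb4 : |β| < 4 * s := by linarith
  obtain ⟨A, hA, e⟩ := R1_form hp hψ hf ha hb hx
  obtain ⟨A0, hA0, e0⟩ := R1_form hp hψ hf (α := 0) (by simpa using hs) hb hx0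
  have hf2 := hf.f2b β hb4
  have hf1 := hf.f1b β hb4
  have hK25 : K ^ 2 ≤ K ^ 5 := pow_le_pow_right₀ hK (by norm_num)
  have hS : |f1 β / (1 + f1 β ^ 2)| ≤ 2 * K * s := (S_le _).trans (hf1.trans (by
    have : K * |β| ≤ K * (2 * s) := by gcongr
    linarith))
  have d1 := hψ.abs_sub_le hs (α - β) (0 - β)
  have d2 := hψ.j_lip hK ((α - β) / s) ((0 - β) / s)
  have hx' : (α - β) / s - (0 - β) / s = α / s := by ring
  have hx2 : α - β - (0 - β) = α := by ring
  rw [hx', abs_div, abs_of_pos hs] at d2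
  rw [hx2] at d1
  have e3 : R1 ψ s f f1 α β - R1 ψ s f f1 0 β = ψ ((α - β) / s) * (A - f2 β / 2) - ψ ((0 - β) / s) * (A0 - f2 β / 2)
     + (ψ ((α - β) / s) - ψ ((0 - β) / s)) * (f2 β / 2)
     - f1 β / (1 + f1 β ^ 2) * (((1 - ψ ((α - β) / s)) / ((α - β) / s) - (1 - ψ ((0 - β) / s)) / ((0 - β) / s)) / s) := by
    rw [e, e0]; ring
  have b1 : |ψ ((α - β) / s) * (A - f2 β / 2)| ≤ 1 * (300 * K ^ 5 * s) := by
    rw [abs_mul, abs_of_nonneg (hψ.nn _)]; gcongr; exact hψ.le1 _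
  have b2 : |ψ ((0 - β) / s) * (A0 - f2 β / 2)| ≤ 1 * (300 * K ^ 5 * s) := by
    rw [abs_mul, abs_of_nonneg (hψ.nn _)]; gcongr; exact hψ.le1 _
  have b3 : |(ψ ((α - β) / s) - ψ ((0 - β) / s)) * (f2 β / 2)| ≤ (K * |α| / s) * (K / 2) := by
    rw [abs_mul, abs_div (f2 β), abs_two]; gcongr
  have b4 : |f1 β / (1 + f1 β ^ 2) * (((1 - ψ ((α - β) / s)) / ((α - β) / s) - (1 - ψ ((0 - β) / s)) / ((0 - β) / s)) / s)|
      ≤ (2 * K * s) * (6 * K * (|α| / s) / s) := by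
    rw [abs_mul, abs_div _ s, abs_of_pos hs]; gcongr
  have e4 : (2 * K * s) * (6 * K * (|α| / s) / s) = 12 * (K ^ 2 * (|α| / s)) := by field_simp; ring
  have e5 : (K * |α| / s) * (K / 2) = K ^ 2 * (|α| / s) / 2 := by ring
  rw [e4] at b4
  rw [e5] at b3
  have h6 : K ^ 2 * (|α| / s) ≤ K ^ 5 * (|α| / s) := by gcongr
  have h7 : 0 ≤ K ^ 5 * s := by positivity
  have h8 : 0 ≤ K ^ 2 * (|α| / s) := by positivity
  rw [e3]
  generalize ψ ((α - β) / s) * (A - f2 β / 2) = y1 at *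
  generalize ψ ((0 - β) / s) * (A0 - f2 β / 2) = y2 at *
  generalize (ψ ((α - β) / s) - ψ ((0 - β) / s)) * (f2 β / 2) = y3 at *
  generalize f1 β / (1 + f1 β ^ 2) * (((1 - ψ ((α - β) / s)) / ((α - β) / s) - (1 - ψ ((0 - β) / s)) / ((0 - β) / s)) / s) = y4 at *
  have : |y1 - y2 + y3 - y4| ≤ |y1| + |y2| + |y3| + |y4| := by
    have := abs_sub (y1 - y2 + y3) y4
    have := abs_add_le (y1 - y2) y3
    have := abs_sub y1 y2
    linarith
  linarith
end

end


section
open scoped ENNReal Topology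

lemma pv_decomp {u R F : ℝ → ℝ} {M R0 α v : ℝ} (hu : BC u M R0)
    (hlim : Tendsto (fun r => ∫ t in {t : ℝ | r < |α - t|}, u t / (α - t)) (𝓝[>] 0) (𝓝 v))
    (hR : Integrable R) (hF : ∀ β, α - β ≠ 0 → F β = u β / (α - β) + R β) : pvI F α = v + ∫ β, R β := by
  apply pvI_eq
  refine (hlim.add (trunc_integrable hR α)).congr' ?_
  refine eventually_nhdsWithin_of_forall fun r hr => ?_
  have hr : 0 < r := hr
  have hmr : MeasurableSet {t : ℝ | r < |α - t|} := measurableSet_lt measurable_const (by fun_prop)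
  have i1 : IntegrableOn (fun t => u t / (α - t)) {t : ℝ | r < |α - t|} := by
    have hb := hu.integrable_mul (g := ({t : ℝ | r < |α - t|}).indicator (fun t => (α - t)⁻¹))
      ((by fun_prop : Measurable fun t : ℝ => (α - t)⁻¹).indicator hmr) (c := r⁻¹) (by
        intro t
        rw [Set.indicator_apply]
        split_ifs with h
        · rw [abs_inv]; exact inv_anti₀ hr (le_of_lt h)
        · simp; exact hr.le)
    refine (integrable_indicator_iff hmr).1 (hb.congr (Eventually.of_forall fun t => ?_))
    simp only [Set.indicator_apply]
    split_ifs
    · rw [div_eq_mul_inv, mul_comm]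
    · simp
  beta_reduce
  rw [← integral_add i1 hR.integrableOn]
  refine setIntegral_congr_fun hmr fun β hβ => ?_
  refine (hF β fun h0 => ?_).symm
  have : r < |α - β| := hβ
  rw [h0, abs_zero] at this; linarith

def wt (s : ℝ) (ω : ℝ → ℝ) : ℝ → ℝ := (Ioo (-(2 * s)) (2 * s)).indicator ω

lemma wt_in {s β : ℝ} {ω : ℝ → ℝ} (h : |β| < 2 * s) : wt s ω β = ω β :=
  Set.indicator_of_mem (show β ∈ Ioo (-(2 * s)) (2 * s) from abs_lt.1 h) _

lemma wt_out {s β : ℝ} {ω : ℝ → ℝ} (h : 2 * s ≤ |β|) : wt s ω β = 0 :=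
  Set.indicator_of_notMem (show β ∉ Ioo (-(2 * s)) (2 * s) from fun hc => by have := abs_lt.2 hc; linarith) _

lemma BC_wt {s B : ℝ} {ω : ℝ → ℝ} (hω : Measurable ω) (hB : 0 ≤ B) (hb : ∀ β, |β| < 2 * s → |ω β| ≤ B) :
    BC (wt s ω) B (2 * s) := by
  refine ⟨hω.indicator measurableSet_Ioo, fun t => ?_, fun t ht => wt_out ht.le⟩
  by_cases ht : |t| < 2 * s
  · rw [wt_in ht]; exact hb t ht
  · rw [wt_out (not_lt.1 ht), abs_zero]; exact hB

lemma Cut.wt_eq {K : ℝ} {ψ : ℝ → ℝ} (h : Cut K ψ) {s α β : ℝ} (hs : 0 < s) {ω : ℝ → ℝ} (ha : |α| < s) :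
    ω β * ψ ((α - β) / s) = wt s ω β * ψ ((α - β) / s) := by
  by_cases h0 : ψ ((α - β) / s) = 0
  · rw [h0]; ring
  · have h1 := h.of_ne hs h0
    rw [wt_in]
    have := abs_sub_abs_le_abs_sub β α
    rw [abs_sub_comm β α] at this; linarith

lemma PK_rho {ε c : ℝ} (he : 0 < ε) (hc : ε ≤ c) (hc8 : c ≤ 8 * ε) (β : ℝ) : PK c β * |β| ≤ 16 * ε * (ε + |β|)⁻¹ := by
  have h1 := PK_comp he hc hc8 β
  have hr : 0 < ε + |β| := by positivity
  have h2 : PK ε β * |β| ≤ 2 * ε * (ε + |β|)⁻¹ := by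
    unfold PK
    rw [← div_eq_mul_inv, div_mul_eq_mul_div, div_le_div_iff₀ (den_pos he β) hr, ← sq_abs β]
    nlinarith [abs_nonneg β, mul_nonneg he.le (sq_nonneg (ε - |β|)), mul_nonneg he.le (abs_nonneg β)]
  have := mul_le_mul_of_nonneg_right h1 (abs_nonneg β)
  linarith

section
variable {K ε s L c C1 B : ℝ} {ψ f f1 f2 H ω : ℝ → ℝ}

theorem T1_est (hp : Par K ε s L) (hψ : Cut K ψ) (hf : Fn K s f f1 f2) (hH : HH ε s c C1 H) (hc : ε ≤ c)
    (hc6 : c ≤ 6 * ε) (hω : Measurable ω) (hB : 1 ≤ B) (hωb : ∀ β, |β| < 2 * s → |ω β| ≤ B) :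
    ∃ V : ℝ → ℝ, (∀ᵐ α, |α| < s → 2 * π * T1 ψ ε f ω α = V α) ∧ Integrable (fun α => H α * V α) ∧
      |∫ α, H α * V α| ≤ (1152 * (2800 * K ^ 5 * B) + 2 * C1 * (2 * K ^ 5 * B) + 2 * C1 ^ 2 + 256 * K ^ 2 * B ^ 2
        + 1024 * K * B) * (ε * L) := by
  have he := hp.he0
  have hs := hp.hs
  have hs1 := hp.hs1
  have hK := hp.hK
  have hL := hp.hL1
  have hc0 := he.trans_le hc
  have hc8 : c ≤ 8 * ε := by linarith
  have hpi := Real.pi_pos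
  have hpi4 := Real.pi_lt_four
  have hss : Real.sqrt ε = s := by rw [hp.he]; exact Real.sqrt_sq hs.le
  have hB0 : 0 ≤ B := by linarith
  have hC1 := hH.C1_nonneg he
  have bw := BC_wt hω hB0 hωb
  have mw := bw.meas
  set u : ℝ → ℝ := fun β => f1 β / (1 + f1 β ^ 2) * wt s ω β with hu
  have mS : Measurable (fun β => f1 β / (1 + f1 β ^ 2)) := by have := hf.mf1; fun_prop
  have bS : ∀ β, |β| < 2 * s → |f1 β / (1 + f1 β ^ 2)| ≤ K * |β| := fun β hβ =>
    (S_le _).trans (hf.f1b β (by linarith))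
  have bu : BC u (2 * K * s * B) (2 * s) := by
    refine ⟨mS.mul mw, fun t => ?_, fun t ht => by simp only [hu]; rw [wt_out ht.le, mul_zero]⟩
    by_cases ht : |t| < 2 * s
    · simp only [hu]
      rw [abs_mul]
      refine mul_le_mul ((bS t ht).trans ?_) (bw.bd t) (abs_nonneg _) (by positivity)
      have : K * |t| ≤ K * (2 * s) := by gcongr
      linarith
    · simp only [hu]; rw [wt_out (not_lt.1 ht), mul_zero, abs_zero]; positivity
  obtain ⟨v, mv, iv, ev, lv, -, qv⟩ := bu.hilbert
  set Θ : ℝ → ℝ := fun α => ∫ β, R1 ψ s f f1 α β * wt s ω β with hΘ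
  have mR1 := measurable_R1 (s := s) hψ.m hf.mf hf.mf1
  have mR : ∀ α, Measurable (R1 ψ s f f1 α) := fun α => mR1.comp (measurable_const.prodMk measurable_id)
  have mΘ : Measurable Θ := measurable_iG (G := fun p => R1 ψ s f f1 p.1 p.2 * wt s ω p.2)
    (mR1.mul (mw.comp measurable_snd))
  have hne : ∀ α : ℝ, ∀ᵐ β : ℝ, α - β ≠ 0 := by
    intro α
    have : ∀ᵐ β : ℝ, β ≠ α := by simp [ae_iff]
    filter_upwards [this] with β hβ h0
    exact hβ (by linarith)
  have hR : ∀ α, |α| < s → _ := fun α ha => bw.int_const (by linarith) (mR α) (c := 400 * K ^ 5)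
    (by filter_upwards [hne α] with β hβ hb using R1_bd hp hψ hf ha hb hβ)
  have hΘM : ∀ α, |α| < s → |Θ α| ≤ 2 * K ^ 5 * B := by
    intro α ha
    refine (hR α ha).2.trans ?_
    have : B * K ^ 5 * s ≤ B * K ^ 5 * (1 / 1000) := by gcongr
    have : 0 ≤ B * K ^ 5 := by positivity
    linarith
  have hΘΛ : ∀ α, |α| < s → |Θ α - Θ 0| ≤ (2800 * K ^ 5 * B) * (|α| + ε) := by
    intro α ha
    have h0 : |(0:ℝ)| < s := by simpa using hs
    have e : Θ α - Θ 0 = ∫ β, (R1 ψ s f f1 α β - R1 ψ s f f1 0 β) * wt s ω β := by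
      simp only [hΘ]
      rw [← integral_sub (hR α ha).1 (hR 0 h0).1]
      congr 1; ext β; ring
    rw [e]
    have := bw.int_const (by linarith) ((mR α).sub (mR 0)) (c := 700 * K ^ 5 * (|α| / s + s))
      (by filter_upwards [hne α, hne 0] with β hβ hβ0 hb using R1_lip hp hψ hf ha hb hβ hβ0)
    refine this.2.trans_eq ?_
    rw [hp.he]; field_simp; ring
  obtain ⟨c1, c2⟩ := CRIT hp hH hc hc8 mΘ hΘM hΘΛ
  obtain ⟨d1, d2⟩ := hH.pair2 hp hc hc8 mv iv
  have eHV : ∀ α, H α * (v α + Θ α) = H α * v α + H α * Θ α := fun α => by ring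
  refine ⟨fun α => v α + Θ α, ?_, ?_, ?_⟩
  · filter_upwards [lv] with α hα ha
    unfold T1
    rw [← mul_assoc, mul_inv_cancel₀ (by positivity), one_mul]
    refine pv_decomp bu hα (hR α ha).1 fun β hβ => ?_
    simp only [scut, hss]
    rw [mul_assoc, hψ.wt_eq hs ha]
    simp only [hu, R1]
    ring
  · simp_rw [eHV]; exact d1.add c1
  · simp_rw [eHV]
    rw [integral_add d1 c1]
    have hu2 : ∫ x, u x ^ 2 ≤ 16 * K ^ 2 * B ^ 2 * ε := by
      have := bu.int_const (by linarith) bu.meas (Eventually.of_forall fun t _ => bu.bd t)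
      have e : ∀ x, u x ^ 2 = u x * u x := fun x => by ring
      simp_rw [e]
      refine (le_abs_self _).trans (this.2.trans ?_)
      rw [hp.he]
      have : K ^ 2 * B ^ 2 * s ^ 2 * s ≤ K ^ 2 * B ^ 2 * s ^ 2 * 1 := by gcongr; linarith
      linarith
    have hq : ∫ α, qc ε c α * v α = π * ∫ β, (PK c β - PK (c + 2 * ε) β) * u β := by
      have hQv : ∀ a, 0 < a → Integrable (fun t => QK a t * v t) := fun a ha =>
        (AMGM (measurable_QK a) mv (integrable_QK_sq ha) iv).1
      have hPu : ∀ a, 0 < a → Integrable (fun t => PK a t * u t) := fun a ha =>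
        bu.integrable_mul (measurable_PK a) (c := a⁻¹) fun t => by
          rw [abs_of_nonneg (PK_nonneg ha t)]; exact PK_le ha t
      have hc2 : 0 < c + 2 * ε := by positivity
      have e1 : ∀ α, qc ε c α * v α = QK c α * v α - QK (c + 2 * ε) α * v α := fun α => by unfold qc; ring
      have e2 : ∀ α, (PK c α - PK (c + 2 * ε) α) * u α = PK c α * u α - PK (c + 2 * ε) α * u α := fun α => by ring
      simp_rw [e1, e2]
      rw [integral_sub (hQv c hc0) (hQv _ hc2), integral_sub (hPu c hc0) (hPu _ hc2), qv c hc0, qv _ hc2]; ring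
    have hq2 : |∫ β, (PK c β - PK (c + 2 * ε) β) * u β| ≤ 64 * K * B * (ε * L) := by
      have e : ∀ β, (PK c β - PK (c + 2 * ε) β) * u β = (PK c β - PK (c + 2 * ε) β) * (f1 β / (1 + f1 β ^ 2)) * wt s ω β :=
        fun β => by simp only [hu]; ring
      simp_rw [e]
      have hne2 : ∀ᵐ t : ℝ, |t| ≠ 2 * s := by
        have h1 : ∀ᵐ t : ℝ, t ≠ 2 * s := by simp [ae_iff]
        have h2 : ∀ᵐ t : ℝ, t ≠ -(2 * s) := by simp [ae_iff]
        filter_upwards [h1, h2] with t g1 g2 h3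
        rcases eq_or_eq_neg_of_abs_eq h3 with h | h
        · exact g1 h
        · exact g2 h
      have := bw.int_rho hp (g := fun β => (PK c β - PK (c + 2 * ε) β) * (f1 β / (1 + f1 β ^ 2))) (c := 32 * K * ε)
        (by positivity) (((measurable_PK _).sub (measurable_PK _)).mul mS) (by
          filter_upwards [hne2] with t ht1 ht
          have ht : |t| < 2 * s := lt_of_le_of_ne ht ht1
          rw [abs_mul]
          have g1 := PK_rho he hc hc8 t
          have g2 := PK_rho he (by linarith : ε ≤ c + 2 * ε) (by linarith) t
          have g3 : |PK c t - PK (c + 2 * ε) t| ≤ PK c t + PK (c + 2 * ε) t := by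
            refine (abs_sub _ _).trans_eq ?_
            rw [abs_of_nonneg (PK_nonneg hc0 t), abs_of_nonneg (PK_nonneg (by positivity) t)]
          have g0 : 0 ≤ PK c t + PK (c + 2 * ε) t := (abs_nonneg _).trans g3
          calc _ ≤ (PK c t + PK (c + 2 * ε) t) * (K * |t|) := by gcongr; exact bS t ht
            _ = K * (PK c t * |t| + PK (c + 2 * ε) t * |t|) := by ring
            _ ≤ K * (16 * ε * (ε + |t|)⁻¹ + 16 * ε * (ε + |t|)⁻¹) := by gcongr
            _ = _ := by ring)
      refine this.2.trans_eq (by ring)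
    have hpq : |π * ∫ α, qc ε c α * v α| ≤ 1024 * K * B * (ε * L) := by
      rw [hq, abs_mul, abs_mul, abs_of_pos hpi]
      calc _ ≤ 4 * (4 * (64 * K * B * (ε * L))) := by gcongr
        _ = _ := by ring
    rw [ev] at d2
    have hpu : π ^ 2 * ∫ x, u x ^ 2 ≤ 256 * K ^ 2 * B ^ 2 * ε := by
      have h0 : 0 ≤ ∫ x, u x ^ 2 := integral_nonneg fun x => sq_nonneg _
      calc _ ≤ 4 ^ 2 * (16 * K ^ 2 * B ^ 2 * ε) := by gcongr
        _ = _ := by ring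
    have hεL : ε ≤ ε * L := by nlinarith
    have h3 : |∫ α, H α * v α| ≤ (2 * C1 ^ 2 + 256 * K ^ 2 * B ^ 2 + 1024 * K * B) * (ε * L) := by
      have t := abs_sub ((∫ α, H α * v α) + π * ∫ α, qc ε c α * v α) (π * ∫ α, qc ε c α * v α)
      rw [add_sub_cancel_right] at t
      have := mul_le_mul_of_nonneg_left hεL (show 0 ≤ 2 * C1 ^ 2 + 256 * K ^ 2 * B ^ 2 by positivity)
      linarith
    have h4 := mul_le_mul_of_nonneg_left hεL (show 0 ≤ 1152 * (2800 * K ^ 5 * B) by positivity)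
    refine (abs_add_le _ _).trans ?_
    linarith
end

end


section
open scoped ENNReal Topology

lemma PKK {K ε Y : ℝ} (he : 0 < ε) (hY : ε ≤ Y) (hY2 : Y ≤ K * ε) (x : ℝ) : PK Y x ≤ K * PK ε x := by
  unfold PK
  rw [← mul_div_assoc]
  have := he.trans_le hY
  have := den_pos he x
  have : 0 ≤ K * ε := by linarith
  gcongr

lemma cinv_re (a x : ℝ) : ((⟨x, a⟩ : ℂ)⁻¹).re = QK a x := by
  rw [Complex.inv_re, Complex.normSq_mk]; unfold QK; simp only [pow_two]

lemma cinv_im (a x : ℝ) : ((⟨x, a⟩ : ℂ)⁻¹).im = - PK a x := by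
  rw [Complex.inv_im, Complex.normSq_mk]; unfold PK; simp only [pow_two]; ring

lemma cnorm_lo {ε ρ a x : ℝ} (ha : ε ≤ a) (he : 0 < ε) (hx : ρ ≤ 2 * |x| + ε) : ρ / 4 ≤ ‖(⟨x, a⟩ : ℂ)‖ := by
  have h1 := Complex.abs_re_le_norm (⟨x, a⟩ : ℂ)
  have h2 := Complex.abs_im_le_norm (⟨x, a⟩ : ℂ)
  simp only at h1 h2
  rw [abs_of_pos (he.trans_le ha)] at h2
  linarith

lemma N_lip {ε ρ a b X x y D : ℝ} (he : 0 < ε) (hρ : 0 < ρ) (ha : ε ≤ a) (hb : ε ≤ b) (hX : ε ≤ X)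
    (hx : ρ ≤ 2 * |x| + ε) (hy : ρ ≤ 2 * |y| + ε) (hD1 : |x - y| + |a - b| ≤ D) :
    |(QK a x * QK X x - PK a x * PK X x)| ≤ 16 / ρ ^ 2 ∧
    |(QK a x * QK X x - PK a x * PK X x) - (QK b y * QK X y - PK b y * PK X y)| ≤ 128 * D / ρ ^ 3 := by
  set z1 : ℂ := ⟨x, a⟩ with h1
  set z2 : ℂ := ⟨x, X⟩ with h2
  set w1 : ℂ := ⟨y, b⟩ with h3
  set w2 : ℂ := ⟨y, X⟩ with h4
  have n1 : ρ / 4 ≤ ‖z1‖ := cnorm_lo ha he hx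
  have n2 : ρ / 4 ≤ ‖z2‖ := cnorm_lo hX he hx
  have n3 : ρ / 4 ≤ ‖w1‖ := cnorm_lo hb he hy
  have n4 : ρ / 4 ≤ ‖w2‖ := cnorm_lo hX he hy
  have iv : ∀ z : ℂ, ρ / 4 ≤ ‖z‖ → ‖z⁻¹‖ ≤ 4 / ρ := fun z hz => by
    rw [norm_inv]
    calc _ ≤ (ρ / 4)⁻¹ := inv_anti₀ (by positivity) hz
      _ = _ := by field_simp
  have nz : ∀ z : ℂ, ρ / 4 ≤ ‖z‖ → z ≠ 0 := fun z hz h0 => by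
    rw [h0, norm_zero] at hz; linarith
  have hD0 : 0 ≤ D := le_trans (by positivity) hD1
  have dv : ∀ z w : ℂ, ρ / 4 ≤ ‖z‖ → ρ / 4 ≤ ‖w‖ → ‖w - z‖ ≤ D → ‖z⁻¹ - w⁻¹‖ ≤ 4 / ρ * D * (4 / ρ) := fun z w hz hw hd => by
    have : z⁻¹ - w⁻¹ = z⁻¹ * (w - z) * w⁻¹ := by
      have := nz z hz; have := nz w hw; field_simp
    rw [this, norm_mul, norm_mul]
    have := iv z hz; have := iv w hw
    gcongr
  have r1 : QK a x * QK X x - PK a x * PK X x = (z1⁻¹ * z2⁻¹).re := by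
    rw [Complex.mul_re, cinv_re, cinv_re, cinv_im, cinv_im]; ring
  have r2 : QK b y * QK X y - PK b y * PK X y = (w1⁻¹ * w2⁻¹).re := by
    rw [Complex.mul_re, cinv_re, cinv_re, cinv_im, cinv_im]; ring
  have d1 : ‖w1 - z1‖ ≤ D := by
    refine (Complex.norm_le_abs_re_add_abs_im _).trans (le_trans (le_of_eq ?_) hD1)
    simp only [h1, h3, Complex.sub_re, Complex.sub_im]
    rw [abs_sub_comm y, abs_sub_comm b]
  have d2 : ‖w2 - z2‖ ≤ D := by
    refine (Complex.norm_le_abs_re_add_abs_im _).trans (le_trans ?_ hD1)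
    simp only [h2, h4, Complex.sub_re, Complex.sub_im, sub_self, abs_zero, add_zero]
    rw [abs_sub_comm y]; linarith [abs_nonneg (a - b)]
  refine ⟨?_, ?_⟩
  · rw [r1]
    refine (Complex.abs_re_le_norm _).trans ?_
    rw [norm_mul]
    calc _ ≤ (4 / ρ) * (4 / ρ) := by gcongr <;> first | exact iv _ n1 | exact iv _ n2
      _ = _ := by ring
  · rw [r1, r2, ← Complex.sub_re]
    refine (Complex.abs_re_le_norm _).trans ?_
    have : z1⁻¹ * z2⁻¹ - w1⁻¹ * w2⁻¹ = (z1⁻¹ - w1⁻¹) * z2⁻¹ + w1⁻¹ * (z2⁻¹ - w2⁻¹) := by ring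
    rw [this]
    refine (norm_add_le _ _).trans ?_
    rw [norm_mul, norm_mul]
    calc _ ≤ (4 / ρ * D * (4 / ρ)) * (4 / ρ) + (4 / ρ) * (4 / ρ * D * (4 / ρ)) := by
          gcongr
          · exact dv _ _ n1 n3 d1
          · exact iv _ n2
          · exact iv _ n3
          · exact dv _ _ n2 n4 d2
      _ = _ := by ring

lemma PK_sub {X Y : ℝ} (hX : 0 < X) (hY : 0 < Y) (x : ℝ) :
    PK Y x - PK X x = (Y - X) * (QK Y x * QK X x - PK Y x * PK X x) := by
  have := den_pos hX x
  have := den_pos hY x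
  unfold PK QK; field_simp; ring

lemma PK_sub_le {ε X Y : ℝ} (he : 0 < ε) (hX : ε ≤ X) (hY : ε ≤ Y) (x : ℝ) :
    |PK Y x - PK X x| ≤ |Y - X| * (16 / (ε + |x|) ^ 2) := by
  rw [PK_sub (he.trans_le hX) (he.trans_le hY), abs_mul]
  have := (N_lip (ε := ε) (ρ := ε + |x|) (a := Y) (b := Y) (X := X) (x := x) (y := x) (D := 0) he (by positivity) hY hY hX
    (by linarith [abs_nonneg x]) (by linarith [abs_nonneg x]) (by simp)).1
  gcongr

/-- The truncation remainder. -/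
lemma Phi_lip {K ε s L X : ℝ} {ψ : ℝ → ℝ} (hp : Par K ε s L) (hψ : Cut K ψ) (hX : ε ≤ X) (hX2 : X ≤ K * ε) (x y : ℝ) :
    |PK X x * (1 - ψ (x / s)) - PK X y * (1 - ψ (y / s))| ≤ 20 * K ^ 2 * |x - y| / s := by
  have he := hp.he0
  have hs := hp.hs
  have hK := hp.hK
  have hX0 := he.trans_le hX
  have key : ∀ x y : ℝ, s / 2 < |x| →
      |PK X x * (1 - ψ (x / s)) - PK X y * (1 - ψ (y / s))| ≤ 20 * K ^ 2 * |x - y| / s := by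
    intro x y hx
    have e : PK X x * (1 - ψ (x / s)) - PK X y * (1 - ψ (y / s)) =
      PK X x * (ψ (y / s) - ψ (x / s)) + (1 - ψ (y / s)) * (PK X x - PK X y) := by ring
    have hPx : PK X x ≤ 4 * K := by
      unfold PK
      rw [div_le_iff₀ (den_pos hX0 x), ← sq_abs x]
      have : s ^ 2 / 4 ≤ |x| ^ 2 := by nlinarith
      have : K * ε ≤ 4 * K * |x| ^ 2 := by rw [hp.he]; nlinarith
      nlinarith [sq_nonneg X]
    have hl := hψ.abs_sub_le (r := s) hs y x
    have b1 : |PK X x * (ψ (y / s) - ψ (x / s))| ≤ 4 * K ^ 2 * |x - y| / s := by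
      rw [abs_mul, abs_of_nonneg (PK_nonneg hX0 x)]
      rw [abs_sub_comm y x] at hl
      calc _ ≤ 4 * K * (K * |x - y| / s) := by gcongr
        _ = _ := by ring
    have b2 : |(1 - ψ (y / s)) * (PK X x - PK X y)| ≤ 16 * K ^ 2 * |x - y| / s := by
      by_cases hy : |y| ≤ s / 2
      · rw [hψ.one (y / s) (by rw [abs_div, abs_of_pos hs, div_le_iff₀ hs]; linarith)]
        simp; positivity
      · push Not at hy
        rw [abs_mul, abs_of_nonneg (by linarith [hψ.le1 (y / s)])]
        have h1 : |PK X x - PK X y| ≤ 16 * K * |x - y| / s := by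
          have hdx := den_pos hX0 x
          have hdy := den_pos hX0 y
          have e : PK X x - PK X y = X * ((y - x) * (x + y)) / ((x ^ 2 + X ^ 2) * (y ^ 2 + X ^ 2)) := by
            unfold PK; field_simp; ring
          have hxa : 0 < |x| := by linarith
          have hya : 0 < |y| := by linarith
          rw [e, abs_div, abs_mul, abs_mul, abs_of_pos hX0, abs_of_pos (mul_pos hdx hdy), abs_sub_comm y x]
          have m1 : |x + y| ≤ |x| + |y| := abs_add_le _ _
          have m2 : |x| ^ 2 * |y| ^ 2 ≤ (x ^ 2 + X ^ 2) * (y ^ 2 + X ^ 2) := by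
            rw [sq_abs, sq_abs]
            gcongr <;> linarith [sq_nonneg X]
          calc X * (|x - y| * |x + y|) / ((x ^ 2 + X ^ 2) * (y ^ 2 + X ^ 2))
              ≤ K * ε * (|x - y| * (|x| + |y|)) / (|x| ^ 2 * |y| ^ 2) := by gcongr
            _ ≤ 16 * K * |x - y| / s := by
                rw [div_le_div_iff₀ (by positivity) hs, hp.he]
                have q1 : s ^ 3 * |x| ≤ 8 * (|x| ^ 2 * |y| ^ 2) := by
                  have : s ^ 3 ≤ 8 * (|x| * |y| ^ 2) := by
                    calc s ^ 3 = 8 * ((s / 2) * (s / 2) ^ 2) := by ring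
                      _ ≤ _ := by gcongr
                  nlinarith
                have q2 : s ^ 3 * |y| ≤ 8 * (|x| ^ 2 * |y| ^ 2) := by
                  have : s ^ 3 ≤ 8 * (|x| ^ 2 * |y|) := by
                    calc s ^ 3 = 8 * ((s / 2) ^ 2 * (s / 2)) := by ring
                      _ ≤ _ := by gcongr
                  nlinarith
                have : 0 ≤ K * |x - y| := by positivity
                nlinarith
        have h2 : 16 * K * |x - y| / s ≤ 16 * K ^ 2 * |x - y| / s := by
          gcongr; nlinarith
        calc _ ≤ 1 * (16 * K ^ 2 * |x - y| / s) := by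
              gcongr
              · linarith [hψ.nn (y / s)]
              · linarith
          _ = _ := one_mul _
    rw [e]
    refine (abs_add_le _ _).trans ((add_le_add b1 b2).trans_eq (by ring))
  by_cases hx : |x| ≤ s / 2
  · by_cases hy : |y| ≤ s / 2
    · rw [hψ.one (x / s) (by rw [abs_div, abs_of_pos hs, div_le_iff₀ hs]; linarith),
        hψ.one (y / s) (by rw [abs_div, abs_of_pos hs, div_le_iff₀ hs]; linarith)]
      simp; positivity
    · push Not at hy
      have := key y x hy
      rwa [abs_sub_comm, abs_sub_comm y x] at this
  · push Not at hx
    exact key x y hx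

def D3 (ψ : ℝ → ℝ) (s ε : ℝ) (f g : ℝ → ℝ) (α β : ℝ) : ℝ :=
  PK (2 * ε + f α + g β) (α - β) * ψ ((α - β) / s) - PK (2 * ε + f β + g β) (α - β)

lemma D3_bd {K ε s L : ℝ} {ψ f g : ℝ → ℝ} (hp : Par K ε s L) (hψ : Cut K ψ) (hfg : PairFG K ε s f g) {α β : ℝ}
    (ha : |α| < s) (hb : |β| < 4 * s) : |D3 ψ s ε f g α β| ≤ 2 * K * PK ε (α - β) := by
  have he := hp.he0
  have hs := hp.hs
  have l1 := hfg.lo α β (by linarith) hb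
  have l2 := hfg.lo β β hb hb
  have p1 := PKK he l1 (hfg.hi α β (by linarith) hb) (α - β)
  have p2 := PKK he l2 (hfg.hi β β hb hb) (α - β)
  have n1 := PK_nonneg (he.trans_le l1) (α - β)
  have n2 := PK_nonneg (he.trans_le l2) (α - β)
  have h0 := hψ.nn ((α - β) / s)
  have h1 := hψ.le1 ((α - β) / s)
  unfold D3
  rw [abs_le]; constructor <;> nlinarith

set_option maxHeartbeats 1000000 in
lemma D3_lip {K ε s L : ℝ} {ψ f f1 f2 g : ℝ → ℝ} (hp : Par K ε s L) (hψ : Cut K ψ) (hf : Fn K s f f1 f2)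
    (hfg : PairFG K ε s f g) {α β : ℝ} (ha : |α| < s) (hb : |β| < 2 * s) :
    |D3 ψ s ε f g α β - D3 ψ s ε f g 0 β| ≤ 500 * K ^ 2 * |α| * ((ε + |α - β|)⁻¹ + (ε + |β|)⁻¹) := by
  have he := hp.he0
  have hs := hp.hs
  have hs1 := hp.hs1
  have hK := hp.hK
  have hes := hp.hes
  have ha4 : |α| < 4 * s := by linarith
  have hb4 : |β| < 4 * s := by linarith
  have h04 : |(0:ℝ)| < 4 * s := by simpa using hs
  set X := 2 * ε + f β + g β with hX
  set Y := 2 * ε + f α + g β with hY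
  set Y0 := 2 * ε + f 0 + g β with hY0
  have lX : ε ≤ X := hfg.lo β β hb4 hb4
  have lY : ε ≤ Y := hfg.lo α β ha4 hb4
  have lY0 : ε ≤ Y0 := hfg.lo 0 β h04 hb4
  have uX : X ≤ K * ε := hfg.hi β β hb4 hb4
  have hx := abs_nonneg (α - β)
  have hρ : 0 < ε + |β| := by positivity
  have hσ : 0 < ε + |α - β| := by positivity
  have e0 : D3 ψ s ε f g α β - D3 ψ s ε f g 0 β =
      ((PK Y (α - β) - PK X (α - β)) * ψ ((α - β) / s) - (PK Y0 (0 - β) - PK X (0 - β)) * ψ ((0 - β) / s))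
      - (PK X (α - β) * (1 - ψ ((α - β) / s)) - PK X (0 - β) * (1 - ψ ((0 - β) / s))) := by
    unfold D3; ring
  have hsρ : 1 / s ≤ 3 * (ε + |β|)⁻¹ := by
    rw [← div_eq_mul_inv, div_le_div_iff₀ hs hρ]; linarith
  have b2 : |PK X (α - β) * (1 - ψ ((α - β) / s)) - PK X (0 - β) * (1 - ψ ((0 - β) / s))| ≤ 60 * K ^ 2 * |α| * (ε + |β|)⁻¹ := by
    refine (Phi_lip hp hψ lX uX (α - β) (0 - β)).trans ?_
    have : α - β - (0 - β) = α := by ring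
    rw [this]
    calc _ = 20 * K ^ 2 * |α| * (1 / s) := by ring
      _ ≤ 20 * K ^ 2 * |α| * (3 * (ε + |β|)⁻¹) := by gcongr
      _ = _ := by ring
  have hps : ∀ x, |ψ x| ≤ 1 := fun x => by rw [abs_of_nonneg (hψ.nn x)]; exact hψ.le1 x
  have hfβ := hf.abs_le hs hb4
  have hfα := hf.abs_le hs ha4
  have i1 : 0 < (ε + |β|)⁻¹ := inv_pos.2 hρ
  have i2 : 0 < (ε + |α - β|)⁻¹ := inv_pos.2 hσ
  have hα0 := abs_nonneg α
  have b1 : |(PK Y (α - β) - PK X (α - β)) * ψ ((α - β) / s) - (PK Y0 (0 - β) - PK X (0 - β)) * ψ ((0 - β) / s)|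
      ≤ 440 * K ^ 2 * |α| * ((ε + |α - β|)⁻¹ + (ε + |β|)⁻¹) := by
    by_cases hc : |β| ≤ 2 * |α|
    · have t1 : |(PK Y (α - β) - PK X (α - β)) * ψ ((α - β) / s)| ≤ 48 * K ^ 2 * |α| * (ε + |α - β|)⁻¹ := by
        rw [abs_mul]
        have h1 := PK_sub_le he lX lY (α - β)
        have h2 : |Y - X| ≤ K * |α - β| * (3 * |α|) := by
          have := hf.lip α β ha4 hb4
          have e : Y - X = f α - f β := by rw [hX, hY]; ring
          rw [e]
          refine this.trans ?_
          gcongr; linarith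
        calc _ ≤ (K * |α - β| * (3 * |α|) * (16 / (ε + |α - β|) ^ 2)) * 1 := by
              gcongr
              · exact h1.trans (by gcongr)
              · exact hps _
          _ = 48 * K * |α| * (|α - β| * (ε + |α - β|)⁻¹) * (ε + |α - β|)⁻¹ := by field_simp; ring
          _ ≤ 48 * K ^ 2 * |α| * 1 * (ε + |α - β|)⁻¹ := by
              gcongr
              · nlinarith
              · rw [← div_eq_mul_inv, div_le_one hσ]; linarith
          _ = _ := by ring
      have t2 : |(PK Y0 (0 - β) - PK X (0 - β)) * ψ ((0 - β) / s)| ≤ 32 * K ^ 2 * |α| * (ε + |β|)⁻¹ := by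
        rw [abs_mul]
        have h1 := PK_sub_le he lX lY0 (0 - β)
        have h2 : |Y0 - X| ≤ K * |β| * (2 * |α|) := by
          have e : Y0 - X = - f β := by rw [hX, hY0, hf.f0]; ring
          rw [e, abs_neg]
          refine hfβ.trans ?_
          rw [← sq_abs β, pow_two, mul_assoc]
          gcongr
        rw [zero_sub, abs_neg] at h1
        rw [zero_sub]
        calc _ ≤ (K * |β| * (2 * |α|) * (16 / (ε + |β|) ^ 2)) * 1 := by
              gcongr
              · exact h1.trans (by gcongr)
              · exact hps _
          _ = 32 * K * |α| * (|β| * (ε + |β|)⁻¹) * (ε + |β|)⁻¹ := by field_simp; ring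
          _ ≤ 32 * K ^ 2 * |α| * 1 * (ε + |β|)⁻¹ := by
              gcongr
              · nlinarith
              · rw [← div_eq_mul_inv, div_le_one hρ]; linarith
          _ = _ := by ring
      refine (abs_sub _ _).trans ((add_le_add t1 t2).trans ?_)
      have q1 : 0 ≤ K ^ 2 * |α| * (ε + |α - β|)⁻¹ := by positivity
      have q2 : 0 ≤ K ^ 2 * |α| * (ε + |β|)⁻¹ := by positivity
      linarith
    · push Not at hc
      have hlow : |β| / 2 ≤ |α - β| := by
        have := abs_sub_abs_le_abs_sub β α
        rw [abs_sub_comm β α] at this; linarith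
      set N := QK Y (α - β) * QK X (α - β) - PK Y (α - β) * PK X (α - β) with hN
      set N0 := QK Y0 (0 - β) * QK X (0 - β) - PK Y0 (0 - β) * PK X (0 - β) with hN0
      have eY : Y - Y0 = f α := by rw [hY, hY0, hf.f0]; ring
      have hNN := N_lip (ε := ε) (ρ := ε + |β|) (a := Y) (b := Y0) (X := X) (x := α - β) (y := 0 - β) (D := 2 * K * |α|)
        he hρ lY lY0 lX (by linarith) (by rw [zero_sub, abs_neg]; linarith [abs_nonneg β]) (by
          have : α - β - (0 - β) = α := by ring
          rw [this, eY]
          have : K * α ^ 2 ≤ K * |α| := by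
            rw [← sq_abs]; gcongr; nlinarith
          nlinarith)
      rw [← hN, ← hN0] at hNN
      have hN0b : |N0| ≤ 16 / (ε + |β|) ^ 2 := by
        refine (N_lip (ε := ε) (ρ := ε + |β|) (a := Y0) (b := Y0) (X := X) (x := 0 - β) (y := 0 - β) (D := 0)
          he hρ lY0 lY0 lX ?_ ?_ (by simp)).1
        · rw [zero_sub, abs_neg]; linarith [abs_nonneg β]
        · rw [zero_sub, abs_neg]; linarith [abs_nonneg β]
      rw [PK_sub (he.trans_le lX) (he.trans_le lY), PK_sub (he.trans_le lX) (he.trans_le lY0), ← hN, ← hN0]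
      have eYX : Y - X = f α - f β := by rw [hX, hY]; ring
      have eY0X : Y0 - X = - f β := by rw [hX, hY0, hf.f0]; ring
      rw [eYX, eY0X]
      have e : (f α - f β) * N * ψ ((α - β) / s) - -f β * N0 * ψ ((0 - β) / s)
        = f α * N * ψ ((α - β) / s) - f β * (N - N0) * ψ ((α - β) / s)
          - f β * N0 * (ψ ((α - β) / s) - ψ ((0 - β) / s)) := by ring
      have hr1 : |β| * (ε + |β|)⁻¹ ≤ 1 := by rw [← div_eq_mul_inv, div_le_one hρ]; linarith
      have hr2 : |β| ^ 2 * (ε + |β|)⁻¹ ^ 2 ≤ 1 := by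
        rw [← mul_pow]; exact pow_le_one₀ (by positivity) hr1
      have t1 : |f α * N * ψ ((α - β) / s)| ≤ 8 * K ^ 2 * |α| * (ε + |β|)⁻¹ := by
        rw [abs_mul, abs_mul]
        have h2 : |f α| ≤ K * (|α| * (|β| / 2)) := by
          refine hfα.trans ?_
          rw [← sq_abs, pow_two]; gcongr; linarith
        calc _ ≤ K * (|α| * (|β| / 2)) * (16 / (ε + |β|) ^ 2) * 1 := by
              gcongr
              · exact hNN.1
              · exact hps _
          _ = 8 * K * |α| * (|β| * (ε + |β|)⁻¹) * (ε + |β|)⁻¹ := by field_simp; ring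
          _ ≤ 8 * K ^ 2 * |α| * 1 * (ε + |β|)⁻¹ := by
              gcongr
              nlinarith
          _ = _ := by ring
      have t2 : |f β * (N - N0) * ψ ((α - β) / s)| ≤ 256 * K ^ 2 * |α| * (ε + |β|)⁻¹ := by
        rw [abs_mul, abs_mul]
        have h2 : |f β| ≤ K * |β| ^ 2 := by rw [sq_abs]; exact hfβ
        calc _ ≤ K * |β| ^ 2 * (128 * (2 * K * |α|) / (ε + |β|) ^ 3) * 1 := by
              gcongr
              · exact hNN.2
              · exact hps _
          _ = 256 * K ^ 2 * |α| * (|β| ^ 2 * (ε + |β|)⁻¹ ^ 2) * (ε + |β|)⁻¹ := by field_simp; ring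
          _ ≤ 256 * K ^ 2 * |α| * 1 * (ε + |β|)⁻¹ := by gcongr
          _ = _ := by ring
      have t3 : |f β * N0 * (ψ ((α - β) / s) - ψ ((0 - β) / s))| ≤ 48 * K ^ 2 * |α| * (ε + |β|)⁻¹ := by
        rw [abs_mul, abs_mul]
        have h2 : |f β| ≤ K * |β| ^ 2 := by rw [sq_abs]; exact hfβ
        have hl := hψ.abs_sub_le (r := s) hs (α - β) (0 - β)
        have : α - β - (0 - β) = α := by ring
        rw [this] at hl
        calc _ ≤ K * |β| ^ 2 * (16 / (ε + |β|) ^ 2) * (K * |α| / s) := by gcongr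
          _ = 16 * K ^ 2 * |α| * (|β| ^ 2 * (ε + |β|)⁻¹ ^ 2) * (1 / s) := by field_simp
          _ ≤ 16 * K ^ 2 * |α| * 1 * (3 * (ε + |β|)⁻¹) := by gcongr
          _ = _ := by ring
      rw [e]
      refine (abs_sub _ _).trans ((add_le_add (abs_sub _ _) le_rfl).trans ?_)
      have q1 : 0 ≤ K ^ 2 * |α| * (ε + |α - β|)⁻¹ := by positivity
      have q2 : 0 ≤ K ^ 2 * |α| * (ε + |β|)⁻¹ := by positivity
      linarith
  rw [e0]
  refine (abs_sub _ _).trans ((add_le_add b1 b2).trans ?_)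
  have q1 : 0 ≤ K ^ 2 * |α| * (ε + |α - β|)⁻¹ := by positivity
  linarith

end


section
open scoped ENNReal Topology

lemma qc_PK {ε c : ℝ} (he : 0 < ε) (hc : ε ≤ c) (hc8 : c ≤ 8 * ε) (α : ℝ) : |qc ε c α| ≤ 144 * PK ε α := by
  refine (qc_bound he hc hc8 α).trans ?_
  unfold PK
  have hr : 0 < ε + |α| := by positivity
  rw [← mul_div_assoc, div_le_div_iff₀ (by positivity) (den_pos he α), ← sq_abs α]
  have h1 : |α| ^ 2 + ε ^ 2 ≤ (ε + |α|) ^ 2 := by nlinarith [abs_nonneg α]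
  calc 144 * ε ^ 2 * (|α| ^ 2 + ε ^ 2) = 144 * ε * (ε * (|α| ^ 2 + ε ^ 2)) := by ring
    _ ≤ 144 * ε * ((ε + |α|) * (ε + |α|) ^ 2) := by gcongr; linarith [abs_nonneg α]
    _ = _ := by ring

lemma integrable_qc {ε c : ℝ} (he : 0 < ε) (hc : ε ≤ c) (hc8 : c ≤ 8 * ε) : Integrable (qc ε c) :=
  ((integrable_PK he).const_mul 144).mono' (measurable_qc ε c).aestronglyMeasurable
    (Eventually.of_forall fun α => qc_PK he hc hc8 α)

lemma qc_tail {K ε s L c : ℝ} (hp : Par K ε s L) (hc : ε ≤ c) (hc8 : c ≤ 8 * ε) {α : ℝ} (ha : s ≤ |α|) :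
    |qc ε c α| ≤ 288 * ε * PK s α := by
  have he := hp.he0
  have hs := hp.hs
  refine (qc_bound he hc hc8 α).trans ?_
  unfold PK
  have hr : 0 < ε + |α| := by positivity
  rw [← mul_div_assoc, div_le_div_iff₀ (by positivity) (den_pos hs α), ← sq_abs α]
  have h1 : |α| ^ 2 + s ^ 2 ≤ 2 * (ε + |α|) ^ 2 := by nlinarith [abs_nonneg α]
  calc 144 * ε ^ 2 * (|α| ^ 2 + s ^ 2) ≤ 144 * ε ^ 2 * (2 * (ε + |α|) ^ 2) := by gcongr
    _ = 288 * ε * s * (s * (ε + |α|) ^ 2) := by rw [hp.he]; ring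
    _ ≤ 288 * ε * s * ((ε + |α|) * (ε + |α|) ^ 2) := by gcongr; linarith
    _ = _ := by ring

section
variable {K ε s L c C1 B : ℝ} {ψ f f1 f2 g g1 g2 H ω : ℝ → ℝ}

/-- pairing against the Poisson extension -/
lemma PKsh_int {ε α : ℝ} (he : 0 < ε) : Integrable (fun β => PK ε (α - β)) ∧ ∫ β, PK ε (α - β) = π := by
  refine ⟨(integrable_PK he).comp_sub_left α, ?_⟩
  rw [integral_sub_left_eq_self (fun x => PK ε x) volume α, integral_PK he]

lemma PK_meas2 {F : ℝ × ℝ → ℝ} (hF : Measurable F) : Measurable (fun p : ℝ × ℝ => PK (F p) (p.1 - p.2)) := by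
  unfold PK; fun_prop

lemma m3_est (hp : Par K ε s L) (hf : Fn K s f f1 f2) (hg : Fn K s g g1 g2) (hfg : PairFG K ε s f g)
    (hH : HH ε s c C1 H) (hc : ε ≤ c) (hc6 : c ≤ 6 * ε) {w : ℝ → ℝ} (bw : BC w B (2 * s)) (hw2 : ∀ t, 2 * s ≤ |t| → w t = 0) :
    Integrable (fun α => H α * ∫ β, PK (2 * ε + f β + g β) (α - β) * w β) ∧
    |(∫ α, H α * ∫ β, PK (2 * ε + f β + g β) (α - β) * w β) + π ^ 2 * ∫ β, qc ε (c + 2 * ε) β * w β|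
      ≤ (8 * C1 * K * B + 20000 * K * B + 10400 * K ^ 2 * B) * (ε * L) := by
  have he := hp.he0
  have hs := hp.hs
  have hK := hp.hK
  have hL := hp.hL1
  have hc0 := he.trans_le hc
  have hc8 : c ≤ 8 * ε := by linarith
  have hpi := Real.pi_pos
  have hpi4 := Real.pi_lt_four
  have hB0 := bw.M_nonneg
  have mw := bw.meas
  have mf := hf.mf
  have mg := hg.mf
  have hC1 := hH.C1_nonneg he
  set X : ℝ → ℝ := fun β => 2 * ε + f β + g β with hX
  have mX : Measurable X := by fun_prop
  have lX : ∀ β, |β| < 2 * s → ε ≤ X β := fun β hb => hfg.lo β β (by linarith) (by linarith)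
  have uX : ∀ β, |β| < 2 * s → X β ≤ K * ε := fun β hb => hfg.hi β β (by linarith) (by linarith)
  have mG : Measurable (fun p : ℝ × ℝ => PK (X p.2) (p.1 - p.2) * w p.2) :=
    (PK_meas2 (F := fun p => X p.2) (mX.comp measurable_snd)).mul (mw.comp measurable_snd)
  set m3 : ℝ → ℝ := fun α => ∫ β, PK (X β) (α - β) * w β with hm3
  have mm3 : Measurable m3 := measurable_iG mG
  have bG : ∀ α β, |PK (X β) (α - β) * w β| ≤ K * B * PK ε (α - β) := by
    intro α β
    by_cases hb : |β| < 2 * s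
    · rw [abs_mul, abs_of_nonneg (PK_nonneg (he.trans_le (lX β hb)) _)]
      calc _ ≤ (K * PK ε (α - β)) * B := by
            have := PK_nonneg he (α - β)
            gcongr
            · exact PKK he (lX β hb) (uX β hb) _
            · exact bw.bd β
        _ = _ := by ring
    · rw [hw2 β (not_lt.1 hb)]; simp
      have := PK_nonneg he (α - β); positivity
  have bm3 : ∀ α, |m3 α| ≤ 4 * K * B := by
    intro α
    obtain ⟨i1, i2⟩ := PKsh_int (α := α) he
    have := norm_integral_le_of_norm_le (f := fun β => PK (X β) (α - β) * w β) (i1.const_mul (K * B)) (Eventually.of_forall fun β => bG α β)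
    rw [Real.norm_eq_abs, integral_const_mul, i2] at this
    refine this.trans ?_
    have : 0 ≤ K * B := by positivity
    nlinarith
  -- cut-off
  set u : ℝ → ℝ := (Icc (-(2 * s)) (2 * s)).indicator m3 with hu
  have uin : ∀ t, |t| ≤ 2 * s → u t = m3 t := fun t ht =>
    Set.indicator_of_mem (show t ∈ Icc _ _ from abs_le.1 ht) _
  have uout : ∀ t, 2 * s < |t| → u t = 0 := fun t ht =>
    Set.indicator_of_notMem (fun hc => by have := abs_le.2 hc; linarith) _
  have bu : BC u (4 * K * B) (2 * s) := by
    refine ⟨mm3.indicator measurableSet_Icc, fun t => ?_, uout⟩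
    by_cases ht : |t| ≤ 2 * s
    · rw [uin t ht]; exact bm3 t
    · rw [uout t (not_le.1 ht), abs_zero]; positivity
  obtain ⟨p1, p2⟩ := hH.pair hp hc hc8 bu
  have eH : ∀ α, H α * m3 α = H α * u α := by
    intro α
    by_cases ht : |α| ≤ 2 * s
    · rw [uin α ht]
    · rw [hH.supp α (by linarith [not_le.1 ht]), zero_mul, zero_mul]
  have iqm : Integrable (fun α => qc ε c α * m3 α) := by
    refine ((integrable_PK he).const_mul (144 * (4 * K * B))).mono' ((measurable_qc ε c).mul mm3).aestronglyMeasurable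
      (Eventually.of_forall fun α => ?_)
    rw [Real.norm_eq_abs, abs_mul]
    calc _ ≤ 144 * PK ε α * (4 * K * B) := by
          have := PK_nonneg he α
          gcongr
          · exact qc_PK he hc hc8 α
          · exact bm3 α
      _ = _ := by ring
  have iqu : Integrable (fun α => qc ε c α * u α) :=
    bu.integrable_mul (measurable_qc ε c) (c := 144 / ε) (fun t => qc_abs he hc hc8 t)
  have tail : |(∫ α, qc ε c α * u α) - ∫ α, qc ε c α * m3 α| ≤ 4608 * K * B * ε := by
    rw [← integral_sub iqu iqm, ← Real.norm_eq_abs]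
    have := norm_integral_le_of_norm_le (f := fun α => qc ε c α * u α - qc ε c α * m3 α)
      ((integrable_PK hs).const_mul (288 * ε * (4 * K * B))) (Eventually.of_forall fun α => by
        by_cases ht : |α| ≤ 2 * s
        · rw [uin α ht, sub_self, norm_zero]
          have := PK_nonneg hs α; positivity
        · rw [uout α (not_le.1 ht), mul_zero, zero_sub, norm_neg, Real.norm_eq_abs, abs_mul]
          calc _ ≤ 288 * ε * PK s α * (4 * K * B) := by
                have := PK_nonneg hs α
                gcongr
                · exact qc_tail hp hc hc8 (by linarith [not_le.1 ht])
                · exact bm3 α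
            _ = _ := by ring)
    refine this.trans ?_
    rw [integral_const_mul, integral_PK hs]
    have : 0 ≤ ε * (K * B) := by positivity
    nlinarith
  -- Fubini
  have fub : ∫ α, qc ε c α * m3 α = ∫ β, (π * (QK (c + X β) β - QK (c + 2 * ε + X β) β)) * w β := by
    have e1 : ∀ α, qc ε c α * m3 α = ∫ β, qc ε c α * (PK (X β) (α - β) * w β) := fun α => by
      rw [integral_const_mul]
    simp_rw [e1]
    rw [integral_integral_swap]
    · have hz : ∀ᵐ β : ℝ, β ≠ 0 := by simp [ae_iff]
      refine integral_congr_ae ?_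
      filter_upwards [hz] with β hβ
      by_cases hb : |β| < 2 * s
      · have hX0 := he.trans_le (lX β hb)
        have k1 := integral_PQ (a := X β) (b := c) (t := β) hX0 hc0 hβ
        have k2 := integral_PQ (a := X β) (b := c + 2 * ε) (t := β) hX0 (by linarith) hβ
        have j1 := integrable_PQ (a := X β) (b := c) (t := β) hX0 hc0
        have j2 := integrable_PQ (a := X β) (b := c + 2 * ε) (t := β) hX0 (by linarith)
        have e2 : ∀ α, qc ε c α * (PK (X β) (α - β) * w β) =
          (PK (X β) (α - β) * QK c α - PK (X β) (α - β) * QK (c + 2 * ε) α) * w β := fun α => by unfold qc; ring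
        simp_rw [e2]
        rw [integral_mul_const, integral_sub j1 j2, k1, k2, add_comm (X β) c, add_comm (X β)]; ring
      · rw [hw2 β (not_lt.1 hb)]; simp
    · have hi : Integrable (fun p : ℝ × ℝ => (144 * PK ε p.1) * (K * ε⁻¹ * |w p.2|)) (volume.prod volume) :=
        ((integrable_PK he).const_mul 144).mul_prod ((bw.integrable.abs).const_mul (K * ε⁻¹))
      refine hi.mono' (((measurable_qc ε c).comp measurable_fst).mul mG).aestronglyMeasurable
        (Eventually.of_forall fun p => ?_)
      simp only [Function.uncurry]
      rw [Real.norm_eq_abs, abs_mul, abs_mul]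
      have h0 := PK_nonneg he p.1
      have h1 := qc_PK he hc hc8 p.1
      have h2 : |PK (X p.2) (p.1 - p.2)| * |w p.2| ≤ K * ε⁻¹ * |w p.2| := by
        by_cases hb : |p.2| < 2 * s
        · rw [abs_of_nonneg (PK_nonneg (he.trans_le (lX _ hb)) _)]
          gcongr
          exact (PKK he (lX _ hb) (uX _ hb) _).trans (by gcongr; exact PK_le he _)
        · rw [hw2 _ (not_lt.1 hb)]; simp
      gcongr
  have hne2 : ∀ᵐ t : ℝ, |t| ≠ 2 * s := by
    have h1 : ∀ᵐ t : ℝ, t ≠ 2 * s := by simp [ae_iff]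
    have h2 : ∀ᵐ t : ℝ, t ≠ -(2 * s) := by simp [ae_iff]
    filter_upwards [h1, h2] with t g1 g2 h3
    rcases eq_or_eq_neg_of_abs_eq h3 with h | h
    · exact g1 h
    · exact g2 h
  have mQX : ∀ a : ℝ, Measurable (fun β => QK (a + X β) β) := fun a => by unfold QK; fun_prop
  have iqw : Integrable (fun β => qc ε (c + 2 * ε) β * w β) :=
    bw.integrable_mul (measurable_qc ε _) (c := 144 / ε) (fun t => qc_abs he (by linarith) (by linarith) t)
  have cmp := bw.int_rho hp
    (g := fun β => π * (QK (c + X β) β - QK (c + 2 * ε + X β) β) - π * qc ε (c + 2 * ε) β) (c := 1280 * K ^ 2 * ε)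
    (by positivity) ((((mQX c).sub (mQX (c + 2 * ε))).const_mul π).sub ((measurable_qc ε _).const_mul π)) (by
      filter_upwards [hne2] with t ht1 ht
      have ht : |t| < 2 * s := lt_of_le_of_ne ht ht1
      have hXb : |X t - 2 * ε| ≤ 2 * K * t ^ 2 := by
        have e : X t - 2 * ε = f t + g t := by simp only [hX]; ring
        rw [e]
        refine (abs_add_le _ _).trans ?_
        have := hf.abs_le hs (by linarith : |t| < 4 * s)
        have := hg.abs_le hs (by linarith : |t| < 4 * s)
        linarith
      have q1 := QX_bound (s := s) hK he hc hc8 (lX t ht) (uX t ht) hXb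
      have q2 := QX_bound (s := s) (c := c + 2 * ε) hK he (by linarith) (by linarith) (lX t ht) (uX t ht) hXb
      have e : π * (QK (c + X t) t - QK (c + 2 * ε + X t) t) - π * qc ε (c + 2 * ε) t =
        π * ((QK (c + X t) t - QK (c + 2 * ε) t) - (QK (c + 2 * ε + X t) t - QK (c + 2 * ε + 2 * ε) t)) := by
        unfold qc; ring
      rw [e, abs_mul, abs_of_pos hpi]
      calc _ ≤ 4 * (160 * K ^ 2 * ε / (ε + |t|) + 160 * K ^ 2 * ε / (ε + |t|)) := by
            gcongr
            exact (abs_sub _ _).trans (add_le_add q1 q2)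
        _ = _ := by ring)
  have iX : Integrable (fun β => (π * (QK (c + X β) β - QK (c + 2 * ε + X β) β)) * w β) := by
    refine (cmp.1.add (iqw.const_mul π)).congr (Eventually.of_forall fun β => ?_)
    simp only [Pi.add_apply]; ring
  have cmp2 : |(∫ α, qc ε c α * m3 α) - π * ∫ β, qc ε (c + 2 * ε) β * w β| ≤ 2560 * K ^ 2 * B * (ε * L) := by
    rw [fub, ← integral_const_mul, ← integral_sub iX (iqw.const_mul π)]
    have e : ∀ β, (π * (QK (c + X β) β - QK (c + 2 * ε + X β) β)) * w β - π * (qc ε (c + 2 * ε) β * w β)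
      = (π * (QK (c + X β) β - QK (c + 2 * ε + X β) β) - π * qc ε (c + 2 * ε) β) * w β := fun β => by ring
    simp_rw [e]
    exact cmp.2.trans_eq (by ring)
  change Integrable (fun α => H α * m3 α) ∧ |(∫ α, H α * m3 α) + π ^ 2 * ∫ β, qc ε (c + 2 * ε) β * w β| ≤ _
  simp_rw [eH]
  refine ⟨p1, ?_⟩
  have hεL : ε ≤ ε * L := by nlinarith
  have e : (∫ α, H α * u α) + π ^ 2 * ∫ β, qc ε (c + 2 * ε) β * w β =
    ((∫ α, H α * u α) + π * ∫ α, qc ε c α * u α) - π * ((∫ α, qc ε c α * u α) - ∫ α, qc ε c α * m3 α)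
      - π * ((∫ α, qc ε c α * m3 α) - π * ∫ β, qc ε (c + 2 * ε) β * w β) := by ring
  rw [e]
  refine (abs_sub _ _).trans ((add_le_add (abs_sub _ _) le_rfl).trans ?_)
  rw [abs_mul, abs_mul, abs_of_pos hpi]
  have z1 : π * |(∫ α, qc ε c α * u α) - ∫ α, qc ε c α * m3 α| ≤ 4 * (4608 * K * B * ε) := by gcongr
  have z2 : π * |(∫ α, qc ε c α * m3 α) - π * ∫ β, qc ε (c + 2 * ε) β * w β| ≤ 4 * (2560 * K ^ 2 * B * (ε * L)) := by gcongr
  have z3 := mul_le_mul_of_nonneg_left hεL (show 0 ≤ K * B by positivity)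
  have z4 : 0 ≤ K ^ 2 * B * (ε * L) := by positivity
  have z5 : 0 ≤ K * B * (ε * L) := by positivity
  linarith

theorem T3_est (hp : Par K ε s L) (hψ : Cut K ψ) (hf : Fn K s f f1 f2) (hg : Fn K s g g1 g2) (hfg : PairFG K ε s f g)
    (hH : HH ε s c C1 H) (hc : ε ≤ c) (hc6 : c ≤ 6 * ε) (hω : Measurable ω) (hB : 1 ≤ B)
    (hωb : ∀ β, |β| < 2 * s → |ω β| ≤ B) :
    ∃ V : ℝ → ℝ, (∀ α, |α| < s → 2 * π * T3 ψ ε f g ω α = V α) ∧ Integrable (fun α => H α * V α) ∧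
      |(∫ α, H α * V α) + π ^ 2 * ∫ β, qc ε (c + 2 * ε) β * wt s ω β| ≤
        (1152 * (2000 * K ^ 2 * B) + 2 * C1 * (8 * K * B) + 8 * C1 * K * B + 20000 * K * B + 10400 * K ^ 2 * B) * (ε * L) := by
  have he := hp.he0
  have hs := hp.hs
  have hK := hp.hK
  have hL := hp.hL1
  have hc0 := he.trans_le hc
  have hc8 : c ≤ 8 * ε := by linarith
  have hpi := Real.pi_pos
  have hpi4 := Real.pi_lt_four
  have hss : Real.sqrt ε = s := by rw [hp.he]; exact Real.sqrt_sq hs.le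
  have hB0 : 0 ≤ B := by linarith
  have bw := BC_wt hω hB0 hωb
  have mw := bw.meas
  have mf := hf.mf
  have mg := hg.mf
  have mψ := hψ.m
  obtain ⟨m1, m2⟩ := m3_est hp hf hg hfg hH hc hc6 bw (fun t ht => wt_out ht)
  have mD : Measurable (fun p : ℝ × ℝ => D3 ψ s ε f g p.1 p.2) := by
    unfold D3
    refine ((PK_meas2 (F := fun p => 2 * ε + f p.1 + g p.2) (by fun_prop)).mul (by fun_prop)).sub
      (PK_meas2 (F := fun p => 2 * ε + f p.2 + g p.2) (by fun_prop))
  have mDα : ∀ α, Measurable (D3 ψ s ε f g α) := fun α => mD.comp (measurable_const.prodMk measurable_id)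
  set Θ : ℝ → ℝ := fun α => ∫ β, D3 ψ s ε f g α β * wt s ω β with hΘ
  have mΘ : Measurable Θ := measurable_iG (G := fun p => D3 ψ s ε f g p.1 p.2 * wt s ω p.2)
    (mD.mul (mw.comp measurable_snd))
  have hD : ∀ α, |α| < s → Integrable (fun β => D3 ψ s ε f g α β * wt s ω β) ∧ |Θ α| ≤ 8 * K * B := by
    intro α ha
    obtain ⟨i1, i2⟩ := PKsh_int (α := α) he
    have := bw.int_le (mDα α) ((i1.const_mul (2 * K)).integrableOn)
      (Eventually.of_forall fun t ht => D3_bd hp hψ hfg ha (by linarith))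
    refine ⟨this.1, this.2.trans ?_⟩
    have h1 : ∫ t in Icc (-(2 * s)) (2 * s), 2 * K * PK ε (α - t) ≤ ∫ t, 2 * K * PK ε (α - t) :=
      setIntegral_le_integral (i1.const_mul (2 * K)) (Eventually.of_forall fun t => by
        have := PK_nonneg he (α - t); simp only [Pi.zero_apply]; positivity)
    have h3 : ∫ t, 2 * K * PK ε (α - t) = 2 * K * π := by rw [integral_const_mul, i2]
    rw [h3] at h1
    calc _ ≤ B * (2 * K * 4) := by
          gcongr
          exact h1.trans (by gcongr)
      _ = _ := by ring
  have hne2 : ∀ᵐ t : ℝ, |t| ≠ 2 * s := by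
    have h1 : ∀ᵐ t : ℝ, t ≠ 2 * s := by simp [ae_iff]
    have h2 : ∀ᵐ t : ℝ, t ≠ -(2 * s) := by simp [ae_iff]
    filter_upwards [h1, h2] with t g1 g2 h3
    rcases eq_or_eq_neg_of_abs_eq h3 with h | h
    · exact g1 h
    · exact g2 h
  have hΛ : ∀ α, |α| < s → |Θ α - Θ 0| ≤ (2000 * K ^ 2 * B * L) * (|α| + ε) := by
    intro α ha
    have h0 : |(0:ℝ)| < s := by simpa using hs
    have e : Θ α - Θ 0 = ∫ β, (D3 ψ s ε f g α β - D3 ψ s ε f g 0 β) * wt s ω β := by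
      simp only [hΘ]
      rw [← integral_sub (hD α ha).1 (hD 0 h0).1]
      congr 1; ext β; ring
    rw [e]
    have r0 : IntegrableOn (fun x : ℝ => (ε + |x|)⁻¹) (Ioo (-(3 * s)) (3 * s)) := (integral_rho he (by linarith)).1
    have r1 := integral_rho_le hp
    set k : ℝ → ℝ := (Ioo (-(3 * s)) (3 * s)).indicator (fun x : ℝ => (ε + |x|)⁻¹) with hk
    have ik : Integrable k := (integrable_indicator_iff measurableSet_Ioo).2 r0
    have ek : ∫ x, k x ≤ 2 * L := by rw [hk, integral_indicator measurableSet_Ioo]; exact r1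
    have k0 : ∀ x, 0 ≤ k x := fun x => Set.indicator_nonneg (fun x _ => by positivity) x
    have ika : Integrable (fun β => k (α - β)) := ik.comp_sub_left α
    have eka : ∫ β, k (α - β) = ∫ x, k x := integral_sub_left_eq_self k volume α
    obtain ⟨j1, j2⟩ := rho_2s hp
    have := bw.int_le ((mDα α).sub (mDα 0))
      (((ika.integrableOn (s := Icc (-(2 * s)) (2 * s))).add j1).const_mul (500 * K ^ 2 * |α|)) (by
        filter_upwards [hne2] with t ht1 ht
        have ht : |t| < 2 * s := lt_of_le_of_ne ht ht1
        refine (D3_lip hp hψ hf hfg ha ht).trans_eq ?_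
        simp only [Pi.add_apply, hk]
        rw [Set.indicator_of_mem]
        exact abs_lt.1 ((abs_sub _ _).trans_lt (by linarith)))
    refine this.2.trans ?_
    rw [integral_const_mul]
    have h1 : ∫ t in Icc (-(2 * s)) (2 * s), (((fun β => k (α - β)) + fun x => (ε + |x|)⁻¹) t) ≤ 4 * L := by
      simp only [Pi.add_apply]
      rw [integral_add ika.integrableOn j1]
      have : ∫ t in Icc (-(2 * s)) (2 * s), k (α - t) ≤ ∫ t, k (α - t) :=
        setIntegral_le_integral ika (Eventually.of_forall fun t => k0 _)
      linarith
    calc _ ≤ B * (500 * K ^ 2 * |α| * (4 * L)) := by gcongr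
      _ = 2000 * K ^ 2 * B * L * |α| := by ring
      _ ≤ _ := by gcongr; linarith
  obtain ⟨c1, c2⟩ := CRIT hp hH hc hc8 mΘ (fun α ha => (hD α ha).2) hΛ
  set m3 : ℝ → ℝ := fun α => ∫ β, PK (2 * ε + f β + g β) (α - β) * wt s ω β with hm3
  have eHV : ∀ α, H α * (m3 α + Θ α) = H α * m3 α + H α * Θ α := fun α => by ring
  refine ⟨fun α => m3 α + Θ α, ?_, ?_, ?_⟩
  · intro α ha
    unfold T3
    rw [← mul_assoc, mul_inv_cancel₀ (by positivity), one_mul]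
    have im : Integrable (fun β => PK (2 * ε + f β + g β) (α - β) * wt s ω β) := by
      obtain ⟨i1, i2⟩ := PKsh_int (α := α) he
      refine (bw.int_le (G := fun t => K * PK ε (α - t)) ?_ ((i1.const_mul K).integrableOn)
        (Eventually.of_forall fun t ht => ?_)).1
      · unfold PK; fun_prop
      · have l := hfg.lo t t (by linarith) (by linarith)
        rw [abs_of_nonneg (PK_nonneg (he.trans_le l) _)]
        exact PKK he l (hfg.hi t t (by linarith) (by linarith)) _
    simp only [hm3, hΘ]
    rw [← integral_add im (hD α ha).1]
    congr 1; ext β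
    simp only [scut, hss]
    rw [mul_assoc, hψ.wt_eq hs ha]
    unfold D3 PK
    ring
  · simp_rw [eHV]; exact m1.add c1
  · simp_rw [eHV]
    rw [integral_add m1 c1]
    have e : ∀ a b c : ℝ, a + b + c = (a + c) + b := fun a b c => by ring
    rw [e]
    refine (abs_add_le _ _).trans ((add_le_add m2 c2).trans_eq ?_)
    ring
end

end


section
open scoped ENNReal Topology

theorem Feq {K ε s L c C1 B CE τ : ℝ} {ψ f f1 f2 g g1 g2 H F E ωa ωb : ℝ → ℝ}
    (hp : Par K ε s L) (hψ : Cut K ψ) (hf : Fn K s f f1 f2) (hg : Fn K s g g1 g2) (hfg : PairFG K ε s f g)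
    (hH : HH ε s c C1 H) (hc : ε ≤ c) (hc6 : c ≤ 6 * ε) (ma : Measurable ωa) (mb : Measurable ωb) (hB : 1 ≤ B)
    (ba : ∀ β, |β| < 2 * s → |ωa β| ≤ B) (bb : ∀ β, |β| < 2 * s → |ωb β| ≤ B) (hτ : |τ| ≤ 1)
    (mF : Measurable F) (bF : ∀ α, |α| < s → |F α| ≤ B) (lF : ∀ α, |α| < s → |F α - F 0| ≤ B * |α|)
    (hE : |∫ α, E α * H α| ≤ CE * (ε * L))
    (hid : ∀ α, |α| < s → F α = T1 ψ ε f ωa α - T3 ψ ε f g ωb α + τ * ωa α + E α) :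
    |2 * τ * (∫ β, qc ε c β * wt s ωa β) - ∫ β, qc ε (c + 2 * ε) β * wt s ωb β| ≤
      (8 * CE + 8 * (1152 * B + 2 * C1 * B) + (1152 * (2800 * K ^ 5 * B) + 2 * C1 * (2 * K ^ 5 * B) + 2 * C1 ^ 2 + 256 * K ^ 2 * B ^ 2
        + 1024 * K * B) + (1152 * (2000 * K ^ 2 * B) + 2 * C1 * (8 * K * B) + 8 * C1 * K * B + 20000 * K * B + 10400 * K ^ 2 * B)
        + 16 * C1 * B) * (ε * L) := by
  have he := hp.he0
  have hs := hp.hs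
  have hL := hp.hL1
  have hpi := Real.pi_pos
  have hpi4 := Real.pi_lt_four
  have hpi1 : 1 ≤ π := by linarith [Real.pi_gt_three]
  have hc8 : c ≤ 8 * ε := by linarith
  have hB0 : 0 ≤ B := by linarith
  obtain ⟨V1, v1, i1, b1⟩ := T1_est hp hψ hf hH hc hc6 ma hB ba
  obtain ⟨V3, v3, i3, b3⟩ := T3_est hp hψ hf hg hfg hH hc hc6 mb hB bb
  obtain ⟨iF, bF'⟩ := CRIT hp hH hc hc8 mF bF (Λ := B) (fun α ha => (lF α ha).trans (by gcongr; linarith))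
  obtain ⟨iw, bw⟩ := hH.pair hp hc hc8 (BC_wt ma hB0 ba)
  have ae : (fun α => 2 * π * (E α * H α)) =ᵐ[volume]
      fun α => 2 * π * (H α * F α) - H α * V1 α + H α * V3 α - 2 * π * τ * (H α * wt s ωa α) := by
    filter_upwards [v1] with α h1
    by_cases ha : |α| < s
    · rw [← h1 ha, ← v3 α ha, wt_in (by linarith), hid α ha]; ring
    · rw [hH.supp α (not_lt.1 ha)]; ring
  have j1 : Integrable (fun α => 2 * π * (H α * F α) - H α * V1 α) := (iF.const_mul _).sub i1
  have j2 : Integrable (fun α => 2 * π * (H α * F α) - H α * V1 α + H α * V3 α) := j1.add i3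
  have eI : 2 * π * ∫ α, E α * H α = 2 * π * (∫ α, H α * F α) - (∫ α, H α * V1 α) + (∫ α, H α * V3 α)
      - 2 * π * τ * ∫ α, H α * wt s ωa α := by
    rw [← integral_const_mul, integral_congr_ae ae, integral_sub j2 (iw.const_mul _), integral_add j1 i3,
      integral_sub (iF.const_mul _) i1, integral_const_mul, integral_const_mul]
  set a := ∫ β, qc ε c β * wt s ωa β
  set b := ∫ β, qc ε (c + 2 * ε) β * wt s ωb β
  set IE := ∫ α, E α * H α
  set I1 := ∫ α, H α * V1 α
  set I3 := ∫ α, H α * V3 α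
  set IF := ∫ α, H α * F α
  set Iw := ∫ α, H α * wt s ωa α
  have key : π ^ 2 * (2 * τ * a - b) = 2 * π * IE - 2 * π * IF + I1 - (I3 + π ^ 2 * b) + 2 * π * τ * (Iw + π * a) := by
    rw [eI]; ring
  have h1 : |2 * τ * a - b| ≤ |π ^ 2 * (2 * τ * a - b)| := by
    rw [abs_mul, abs_of_pos (by positivity : 0 < π ^ 2)]
    have : 1 ≤ π ^ 2 := by nlinarith
    nlinarith [abs_nonneg (2 * τ * a - b)]
  refine h1.trans ?_
  rw [key]
  have t1 : |2 * π * IE| ≤ 8 * (CE * (ε * L)) := by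
    rw [abs_mul, abs_of_pos (by positivity : 0 < 2 * π)]
    gcongr; linarith
  have hεL : ε ≤ ε * L := by nlinarith
  have t2 : |2 * π * IF| ≤ 8 * ((1152 * B + 2 * C1 * B) * (ε * L)) := by
    rw [abs_mul, abs_of_pos (by positivity : 0 < 2 * π)]
    have : 1152 * B * ε ≤ 1152 * B * (ε * L) := by gcongr
    gcongr
    · linarith
    · linarith
  have t3 : |2 * π * τ * (Iw + π * a)| ≤ 8 * (2 * C1 * B * (ε * L)) := by
    rw [abs_mul, abs_mul, abs_of_pos (by positivity : 0 < 2 * π)]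
    have : 2 * π * |τ| ≤ 8 := by nlinarith [abs_nonneg τ]
    gcongr
  have u1 := abs_add_le (2 * π * IE - 2 * π * IF + I1 - (I3 + π ^ 2 * b)) (2 * π * τ * (Iw + π * a))
  have u2 := abs_sub (2 * π * IE - 2 * π * IF + I1) (I3 + π ^ 2 * b)
  have u3 := abs_add_le (2 * π * IE - 2 * π * IF) I1
  have u4 := abs_sub (2 * π * IE) (2 * π * IF)
  linarith

end


section
open scoped ENNReal Topology

lemma pv_decomp_c {u R F : ℝ → ℝ} {M R0 α v c : ℝ} (hu : BC u M R0)
    (hlim : Tendsto (fun r => ∫ t in {t : ℝ | r < |α - t|}, u t / (α - t)) (𝓝[>] 0) (𝓝 v))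
    (hR : Integrable R) (hF : ∀ β, α - β ≠ 0 → c * F β = u β / (α - β) + R β) : c * pvI F α = v + ∫ β, R β := by
  by_cases hc : c = 0
  · have h1 := pv_decomp (F := fun _ => 0) hu hlim hR (fun β hβ => by rw [← hF β hβ, hc, zero_mul])
    have h2 : pvI (fun _ => 0) α = 0 := by
      apply pvI_eq; simp
    rw [hc, zero_mul, ← h1, h2]
  · have hu' : BC (fun t => c⁻¹ * u t) (|c⁻¹| * M) R0 := by
      refine ⟨hu.meas.const_mul _, fun t => ?_, fun t ht => by rw [hu.supp t ht, mul_zero]⟩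
      rw [abs_mul]; have := hu.bd t; gcongr
    have hl' : Tendsto (fun r => ∫ t in {t : ℝ | r < |α - t|}, c⁻¹ * u t / (α - t)) (𝓝[>] 0) (𝓝 (c⁻¹ * v)) := by
      refine (hlim.const_mul c⁻¹).congr fun r => ?_
      rw [← integral_const_mul]
      congr 1; ext t; ring
    have := pv_decomp (F := F) hu' hl' (hR.const_mul c⁻¹) (fun β hβ => by
      have := hF β hβ
      field_simp at this ⊢
      linarith)
    rw [this, integral_const_mul]; field_simp

lemma U_diff (r p : ℝ) : |1 / (1 + r ^ 2) - 1 / (1 + p ^ 2)| ≤ |r - p| * (|r| + |p|) := by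
  have h1 : 0 < 1 + r ^ 2 := by positivity
  have h2 : 0 < 1 + p ^ 2 := by positivity
  have e : 1 / (1 + r ^ 2) - 1 / (1 + p ^ 2) = (p - r) * (r + p) / ((1 + r ^ 2) * (1 + p ^ 2)) := by
    field_simp; ring
  rw [e, abs_div, abs_mul, abs_of_pos (mul_pos h1 h2), abs_sub_comm p r]
  have h3 : 1 ≤ (1 + r ^ 2) * (1 + p ^ 2) := by nlinarith [sq_nonneg r, sq_nonneg p, mul_nonneg (sq_nonneg r) (sq_nonneg p)]
  calc _ ≤ |r - p| * |r + p| / 1 := by gcongr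
    _ ≤ _ := by rw [div_one]; gcongr; exact abs_add_le _ _

section
variable {K ε s L : ℝ} {ψ f f1 f2 g g1 g2 : ℝ → ℝ}

lemma mn_lip (hp : Par K ε s L) (hψ : Cut K ψ) (α β : ℝ) :
    |ψ (α / (s / 128)) * ψ ((α - β) / s) - ψ (β / (s / 128))| ≤ 129 * K * |α - β| / s := by
  have hs := hp.hs
  have hK := hp.hK
  have h1 := hψ.abs_sub_le (r := s / 128) (by positivity) α β
  have h2 := hψ.abs_sub_le (r := s) hs (α - β) 0
  rw [zero_div, sub_zero, hψ.one 0 (by simp)] at h2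
  have e : ψ (α / (s / 128)) * ψ ((α - β) / s) - ψ (β / (s / 128)) =
    ψ (α / (s / 128)) * (ψ ((α - β) / s) - 1) + (ψ (α / (s / 128)) - ψ (β / (s / 128))) := by ring
  rw [e]
  refine (abs_add_le _ _).trans ?_
  rw [abs_mul, abs_of_nonneg (hψ.nn _)]
  calc _ ≤ 1 * (K * |α - β| / s) + K * |α - β| / (s / 128) := by
        gcongr
        exact hψ.le1 _
    _ = _ := by field_simp; ring

lemma J2_bd (hp : Par K ε s L) (hψ : Cut K ψ) (hf : Fn K s f f1 f2) {α β : ℝ} (hb : |β| < 2 * s) (hx : α - β ≠ 0) :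
    |(ψ (α / (s / 128)) * ψ ((α - β) / s) * ((α - β) ^ 2 / ((α - β) ^ 2 + (f α - f β) ^ 2))
      - ψ (β / (s / 128)) * (1 / (1 + f1 β ^ 2))) / (α - β)
      - (ψ (α / (s / 128)) * ψ ((α - β) / s) - ψ (β / (s / 128))) / (α - β)| ≤ 600 * K ^ 3 * s := by
  have hs := hp.hs
  have hs1 := hp.hs1
  have hK := hp.hK
  have hmn := mn_lip hp hψ α β
  have hm0 : 0 ≤ ψ (α / (s / 128)) * ψ ((α - β) / s) := mul_nonneg (hψ.nn _) (hψ.nn _)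
  have hm1 : ψ (α / (s / 128)) * ψ ((α - β) / s) ≤ 1 := mul_le_one₀ (hψ.le1 _) (hψ.nn _) (hψ.le1 _)
  have hmz : ψ (α / (s / 128)) * ψ ((α - β) / s) ≠ 0 → |α| < s := fun h => by
    have := hψ.of_ne (by positivity) (left_ne_zero_of_mul h)
    linarith
  set m := ψ (α / (s / 128)) * ψ ((α - β) / s)
  set n := ψ (β / (s / 128))
  set x := α - β with hxd
  set q := f α - f β with hq
  set p := f1 β with hpd
  have hxa : 0 < |x| := abs_pos.2 hx
  have hpb : |p| ≤ 2 * K * s := by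
    have := hf.f1b β (by linarith)
    have : K * |β| ≤ K * (2 * s) := by gcongr
    linarith
  have eU : x ^ 2 / (x ^ 2 + q ^ 2) = 1 / (1 + (q / x) ^ 2) := by field_simp
  have e : (m * (x ^ 2 / (x ^ 2 + q ^ 2)) - n * (1 / (1 + p ^ 2))) / x - (m - n) / x =
    (m * (1 / (1 + (q / x) ^ 2) - 1 / (1 + p ^ 2)) + (m - n) * (1 / (1 + p ^ 2) - 1)) / x := by
    rw [eU]; ring
  rw [e, abs_div, div_le_iff₀ hxa]
  have b1 : |m * (1 / (1 + (q / x) ^ 2) - 1 / (1 + p ^ 2))| ≤ 10 * K ^ 2 * s * |x| := by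
    by_cases hm : m = 0
    · rw [hm, zero_mul, abs_zero]; positivity
    · have ha := hmz hm
      have hx3 : |x| ≤ 3 * s := (abs_sub _ _).trans (by linarith)
      rw [abs_mul, abs_of_nonneg hm0]
      have hr : |q / x| ≤ 3 * K * s := by
        rw [abs_div, div_le_iff₀ hxa]
        have := hf.lip α β (by linarith) (by linarith)
        refine this.trans ?_
        have : K * |x| * (|α| + |β|) ≤ K * |x| * (3 * s) := by gcongr; linarith
        linarith
      have hrp : |q / x - p| ≤ 2 * K * |x| := by
        have ht := hf.tay α β (by linarith) (by linarith)
        have hf2 := hf.f2b β (by linarith)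
        have e : q / x - p = (q - x * p - x ^ 2 / 2 * f2 β) / x + x / 2 * f2 β := by field_simp; ring
        rw [e]
        refine (abs_add_le _ _).trans ?_
        have c1 : |(q - x * p - x ^ 2 / 2 * f2 β) / x| ≤ K * |x| ^ 2 := by
          rw [abs_div, div_le_iff₀ hxa]; refine ht.trans_eq (by ring)
        have c2 : |x / 2 * f2 β| ≤ |x| / 2 * K := by
          rw [abs_mul, abs_div, abs_of_pos (by norm_num : (0:ℝ) < 2)]; gcongr
        have c3 : K * |x| ^ 2 ≤ K * |x| := by
          gcongr; nlinarith
        have : 0 ≤ K * |x| := by positivity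
        linarith
      calc _ ≤ 1 * ((2 * K * |x|) * (3 * K * s + 2 * K * s)) := by
            gcongr
            exact (U_diff _ _).trans (by gcongr)
        _ = _ := by ring
  have b2 : |(m - n) * (1 / (1 + p ^ 2) - 1)| ≤ 516 * K ^ 3 * s * |x| := by
    rw [abs_mul]
    have hu := U_diff p 0
    simp only [sub_zero, abs_zero, add_zero, ne_eq, OfNat.ofNat_ne_zero, not_false_eq_true, zero_pow, div_one] at hu
    calc _ ≤ (129 * K * |x| / s) * ((2 * K * s) * (2 * K * s)) := by
          gcongr
          exact hu.trans (by gcongr)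
      _ = _ := by field_simp; ring
  refine (abs_add_le _ _).trans ((add_le_add b1 b2).trans ?_)
  have : K ^ 2 * s * |x| ≤ K ^ 3 * s * |x| := by
    gcongr
    norm_num
  have : 0 ≤ K ^ 3 * s * |x| := by positivity
  linarith

def R4 (ψ : ℝ → ℝ) (s : ℝ) (f f1 : ℝ → ℝ) (α β : ℝ) : ℝ :=
  (ψ (α / (s / 128)) * ψ ((α - β) / s) * ((α - β) ^ 2 / ((α - β) ^ 2 + (f α - f β) ^ 2))
      - ψ (β / (s / 128)) * (1 / (1 + f1 β ^ 2))) / (α - β)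

def S4 (ψ : ℝ → ℝ) (s ε : ℝ) (f f1 g : ℝ → ℝ) (α β : ℝ) : ℝ :=
  R4 ψ s f f1 α β - ψ (α / (s / 128)) * ψ ((α - β) / s) * QK (2 * ε + g α + f β) (α - β)

lemma R4_bd (hp : Par K ε s L) (hψ : Cut K ψ) (hf : Fn K s f f1 f2) {α β : ℝ} (hb : |β| < 2 * s) (hx : α - β ≠ 0) :
    |R4 ψ s f f1 α β| ≤ 600 * K ^ 3 * s + 129 * K / s := by
  have h1 := J2_bd hp hψ hf hb hx
  have h2 : |(ψ (α / (s / 128)) * ψ ((α - β) / s) - ψ (β / (s / 128))) / (α - β)| ≤ 129 * K / s := by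
    rw [abs_div, div_le_iff₀ (abs_pos.2 hx)]
    refine (mn_lip hp hψ α β).trans_eq (by ring)
  have h3 := abs_add_le (R4 ψ s f f1 α β - (ψ (α / (s / 128)) * ψ ((α - β) / s) - ψ (β / (s / 128))) / (α - β))
    ((ψ (α / (s / 128)) * ψ ((α - β) / s) - ψ (β / (s / 128))) / (α - β))
  rw [sub_add_cancel] at h3
  unfold R4 at *
  linarith

lemma mQ_bd (hp : Par K ε s L) (hψ : Cut K ψ) (hfg : PairFG K ε s f g) {α β : ℝ} (hb : |β| < 2 * s) :
    |ψ (α / (s / 128)) * ψ ((α - β) / s) * QK (2 * ε + g α + f β) (α - β)| ≤ ε⁻¹ := by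
  have hs := hp.hs
  have he := hp.he0
  by_cases h0 : ψ (α / (s / 128)) = 0
  · rw [h0]; simp; exact he.le
  · have ha := hψ.of_ne (by positivity) h0
    have l := hfg.symm.lo α β (by linarith) (by linarith)
    rw [abs_mul, abs_of_nonneg (mul_nonneg (hψ.nn _) (hψ.nn _))]
    calc _ ≤ 1 * ε⁻¹ := by
          gcongr
          · exact mul_le_one₀ (hψ.le1 _) (hψ.nn _) (hψ.le1 _)
          · exact (abs_QK_le (he.trans_le l) _).trans (inv_anti₀ he l)
      _ = _ := one_mul _

lemma S4_J (hp : Par K ε s L) (hψ : Cut K ψ) (hf : Fn K s f f1 f2) (hg : Fn K s g g1 g2) (hfg : PairFG K ε s f g)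
    {α β : ℝ} (hb : |β| < 2 * s) (hx : α - β ≠ 0) :
    |S4 ψ s ε f f1 g α β + ψ (β / (s / 128)) * QK (2 * ε + f β + g β) (α - β)|
      ≤ 10 ^ 5 * K ^ 3 * ((|α| + |β|) * PK ε (α - β)) + 600 * K ^ 3 * s := by
  have hs := hp.hs
  have he := hp.he0
  have hK := hp.hK
  have h2 := J2_bd hp hψ hf hb hx
  have hb4 : |β| < 4 * s := by linarith
  have lX := hfg.lo β β hb4 hb4
  have uX := hfg.hi β β hb4 hb4
  have hx0 : 0 < |α - β| := abs_pos.2 hx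
  have hm0 : 0 ≤ ψ (α / (s / 128)) * ψ ((α - β) / s) := mul_nonneg (hψ.nn _) (hψ.nn _)
  have hm1 : ψ (α / (s / 128)) * ψ ((α - β) / s) ≤ 1 := mul_le_one₀ (hψ.le1 _) (hψ.nn _) (hψ.le1 _)
  have hYp : ψ (α / (s / 128)) * ψ ((α - β) / s) ≠ 0 → ε ≤ 2 * ε + g α + f β ∧ 2 * ε + g α + f β ≤ K * ε ∧
      |2 * ε + g α + f β - (2 * ε + f β + g β)| ≤ 2 * K * (|α - β| * (|α| + |β|)) := fun h => by
    have ha := hψ.of_ne (by positivity) (left_ne_zero_of_mul h)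
    have ha4 : |α| < 4 * s := by linarith
    refine ⟨hfg.symm.lo α β ha4 hb4, hfg.symm.hi α β ha4 hb4, ?_⟩
    have e : 2 * ε + g α + f β - (2 * ε + f β + g β) = g α - g β := by ring
    rw [e]
    refine (hg.lip α β ha4 hb4).trans ?_
    have : 0 ≤ K * (|α - β| * (|α| + |β|)) := by positivity
    linarith
  have hw := wdiff (x := α - β) (X := 2 * ε + f β + g β) (Y := 2 * ε + g α + f β)
    (m := ψ (α / (s / 128)) * ψ ((α - β) / s)) (n := ψ (β / (s / 128))) (D := |α - β| * (|α| + |β|)) hK he lX uX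
    (by positivity) hm0 hm1 (cut_diff hp hψ (by linarith) α β) hYp
  unfold S4 R4
  have hX0 := he.trans_le lX
  have hdX := den_pos hX0 (α - β)
  have qX : QK (2 * ε + f β + g β) (α - β) = (1 - (2 * ε + f β + g β) ^ 2 / ((α - β) ^ 2 + (2 * ε + f β + g β) ^ 2)) / (α - β) := by
    unfold QK; field_simp; ring
  have qY : ψ (α / (s / 128)) * ψ ((α - β) / s) * QK (2 * ε + g α + f β) (α - β) =
      ψ (α / (s / 128)) * ψ ((α - β) / s) * ((1 - (2 * ε + g α + f β) ^ 2 / ((α - β) ^ 2 + (2 * ε + g α + f β) ^ 2)) / (α - β)) := by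
    by_cases hm : ψ (α / (s / 128)) * ψ ((α - β) / s) = 0
    · rw [hm, zero_mul, zero_mul]
    · have hdY := den_pos (he.trans_le (hYp hm).1) (α - β)
      congr 1
      unfold QK; field_simp; ring
  rw [qX, qY]
  set m := ψ (α / (s / 128)) * ψ ((α - β) / s)
  set n := ψ (β / (s / 128))
  set x := α - β
  set wX := (2 * ε + f β + g β) ^ 2 / (x ^ 2 + (2 * ε + f β + g β) ^ 2)
  set wY := (2 * ε + g α + f β) ^ 2 / (x ^ 2 + (2 * ε + g α + f β) ^ 2)
  set U := x ^ 2 / (x ^ 2 + (f α - f β) ^ 2)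
  set U1 := 1 / (1 + f1 β ^ 2)
  have e : (m * U - n * U1) / x - m * ((1 - wY) / x) + n * ((1 - wX) / x) =
    (m * wY - n * wX) / x + ((m * U - n * U1) / x - (m - n) / x) := by ring
  rw [e]
  refine (abs_add_le _ _).trans (add_le_add ?_ h2)
  rw [abs_div, div_le_iff₀ hx0]
  refine hw.trans_eq (by ring)
end

end


section
open scoped ENNReal Topology

variable {K ε s L c B : ℝ} {ψ f f1 f2 g g1 g2 ω : ℝ → ℝ}

lemma measurable_S4 (hψ : Measurable ψ) (mf : Measurable f) (mf1 : Measurable f1) (mg : Measurable g) :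
    Measurable (fun p : ℝ × ℝ => R4 ψ s f f1 p.1 p.2) ∧ Measurable (fun p : ℝ × ℝ => S4 ψ s ε f f1 g p.1 p.2) ∧
    Measurable (fun p : ℝ × ℝ => ψ (p.1 / (s / 128)) * ψ ((p.1 - p.2) / s) * QK (2 * ε + g p.1 + f p.2) (p.1 - p.2)) := by
  have h1 : Measurable (fun p : ℝ × ℝ => R4 ψ s f f1 p.1 p.2) := by unfold R4; fun_prop
  have h2 : Measurable (fun p : ℝ × ℝ => ψ (p.1 / (s / 128)) * ψ ((p.1 - p.2) / s) * QK (2 * ε + g p.1 + f p.2) (p.1 - p.2)) := by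
    unfold QK; fun_prop
  exact ⟨h1, h1.sub h2, h2⟩

lemma S4_bd (hp : Par K ε s L) (hψ : Cut K ψ) (hf : Fn K s f f1 f2) (hfg : PairFG K ε s f g) {α β : ℝ} (hb : |β| < 2 * s) :
    |S4 ψ s ε f f1 g α β| ≤ 600 * K ^ 3 * s + 129 * K / s + ε⁻¹ := by
  have hs := hp.hs
  have hK := hp.hK
  refine (abs_sub _ _).trans (add_le_add ?_ (mQ_bd hp hψ hfg hb))
  by_cases hx : α - β = 0
  · unfold R4; rw [hx, div_zero, abs_zero]; positivity
  · exact R4_bd hp hψ hf hb hx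

lemma inner4 (hp : Par K ε s L) (hψ : Cut K ψ) (hf : Fn K s f f1 f2) (hg : Fn K s g g1 g2) (hfg : PairFG K ε s f g)
    (hc : ε ≤ c) (hc8 : c ≤ 8 * ε) {β : ℝ} (hb : |β| < 2 * s) (h0 : β ≠ 0) :
    |(∫ α, PK c α * S4 ψ s ε f f1 g α β) - π * ψ (β / (s / 128)) * QK (c + (2 * ε + f β + g β)) β| ≤
      (6 * 10 ^ 7 * K ^ 3 * ε) * (ε + |β|)⁻¹ := by
  have he := hp.he0
  have hs := hp.hs
  have hK := hp.hK
  have hc0 := he.trans_le hc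
  have hpi := Real.pi_pos
  have hpi4 := Real.pi_lt_four
  have lX := hfg.lo β β (by linarith) (by linarith)
  obtain ⟨-, mS, -⟩ := measurable_S4 (s := s) (ε := ε) hψ.m hf.mf hf.mf1 hg.mf
  have mSα : Measurable fun α => S4 ψ s ε f f1 g α β := mS.comp (measurable_id.prodMk measurable_const)
  obtain ⟨iQ, eQ⟩ := integral_PQ2 hc0 (he.trans_le lX) h0
  have iS : Integrable fun α => PK c α * S4 ψ s ε f f1 g α β :=
    (integrable_PK hc0).mul_bdd (c := 600 * K ^ 3 * s + 129 * K / s + ε⁻¹) mSα.aestronglyMeasurable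
      (Eventually.of_forall fun α => S4_bd hp hψ hf hfg hb)
  have e1 : (∫ α, PK c α * S4 ψ s ε f f1 g α β) - π * ψ (β / (s / 128)) * QK (c + (2 * ε + f β + g β)) β =
      ∫ α, (PK c α * S4 ψ s ε f f1 g α β + ψ (β / (s / 128)) * (QK (2 * ε + f β + g β) (α - β) * PK c α)) := by
    rw [integral_add iS (iQ.const_mul _), integral_const_mul, eQ]; ring
  obtain ⟨iP, eP⟩ := PK_pair_int he β
  have iD : Integrable fun α => (10 ^ 5 * K ^ 3 * (64 * (ε / (ε + |β|)))) * (PK ε α + PK ε (α - β)) + 600 * K ^ 3 * s * PK c α :=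
    (iP.const_mul _).add ((integrable_PK hc0).const_mul _)
  rw [e1, ← Real.norm_eq_abs]
  have hne : ∀ᵐ α : ℝ, α ≠ β := by simp [ae_iff]
  refine (norm_integral_le_of_norm_le iD (f := fun α => PK c α * S4 ψ s ε f f1 g α β + ψ (β / (s / 128)) * (QK (2 * ε + f β + g β) (α - β) * PK c α)) ?_).trans ?_
  · filter_upwards [hne] with α hα
    have h1 := S4_J hp hψ hf hg hfg hb (sub_ne_zero.2 hα)
    have h2 := PM he hc hc8 α β
    have hP := PK_nonneg hc0 α
    have e : PK c α * S4 ψ s ε f f1 g α β + ψ (β / (s / 128)) * (QK (2 * ε + f β + g β) (α - β) * PK c α) =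
      PK c α * (S4 ψ s ε f f1 g α β + ψ (β / (s / 128)) * QK (2 * ε + f β + g β) (α - β)) := by ring
    rw [e, Real.norm_eq_abs, abs_mul, abs_of_nonneg hP]
    calc _ ≤ PK c α * (10 ^ 5 * K ^ 3 * ((|α| + |β|) * PK ε (α - β)) + 600 * K ^ 3 * s) := mul_le_mul_of_nonneg_left h1 hP
      _ = 10 ^ 5 * K ^ 3 * (PK c α * ((|α| + |β|) * PK ε (α - β))) + 600 * K ^ 3 * s * PK c α := by ring
      _ ≤ 10 ^ 5 * K ^ 3 * (64 * (ε / (ε + |β|)) * (PK ε α + PK ε (α - β))) + 600 * K ^ 3 * s * PK c α := by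
          refine add_le_add (mul_le_mul_of_nonneg_left h2 (by positivity)) le_rfl
      _ = _ := by ring
  · rw [integral_add (iP.const_mul _) ((integrable_PK hc0).const_mul _), integral_const_mul, integral_const_mul, eP, integral_PK hc0]
    have hr : 0 < ε + |β| := by positivity
    have hsr : s ≤ 3 * ε * (ε + |β|)⁻¹ := by
      rw [← div_eq_mul_inv, le_div_iff₀ hr, hp.he]
      have := hp.hs1
      nlinarith
    have hK3 : 0 ≤ K ^ 3 * (ε * (ε + |β|)⁻¹) := by positivity
    have h1 : 600 * K ^ 3 * s * π ≤ 600 * K ^ 3 * (3 * ε * (ε + |β|)⁻¹) * 4 := by gcongr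
    have h2 : (10 ^ 5 * K ^ 3 * (64 * (ε / (ε + |β|)))) * (2 * π) ≤ (10 ^ 5 * K ^ 3 * (64 * (ε / (ε + |β|)))) * (2 * 4) := by gcongr
    rw [div_eq_mul_inv] at h2 ⊢
    linarith

theorem T24_est (hp : Par K ε s L) (hψ : Cut K ψ) (hf : Fn K s f f1 f2) (hg : Fn K s g g1 g2) (hfg : PairFG K ε s f g)
    (hc : ε ≤ c) (hc8 : c ≤ 8 * ε) (hω : Measurable ω) (hB : 1 ≤ B) (hωb : ∀ β, |β| < 2 * s → |ω β| ≤ B) :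
    Integrable (fun α => PK c α * (ψ (α / (s / 128)) * (2 * π * (T2 ψ ε f ω α - T4 ψ ε g f ω α)))) ∧
    |(∫ α, PK c α * (ψ (α / (s / 128)) * (2 * π * (T2 ψ ε f ω α - T4 ψ ε g f ω α)))) + π * ∫ β, qc ε c β * wt s ω β| ≤
      (4 * 10 ^ 8 * K ^ 3 * B) * (ε * L) := by
  have he := hp.he0
  have hs := hp.hs
  have hK := hp.hK
  have hL := hp.hL1
  have hc0 := he.trans_le hc
  have hpi := Real.pi_pos
  have hpi4 := Real.pi_lt_four
  have hss : Real.sqrt ε = s := by rw [hp.he]; exact Real.sqrt_sq hs.le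
  have hB0 : 0 ≤ B := by linarith
  have bw := BC_wt hω hB0 hωb
  have mw := bw.meas
  obtain ⟨mR, mS, mQ⟩ := measurable_S4 (s := s) (ε := ε) hψ.m hf.mf hf.mf1 hg.mf
  have mRα : ∀ α, Measurable (R4 ψ s f f1 α) := fun α => mR.comp (measurable_const.prodMk measurable_id)
  have mQα : ∀ α, Measurable (fun β => ψ (α / (s / 128)) * ψ ((α - β) / s) * QK (2 * ε + g α + f β) (α - β)) :=
    fun α => mQ.comp (measurable_const.prodMk measurable_id)
  have mψ := hψ.m
  have mχ : Measurable (fun β : ℝ => ψ (β / (s / 128)) * (1 / (1 + f1 β ^ 2))) := by have := hf.mf1; fun_prop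
  have bχ : ∀ β : ℝ, |ψ (β / (s / 128)) * (1 / (1 + f1 β ^ 2))| ≤ 1 := fun β => by
    rw [abs_of_nonneg (mul_nonneg (hψ.nn _) (by positivity))]
    refine mul_le_one₀ (hψ.le1 _) (by positivity) ?_
    rw [div_le_one (by positivity)]; nlinarith [sq_nonneg (f1 β)]
  set u : ℝ → ℝ := fun β => ψ (β / (s / 128)) * (1 / (1 + f1 β ^ 2)) * wt s ω β with hu
  have bu : BC u B (2 * s) := by
    refine ⟨mχ.mul mw, fun t => ?_, fun t ht => by simp only [hu]; rw [wt_out ht.le, mul_zero]⟩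
    simp only [hu]
    rw [abs_mul]
    exact (mul_le_mul (bχ t) (bw.bd t) (abs_nonneg _) zero_le_one).trans_eq (one_mul _)
  obtain ⟨v, mv, iv, -, lv, pv, -⟩ := bu.hilbert
  have hne : ∀ α : ℝ, ∀ᵐ β : ℝ, α - β ≠ 0 := by
    intro α
    have : ∀ᵐ β : ℝ, β ≠ α := by simp [ae_iff]
    filter_upwards [this] with β hβ h0
    exact hβ (by linarith)
  have hn2 : ∀ᵐ β : ℝ, |β| ≠ 2 * s := by
    have h1 : ∀ᵐ β : ℝ, β ≠ 2 * s := by simp [ae_iff]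
    have h2 : ∀ᵐ β : ℝ, β ≠ -(2 * s) := by simp [ae_iff]
    filter_upwards [h1, h2] with β h1 h2 h
    rcases abs_eq (by positivity : 0 ≤ 2 * s) |>.1 h with h | h
    · exact h1 h
    · exact h2 h
  have iR : ∀ α, Integrable (fun β => R4 ψ s f f1 α β * wt s ω β) := fun α =>
    (bw.int_const (by linarith) (mRα α) (c := 600 * K ^ 3 * s + 129 * K / s)
    (by filter_upwards [hne α, hn2] with β hβ h2 hb using R4_bd hp hψ hf (lt_of_le_of_ne hb h2) hβ)).1
  have iQ : ∀ α, Integrable (fun β => ψ (α / (s / 128)) * ψ ((α - β) / s) * QK (2 * ε + g α + f β) (α - β) * wt s ω β) := fun α =>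
    (bw.int_const (by linarith) (mQα α) (c := ε⁻¹)
    (by filter_upwards [hn2] with β h2 hb using mQ_bd hp hψ hfg (lt_of_le_of_ne hb h2))).1
  have key : (fun α => PK c α * (ψ (α / (s / 128)) * (2 * π * (T2 ψ ε f ω α - T4 ψ ε g f ω α)))) =ᵐ[volume]
      fun α => PK c α * v α + PK c α * ∫ β, S4 ψ s ε f f1 g α β * wt s ω β := by
    filter_upwards [lv] with α hα
    have eS : ∫ β, S4 ψ s ε f f1 g α β * wt s ω β = (∫ β, R4 ψ s f f1 α β * wt s ω β) -
        ∫ β, ψ (α / (s / 128)) * ψ ((α - β) / s) * QK (2 * ε + g α + f β) (α - β) * wt s ω β := by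
      rw [← integral_sub (iR α) (iQ α)]
      congr 1; ext β; unfold S4; ring
    have hwt : ∀ β, ψ (α / (s / 128)) * (ω β * ψ ((α - β) / s)) = ψ (α / (s / 128)) * (wt s ω β * ψ ((α - β) / s)) := fun β => by
      by_cases h0 : ψ (α / (s / 128)) = 0
      · rw [h0, zero_mul, zero_mul]
      · rw [hψ.wt_eq hs (by have := hψ.of_ne (by positivity) h0; linarith)]
    have e2 : ψ (α / (s / 128)) * (2 * π * T2 ψ ε f ω α) = v α + ∫ β, R4 ψ s f f1 α β * wt s ω β := by
      unfold T2
      rw [← mul_assoc (2 * π), mul_inv_cancel₀ (by positivity), one_mul]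
      refine pv_decomp_c bu hα (iR α) fun β hβ => ?_
      simp only [scut, hss]
      have e : ∀ a : ℝ, ψ (α / (s / 128)) * (a * ω β * ψ ((α - β) / s)) = a * (ψ (α / (s / 128)) * (ω β * ψ ((α - β) / s))) := fun a => by ring
      rw [e, hwt]
      simp only [hu, R4]
      have hd : (α - β) ^ 2 + (f α - f β) ^ 2 ≠ 0 := by positivity
      field_simp
      ring
    have e4 : ψ (α / (s / 128)) * (2 * π * T4 ψ ε g f ω α) =
        ∫ β, ψ (α / (s / 128)) * ψ ((α - β) / s) * QK (2 * ε + g α + f β) (α - β) * wt s ω β := by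
      unfold T4
      rw [← mul_assoc (2 * π), mul_inv_cancel₀ (by positivity), one_mul, ← integral_const_mul]
      congr 1; ext β
      simp only [scut, hss]
      have e : ∀ a : ℝ, ψ (α / (s / 128)) * (a * ω β * ψ ((α - β) / s)) = a * (ψ (α / (s / 128)) * (ω β * ψ ((α - β) / s))) := fun a => by ring
      rw [e, hwt]; unfold QK; ring
    rw [mul_sub (2 * π), mul_sub, e2, e4, eS]; ring
  have iPv := (AMGM (measurable_PK c) mv (PK_sq_int hc0) iv).1
  have mw2 : Measurable fun p : ℝ × ℝ => wt s ω p.2 := mw.comp measurable_snd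
  have mP1 : Measurable fun p : ℝ × ℝ => PK c p.1 := (measurable_PK c).comp measurable_fst
  have hS : ∀ α β, |S4 ψ s ε f f1 g α β * wt s ω β| ≤ (600 * K ^ 3 * s + 129 * K / s + ε⁻¹) * |wt s ω β| := fun α β => by
    rw [abs_mul]
    by_cases hb : |β| < 2 * s
    · exact mul_le_mul_of_nonneg_right (S4_bd hp hψ hf hfg hb) (abs_nonneg _)
    · rw [wt_out (not_lt.1 hb), abs_zero, mul_zero, mul_zero]
  have iP : Integrable (fun p : ℝ × ℝ => PK c p.1 * (S4 ψ s ε f f1 g p.1 p.2 * wt s ω p.2)) (volume.prod volume) := by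
    refine Integrable.mono' (((integrable_PK hc0).mul_prod (bw.integrable.abs)).const_mul (600 * K ^ 3 * s + 129 * K / s + ε⁻¹))
      (mP1.mul (mS.mul mw2)).aestronglyMeasurable (Eventually.of_forall fun p => ?_)
    rw [Real.norm_eq_abs, abs_mul, abs_of_nonneg (PK_nonneg hc0 _)]
    exact (mul_le_mul_of_nonneg_left (hS p.1 p.2) (PK_nonneg hc0 _)).trans_eq (by ring)
  have iP1 : Integrable fun α => PK c α * ∫ β, S4 ψ s ε f f1 g α β * wt s ω β := by
    refine iP.integral_prod_left.congr (Eventually.of_forall fun α => ?_)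
    exact integral_const_mul (PK c α) fun β => S4 ψ s ε f f1 g α β * wt s ω β
  have fub : ∫ α, PK c α * ∫ β, S4 ψ s ε f f1 g α β * wt s ω β = ∫ β, (∫ α, PK c α * S4 ψ s ε f f1 g α β) * wt s ω β := by
    simp_rw [← integral_const_mul]
    rw [integral_integral_swap iP]
    congr 1; ext β
    rw [← integral_mul_const]
    congr 1; ext α; ring
  have iI : Integrable fun β => (∫ α, PK c α * S4 ψ s ε f f1 g α β) * wt s ω β := by
    refine iP.integral_prod_right.congr (Eventually.of_forall fun β => ?_)
    beta_reduce
    rw [← integral_mul_const]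
    congr 1; ext α; ring
  refine ⟨(iPv.add iP1).congr key.symm, ?_⟩
  rw [integral_congr_ae key, integral_add iPv iP1, fub, pv c hc0]
  have mqc : Measurable (qc ε c) := measurable_qc ε c
  have mq : Measurable (QK c) := measurable_QK c
  have iu : Integrable fun t => QK c t * u t := bu.integrable_mul mq (fun t => abs_QK_le hc0 t)
  have iqc : Integrable fun t => qc ε c t * wt s ω t :=
    bw.integrable_mul mqc (c := c⁻¹ + (c + 2 * ε)⁻¹) fun t => (abs_sub _ _).trans (add_le_add (abs_QK_le hc0 t) (abs_QK_le (by positivity) t))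
  have mI : Measurable fun β => ∫ α, PK c α * S4 ψ s ε f f1 g α β :=
    measurable_iG (G := fun p => PK c p.2 * S4 ψ s ε f f1 g p.2 p.1) ((mP1.mul mS).comp measurable_swap)
  have e : -(π * ∫ t, QK c t * u t) + (∫ β, (∫ α, PK c α * S4 ψ s ε f f1 g α β) * wt s ω β) + π * ∫ β, qc ε c β * wt s ω β =
      ∫ β, (-(π * QK c β * (ψ (β / (s / 128)) * (1 / (1 + f1 β ^ 2)))) + (∫ α, PK c α * S4 ψ s ε f f1 g α β) + π * qc ε c β) * wt s ω β := by
    have i1 : Integrable fun t => -(π * (QK c t * u t)) := (iu.const_mul _).neg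
    have i2 : Integrable fun β => -(π * (QK c β * u β)) + (∫ α, PK c α * S4 ψ s ε f f1 g α β) * wt s ω β := i1.add iI
    rw [← integral_const_mul, ← integral_const_mul, ← integral_neg, ← integral_add i1 iI,
      ← integral_add i2 (iqc.const_mul _)]
    congr 1; ext β; simp only [hu]; ring
  rw [e]
  have h0 : ∀ᵐ β : ℝ, β ≠ 0 := by simp [ae_iff]
  refine (bw.int_rho hp (c := 2 * 10 ^ 8 * K ^ 3 * ε) (by positivity) (((((mq.const_mul π).mul mχ).neg).add mI).add (mqc.const_mul π)) ?_).2.trans_eq (by ring)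
  filter_upwards [h0, hn2] with β h0 h2 hb
  have hb := lt_of_le_of_ne hb h2
  have hb4 : |β| < 4 * s := by linarith
  have lX := hfg.lo β β hb4 hb4
  have uX := hfg.hi β β hb4 hb4
  have hr : 0 < ε + |β| := by positivity
  have b1 := inner4 hp hψ hf hg hfg hc hc8 hb h0
  have hX : |2 * ε + f β + g β - 2 * ε| ≤ 2 * K * β ^ 2 := by
    have e : 2 * ε + f β + g β - 2 * ε = f β + g β := by ring
    rw [e]
    refine (abs_add_le _ _).trans ((add_le_add (hf.abs_le hs hb4) (hg.abs_le hs hb4)).trans_eq (by ring))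
  have b2 := QX_bound (s := s) hK he hc hc8 lX uX hX
  have hχ0 := hψ.nn (β / (s / 128))
  have hχ1 := hψ.le1 (β / (s / 128))
  have b3 : |(1 - ψ (β / (s / 128))) * qc ε c β| ≤ 10 ^ 7 * ε / (ε + |β|) := by
    by_cases h : |β| ≤ s / 256
    · rw [hψ.one, sub_self, zero_mul, abs_zero]
      · positivity
      · rw [abs_div, abs_of_pos (by positivity : 0 < s / 128), div_le_iff₀ (by positivity)]; linarith
    · push Not at h
      rw [abs_mul, abs_of_nonneg (by linarith)]
      exact (mul_le_of_le_one_left (abs_nonneg _) (by linarith)).trans (qc_bound1 hp hc hc8 h.le)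
  have b4 : |QK c β * (1 - 1 / (1 + f1 β ^ 2))| ≤ 6 * K ^ 2 * ε / (ε + |β|) := by
    have hf1 := hf.f1b β hb4
    have hu := U_diff 0 (f1 β)
    simp only [zero_sub, abs_zero, zero_add, abs_neg, ne_eq, OfNat.ofNat_ne_zero, not_false_eq_true, zero_pow, add_zero, div_one] at hu
    have hq : |QK c β| * |β| ^ 2 ≤ |β| := by
      unfold QK
      rw [abs_div, abs_of_pos (den_pos hc0 β), div_mul_eq_mul_div, div_le_iff₀ (den_pos hc0 β), sq_abs]
      nlinarith [abs_nonneg β, sq_nonneg c, mul_nonneg (abs_nonneg β) (sq_nonneg c)]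
    rw [abs_mul]
    calc _ ≤ |QK c β| * ((K * |β|) * (K * |β|)) := by
          refine mul_le_mul_of_nonneg_left (hu.trans ?_) (abs_nonneg _)
          gcongr
      _ = K ^ 2 * (|QK c β| * |β| ^ 2) := by ring
      _ ≤ K ^ 2 * |β| := by gcongr
      _ ≤ _ := by
          rw [le_div_iff₀ hr]
          have : |β| * (ε + |β|) ≤ 6 * ε := by
            rw [hp.he]
            have := hp.hs1
            have : ε ≤ s := by have := hp.hes; linarith
            rw [hp.he] at this
            nlinarith [abs_nonneg β]
          calc _ = K ^ 2 * (|β| * (ε + |β|)) := by ring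
            _ ≤ K ^ 2 * (6 * ε) := by gcongr
            _ = _ := by ring
  have hid : -(π * QK c β * (ψ (β / (s / 128)) * (1 / (1 + f1 β ^ 2)))) + (∫ α, PK c α * S4 ψ s ε f f1 g α β) + π * qc ε c β =
      ((∫ α, PK c α * S4 ψ s ε f f1 g α β) - π * ψ (β / (s / 128)) * QK (c + (2 * ε + f β + g β)) β)
      + π * (ψ (β / (s / 128)) * (QK (c + (2 * ε + f β + g β)) β - QK (c + 2 * ε) β) + (1 - ψ (β / (s / 128))) * qc ε c β
        + ψ (β / (s / 128)) * (QK c β * (1 - 1 / (1 + f1 β ^ 2)))) := by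
    have : qc ε c β = QK c β - QK (c + 2 * ε) β := rfl
    rw [this]; ring
  have c2 : |ψ (β / (s / 128)) * (QK (c + (2 * ε + f β + g β)) β - QK (c + 2 * ε) β)| ≤ 160 * K ^ 2 * ε / (ε + |β|) := by
    rw [abs_mul, abs_of_nonneg hχ0]; exact (mul_le_of_le_one_left (abs_nonneg _) hχ1).trans b2
  have c4 : |ψ (β / (s / 128)) * (QK c β * (1 - 1 / (1 + f1 β ^ 2)))| ≤ 6 * K ^ 2 * ε / (ε + |β|) := by
    rw [abs_mul (ψ _), abs_of_nonneg hχ0]; exact (mul_le_of_le_one_left (abs_nonneg _) hχ1).trans b4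
  refine (congrArg abs hid).trans_le ?_
  refine (abs_add_le _ _).trans ?_
  rw [abs_mul, abs_of_pos hpi]
  have h3 := (abs_add_three (ψ (β / (s / 128)) * (QK (c + (2 * ε + f β + g β)) β - QK (c + 2 * ε) β)) ((1 - ψ (β / (s / 128))) * qc ε c β)
    (ψ (β / (s / 128)) * (QK c β * (1 - 1 / (1 + f1 β ^ 2))))).trans (add_le_add (add_le_add c2 b3) c4)
  refine (add_le_add b1 (mul_le_mul hpi4.le h3 (abs_nonneg _) (by norm_num))).trans ?_
  have hK23 : K ^ 2 * (ε * (ε + |β|)⁻¹) ≤ K ^ 3 * (ε * (ε + |β|)⁻¹) := by gcongr; norm_num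
  have hK13 : 1 * (ε * (ε + |β|)⁻¹) ≤ K ^ 3 * (ε * (ε + |β|)⁻¹) := by
    gcongr; exact one_le_pow₀ hK
  have hZ : 0 ≤ ε * (ε + |β|)⁻¹ := by positivity
  simp only [div_eq_mul_inv]
  linarith

end


section
open scoped ENNReal Topology

lemma chiP_lower {K ε s L : ℝ} {ψ : ℝ → ℝ} (hp : Par K ε s L) (hψ : Cut K ψ)
    (iP : Integrable fun α => ψ (α / (s / 128)) * (PK (2 * ε) α + PK (6 * ε) α)) :
    4 / 5 ≤ ∫ α, ψ (α / (s / 128)) * (PK (2 * ε) α + PK (6 * ε) α) := by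
  have he := hp.he0
  have hs := hp.hs
  have hes := hp.hes
  have h0 : ∀ α, 0 ≤ ψ (α / (s / 128)) * (PK (2 * ε) α + PK (6 * ε) α) := fun α =>
    mul_nonneg (hψ.nn _) (add_nonneg (PK_nonneg (by positivity) _) (PK_nonneg (by positivity) _))
  have h1 := setIntegral_le_integral (s := Icc (-ε) ε) iP (Eventually.of_forall h0)
  have h2 : ∫ α in Icc (-ε) ε, (2 / (5 * ε) : ℝ) ≤ ∫ α in Icc (-ε) ε, ψ (α / (s / 128)) * (PK (2 * ε) α + PK (6 * ε) α) := by
    refine setIntegral_mono_on (integrableOn_const (by simp)) iP.integrableOn measurableSet_Icc fun α ha => ?_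
    have ha := abs_le.2 ha
    rw [hψ.one _ (by rw [abs_div, abs_of_pos (by positivity : 0 < s / 128), div_le_iff₀ (by positivity)]; linarith), one_mul]
    refine le_add_of_le_of_nonneg ?_ (PK_nonneg (by positivity) _)
    unfold PK
    rw [div_le_div_iff₀ (by positivity) (by positivity), ← sq_abs α]
    have : |α| ^ 2 ≤ ε ^ 2 := by gcongr
    nlinarith
  rw [setIntegral_const] at h2
  simp only [measureReal_def, Real.volume_Icc, smul_eq_mul] at h2
  rw [ENNReal.toReal_ofReal (by linarith)] at h2
  have : (ε - -ε) * (2 / (5 * ε)) = 4 / 5 := by field_simp; ring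
  linarith

lemma int6 {a b c d e h : ℝ → ℝ} (ha : Integrable a) (hb : Integrable b) (hc : Integrable c) (hd : Integrable d) (he : Integrable e)
    (hh : Integrable h) : ∫ x, (a x + b x + c x + d x + e x + h x) =
      (∫ x, a x) + (∫ x, b x) + (∫ x, c x) + (∫ x, d x) + (∫ x, e x) + ∫ x, h x := by
  have h2 : Integrable fun x => a x + b x := ha.add hb
  have h3 : Integrable fun x => a x + b x + c x := h2.add hc
  have h4 : Integrable fun x => a x + b x + c x + d x := h3.add hd
  have h5 : Integrable fun x => a x + b x + c x + d x + e x := h4.add he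
  rw [integral_add h5 hh, integral_add h4 he, integral_add h3 hd, integral_add h2 hc, integral_add ha hb]

lemma fin_arith {B κ T C4 CF X Y Z I1 I2 I3 I4 a1 a2 a3 b1 b2 b3 G0 : ℝ} (hT : 0 < T) (hC4 : 0 < C4) (hCF0 : 0 < CF)
    (hlow : 4 / 5 ≤ X) (a12 : |2 * (-(1 / 2)) * a1 - b2| ≤ CF * T) (a23 : |2 * (-(1 / 2)) * a2 - b3| ≤ CF * T)
    (b12 : |2 * (1 / 2) * b1 - a2| ≤ CF * T) (b23 : |2 * (1 / 2) * b2 - a3| ≤ CF * T)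
    (j1 : |I1 + π * a1| ≤ C4 * T) (j2 : |I2 + π * a3| ≤ C4 * T) (j3 : |I3 + π * b1| ≤ C4 * T) (j4 : |I4 + π * b3| ≤ C4 * T)
    (hE' : |Y| ≤ B / κ * T) (bD' : |Z| ≤ 64 * B * T)
    (eI : 2 * π * Y = 2 * π * Z + 2 * π * G0 * X + I1 + I2 + I3 + I4) :
    |G0| ≤ 2 * (B / κ + 4 * CF + 4 * C4 + 64 * B) * T := by
  have hpi := Real.pi_pos
  have hab : |a1 + a3 + b1 + b3| ≤ 4 * CF * T := by
    rw [abs_le] at a12 a23 b12 b23 ⊢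
    constructor <;> linarith [a12.1, a12.2, a23.1, a23.2, b12.1, b12.2, b23.1, b23.2]
  have eG : 2 * π * (G0 * X) = 2 * π * Y - 2 * π * Z - (I1 + π * a1) - (I2 + π * a3) - (I3 + π * b1) - (I4 + π * b3)
      + π * (a1 + a3 + b1 + b3) := by linarith
  have hG : 2 * π * |G0 * X| ≤ 2 * π * (B / κ * T) + 2 * π * (64 * B * T) + 4 * (C4 * T) + π * (4 * CF * T) := by
    have e : 2 * π * |G0 * X| = |2 * π * (G0 * X)| := by rw [abs_mul (2 * π), abs_of_pos (by positivity : 0 < 2 * π)]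
    rw [e, eG]
    have y1 : |2 * π * Y| ≤ 2 * π * (B / κ * T) := by rw [abs_mul, abs_of_pos (by positivity : 0 < 2 * π)]; gcongr
    have y2 : |2 * π * Z| ≤ 2 * π * (64 * B * T) := by rw [abs_mul, abs_of_pos (by positivity : 0 < 2 * π)]; gcongr
    have y3 : |π * (a1 + a3 + b1 + b3)| ≤ π * (4 * CF * T) := by rw [abs_mul, abs_of_pos hpi]; gcongr
    rw [abs_le] at y1 y2 y3 j1 j2 j3 j4 ⊢
    constructor <;> linarith [y1.1, y1.2, y2.1, y2.2, y3.1, y3.2, j1.1, j1.2, j2.1, j2.2, j3.1, j3.2, j4.1, j4.2]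
  have hC4T : 4 * (C4 * T) ≤ 2 * π * (4 * (C4 * T)) := by have := Real.pi_gt_three; nlinarith [mul_pos hC4 hT]
  have hCFT : π * (4 * CF * T) ≤ 2 * π * (4 * CF * T) := by
    have : 0 ≤ π * (4 * CF * T) := by positivity
    linarith
  have hG2 : |G0 * X| ≤ (B / κ + 4 * CF + 4 * C4 + 64 * B) * T := by
    have : 2 * π * |G0 * X| ≤ 2 * π * ((B / κ + 4 * CF + 4 * C4 + 64 * B) * T) := by linarith
    exact le_of_mul_le_mul_left this (by positivity)
  rw [abs_mul, abs_of_pos (show 0 < X by linarith)] at hG2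
  have : |G0| * (4 / 5) ≤ |G0| * X := by gcongr
  have := abs_nonneg (G0)
  linarith

theorem core {K B κ : ℝ} (hK : 1 ≤ K) (hB : 1 ≤ B) (hκ : 0 < κ) : ∃ C : ℝ, 0 < C ∧
    ∀ (ε s L : ℝ) (ψ f f1 f2 g g1 g2 Fp Fm G ωp ωm Ep Em E : ℝ → ℝ), Par K ε s L → Cut K ψ → Fn K s f f1 f2 → Fn K s g g1 g2 →
    PairFG K ε s f g → Measurable Fp → Measurable Fm → Measurable G → Measurable ωp → Measurable ωm →
    (∀ x, |x| < s → |Fp x| ≤ B ∧ |Fm x| ≤ B ∧ |G x| ≤ B ∧ |Fp x - Fp 0| ≤ B * |x| ∧ |Fm x - Fm 0| ≤ B * |x| ∧ |G x - G 0| ≤ B * |x|) →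
    (∀ x, |x| < 2 * s → |ωp x| ≤ B ∧ |ωm x| ≤ B) →
    (∀ c, ε ≤ c → c ≤ 8 * ε → |∫ α, Ep α * Hstar ψ ε f g (fun α => κ * (ψ (α / (s / 128)) * PK c α)) α| ≤ B * (ε * L) ∧
      |∫ α, Em α * Hstar ψ ε f g (fun α => κ * (ψ (α / (s / 128)) * PK c α)) α| ≤ B * (ε * L)) →
    |∫ α, E α * (κ * (ψ (α / (s / 128)) * (PK (2 * ε) α + PK (6 * ε) α)))| ≤ B * (ε * L) →
    (∀ α, |α| < s → Fp α = T1 ψ ε f ωp α - T3 ψ ε f g ωm α - (1/2) * ωp α + Ep α ∧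
          Fm α = -T3 ψ ε g f ωp α + T1 ψ ε g ωm α + (1/2) * ωm α + Em α ∧
          G α = (T4 ψ ε g f ωp α - T2 ψ ε f ωp α) + (T4 ψ ε f g ωm α - T2 ψ ε g ωm α) + E α) →
    |G 0| ≤ C * (ε * L) := by
  set C1 : ℝ := 10 ^ 9 * K ^ 3 with hC1
  set CE : ℝ := 8 * B / κ with hCE
  set CF : ℝ := (8 * CE + 8 * (1152 * B + 2 * C1 * B) + (1152 * (2800 * K ^ 5 * B) + 2 * C1 * (2 * K ^ 5 * B) + 2 * C1 ^ 2 + 256 * K ^ 2 * B ^ 2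
        + 1024 * K * B) + (1152 * (2000 * K ^ 2 * B) + 2 * C1 * (8 * K * B) + 8 * C1 * K * B + 20000 * K * B + 10400 * K ^ 2 * B)
        + 16 * C1 * B) with hCF
  have hB0 : 0 < B := by linarith
  have hCF0 : 0 < CF := by positivity
  refine ⟨2 * (B / κ + 4 * CF + 4 * (4 * 10 ^ 8 * K ^ 3 * B) + 64 * B), by positivity, ?_⟩
  intro ε s L ψ f f1 f2 g g1 g2 Fp Fm G ωp ωm Ep Em E hp hψ hf hg hfg mFp mFm mG mωp mωm hF hω hEpm hE hid
  have he := hp.he0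
  have hs := hp.hs
  have hL := hp.hL1
  have hpi := Real.pi_pos
  have hpi3 := Real.pi_gt_three
  have hpi4 := Real.pi_lt_four
  have hεL : 0 < ε * L := by positivity
  have hH : ∀ c, ε ≤ c → c ≤ 8 * ε → ∃ H, HH ε s c C1 H ∧ |∫ α, Ep α * H α| ≤ CE * (ε * L) ∧ |∫ α, Em α * H α| ≤ CE * (ε * L) := by
    intro c hc hc8
    obtain ⟨H, h1, h2⟩ := Hstar_HH hp hψ hf hg hfg hc hc8
    obtain ⟨e1, e2⟩ := hEpm c hc hc8
    have gen : ∀ W : ℝ → ℝ, |∫ α, W α * Hstar ψ ε f g (fun α => κ * (ψ (α / (s / 128)) * PK c α)) α| ≤ B * (ε * L) →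
        |∫ α, W α * H α| ≤ CE * (ε * L) := by
      intro W hW
      have e : ∫ α, W α * Hstar ψ ε f g (fun α => κ * (ψ (α / (s / 128)) * PK c α)) α = ((2 * π)⁻¹ * κ) * ∫ α, W α * H α := by
        rw [← integral_const_mul]
        refine integral_congr_ae ?_
        filter_upwards [h2 κ] with α hα
        rw [hα]; ring
      rw [e, abs_mul, abs_of_pos (by positivity)] at hW
      have h3 : |∫ α, W α * H α| = (2 * π / κ) * ((2 * π)⁻¹ * κ * |∫ α, W α * H α|) := by field_simp
      rw [h3, hCE]
      calc _ ≤ (2 * 4 / κ) * (B * (ε * L)) := by gcongr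
        _ = _ := by ring
    exact ⟨H, h1, gen Ep e1, gen Em e2⟩
  obtain ⟨H2, hH2, p2, m2⟩ := hH (2 * ε) (by linarith) (by linarith)
  obtain ⟨H4, hH4, p4, m4⟩ := hH (4 * ε) (by linarith) (by linarith)
  have q1 : ∀ c H, HH ε s c C1 H → |∫ α, Ep α * H α| ≤ CE * (ε * L) → ε ≤ c → c ≤ 6 * ε →
      |2 * (-(1 / 2)) * (∫ β, qc ε c β * wt s ωp β) - ∫ β, qc ε (c + 2 * ε) β * wt s ωm β| ≤ CF * (ε * L) := fun c H hH hE hc hc6 =>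
    Feq hp hψ hf hg hfg hH hc hc6 mωp mωm hB (fun β hb => (hω β hb).1) (fun β hb => (hω β hb).2) (by rw [abs_neg, abs_of_pos] <;> norm_num) mFp
      (fun α ha => (hF α ha).1) (fun α ha => (hF α ha).2.2.2.1) hE (fun α ha => by rw [(hid α ha).1]; ring)
  have q2 : ∀ c H, HH ε s c C1 H → |∫ α, Em α * H α| ≤ CE * (ε * L) → ε ≤ c → c ≤ 6 * ε →
      |2 * (1 / 2) * (∫ β, qc ε c β * wt s ωm β) - ∫ β, qc ε (c + 2 * ε) β * wt s ωp β| ≤ CF * (ε * L) := fun c H hH hE hc hc6 =>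
    Feq hp hψ hg hf hfg.symm hH hc hc6 mωm mωp hB (fun β hb => (hω β hb).2) (fun β hb => (hω β hb).1) (by rw [abs_of_pos] <;> norm_num) mFm
      (fun α ha => (hF α ha).2.1) (fun α ha => (hF α ha).2.2.2.2.1) hE (fun α ha => by rw [(hid α ha).2.1]; ring)
  have a12 := q1 _ _ hH2 p2 (by linarith) (by linarith)
  have a23 := q1 _ _ hH4 p4 (by linarith) (by linarith)
  have b12 := q2 _ _ hH2 m2 (by linarith) (by linarith)
  have b23 := q2 _ _ hH4 m4 (by linarith) (by linarith)
  rw [show 2 * ε + 2 * ε = 4 * ε by ring] at a12 b12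
  rw [show 4 * ε + 2 * ε = 6 * ε by ring] at a23 b23
  obtain ⟨i1, j1⟩ := T24_est hp hψ hf hg hfg (c := 2 * ε) (by linarith) (by linarith) mωp hB (fun β hb => (hω β hb).1)
  obtain ⟨i2, j2⟩ := T24_est hp hψ hf hg hfg (c := 6 * ε) (by linarith) (by linarith) mωp hB (fun β hb => (hω β hb).1)
  obtain ⟨i3, j3⟩ := T24_est hp hψ hg hf hfg.symm (c := 2 * ε) (by linarith) (by linarith) mωm hB (fun β hb => (hω β hb).2)
  obtain ⟨i4, j4⟩ := T24_est hp hψ hg hf hfg.symm (c := 6 * ε) (by linarith) (by linarith) mωm hB (fun β hb => (hω β hb).2)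
  set P : ℝ → ℝ := fun α => PK (2 * ε) α + PK (6 * ε) α with hP
  have mP : Measurable P := (measurable_PK _).add (measurable_PK _)
  have iP : Integrable P := (integrable_PK (by positivity)).add (integrable_PK (by positivity))
  have P0 : ∀ α, 0 ≤ P α := fun α => add_nonneg (PK_nonneg (by positivity) _) (PK_nonneg (by positivity) _)
  have mχ : Measurable fun α : ℝ => ψ (α / (s / 128)) := by have := hψ.m; fun_prop
  have bχ : BC (fun α : ℝ => ψ (α / (s / 128))) 1 (2 * s) := by
    refine ⟨mχ, fun t => by rw [abs_of_nonneg (hψ.nn _)]; exact hψ.le1 _, fun t ht => ?_⟩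
    by_contra h0
    have := hψ.of_ne (by positivity) h0
    linarith
  have iχP : Integrable fun α => ψ (α / (s / 128)) * P α :=
    iP.bdd_mul (c := 1) mχ.aestronglyMeasurable (Eventually.of_forall bχ.bd)
  have hlow := chiP_lower hp hψ iχP
  obtain ⟨iD, bD⟩ := bχ.int_rho hp (g := fun t => wt (s / 2) (fun t => G t - G 0) t * P t) (c := 32 * B * ε) (by positivity)
    (((mG.sub_const _).indicator measurableSet_Ioo).mul mP) (Eventually.of_forall fun t _ => by
      have hr : 0 < ε + |t| := by positivity
      by_cases ht : |t| < s
      · rw [wt_in (by linarith), abs_mul, abs_of_nonneg (P0 t)]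
        have h2 := PK_rho he (c := 2 * ε) (by linarith) (by linarith) t
        have h6 := PK_rho he (c := 6 * ε) (by linarith) (by linarith) t
        calc _ ≤ B * |t| * P t := mul_le_mul_of_nonneg_right (hF t ht).2.2.2.2.2 (P0 t)
          _ = B * (PK (2 * ε) t * |t| + PK (6 * ε) t * |t|) := by simp only [hP]; ring
          _ ≤ B * (16 * ε * (ε + |t|)⁻¹ + 16 * ε * (ε + |t|)⁻¹) := by gcongr
          _ = _ := by ring
      · rw [wt_out (by push Not at ht; linarith), zero_mul, abs_zero]; positivity)
  have hin : ∀ α, ψ (α / (s / 128)) ≠ 0 → |α| < s := fun α h => by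
    have := hψ.of_ne (by positivity) h; linarith
  have eE : ∀ α, 2 * π * (E α * (ψ (α / (s / 128)) * P α)) = 2 * π * (wt (s / 2) (fun t => G t - G 0) α * P α * ψ (α / (s / 128)))
      + 2 * π * G 0 * (ψ (α / (s / 128)) * P α)
      + PK (2 * ε) α * (ψ (α / (s / 128)) * (2 * π * (T2 ψ ε f ωp α - T4 ψ ε g f ωp α)))
      + PK (6 * ε) α * (ψ (α / (s / 128)) * (2 * π * (T2 ψ ε f ωp α - T4 ψ ε g f ωp α)))
      + PK (2 * ε) α * (ψ (α / (s / 128)) * (2 * π * (T2 ψ ε g ωm α - T4 ψ ε f g ωm α)))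
      + PK (6 * ε) α * (ψ (α / (s / 128)) * (2 * π * (T2 ψ ε g ωm α - T4 ψ ε f g ωm α))) := fun α => by
    by_cases h0 : ψ (α / (s / 128)) = 0
    · rw [h0]; ring
    · have ha := hin α h0
      rw [wt_in (by linarith), (hid α ha).2.2]
      simp only [hP]; ring
  have eI : 2 * π * (∫ α, E α * (ψ (α / (s / 128)) * P α)) = 2 * π * (∫ α, wt (s / 2) (fun t => G t - G 0) α * P α * ψ (α / (s / 128)))
      + 2 * π * G 0 * (∫ α, ψ (α / (s / 128)) * P α)
      + (∫ α, PK (2 * ε) α * (ψ (α / (s / 128)) * (2 * π * (T2 ψ ε f ωp α - T4 ψ ε g f ωp α))))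
      + (∫ α, PK (6 * ε) α * (ψ (α / (s / 128)) * (2 * π * (T2 ψ ε f ωp α - T4 ψ ε g f ωp α))))
      + (∫ α, PK (2 * ε) α * (ψ (α / (s / 128)) * (2 * π * (T2 ψ ε g ωm α - T4 ψ ε f g ωm α))))
      + (∫ α, PK (6 * ε) α * (ψ (α / (s / 128)) * (2 * π * (T2 ψ ε g ωm α - T4 ψ ε f g ωm α)))) := by
    rw [← integral_const_mul, ← integral_const_mul, ← integral_const_mul]
    simp_rw [eE]
    have k1 := iD.const_mul (2 * π)
    have k2 := iχP.const_mul (2 * π * G 0)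
    exact int6 k1 k2 i1 i2 i3 i4
  have hE' : |∫ α, E α * (ψ (α / (s / 128)) * P α)| ≤ B / κ * (ε * L) := by
    have e : ∫ α, E α * (κ * (ψ (α / (s / 128)) * (PK (2 * ε) α + PK (6 * ε) α))) = κ * ∫ α, E α * (ψ (α / (s / 128)) * P α) := by
      rw [← integral_const_mul]; congr 1; ext α; simp only [hP]; ring
    rw [e, abs_mul, abs_of_pos hκ] at hE
    rw [div_mul_eq_mul_div, le_div_iff₀ hκ]; linarith
  have bD' : |∫ α, wt (s / 2) (fun t => G t - G 0) α * P α * ψ (α / (s / 128))| ≤ 64 * B * (ε * L) := bD.trans_eq (by ring)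
  exact fin_arith hεL (by positivity) hCF0 hlow a12 a23 b12 b23 j1 j2 j3 j4 hE' bD' eI

end


section
open scoped ENNReal Topology

lemma PK_deriv {c : ℝ} (hc : 0 < c) (x : ℝ) : HasDerivAt (PK c) (-(c * (2 * x)) / (x ^ 2 + c ^ 2) ^ 2) x := by
  have h1 : HasDerivAt (fun x : ℝ => x ^ 2 + c ^ 2) (2 * x) x := by
    simpa using (hasDerivAt_pow 2 x).add_const (c ^ 2)
  exact ((hasDerivAt_const x c).div h1 (den_pos hc x).ne').congr_deriv (by ring)

lemma PK_deriv_bd {ε c : ℝ} (he : 0 < ε) (hc : ε ≤ c) (hc8 : c ≤ 8 * ε) (x : ℝ) :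
    |-(c * (2 * x)) / (x ^ 2 + c ^ 2) ^ 2| ≤ 16 * ε * |x| / (ε ^ 2 + |x| ^ 2) ^ 2 := by
  have hc0 := he.trans_le hc
  rw [abs_div, abs_neg, abs_mul, abs_mul, abs_of_pos hc0, abs_two, abs_of_pos (pow_pos (den_pos hc0 x) 2 : (0:ℝ) < (x ^ 2 + c ^ 2) ^ 2), sq_abs]
  have : ε ^ 2 ≤ c ^ 2 := by gcongr
  calc _ ≤ 8 * ε * (2 * |x|) / (ε ^ 2 + x ^ 2) ^ 2 := by
        refine div_le_div₀ (by positivity) (mul_le_mul_of_nonneg_right hc8 (by positivity)) (by positivity)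
          (pow_le_pow_left₀ (by positivity) (by linarith) 2)
    _ = _ := by ring

lemma PK_C2 {c : ℝ} (hc : 0 < c) : ContDiff ℝ 1 (PK c) := by
  unfold PK
  exact contDiff_const.div ((contDiff_id.pow 2).add contDiff_const) fun x => (den_pos hc x).ne'

lemma phi_InC2 {K ε s L δ a b : ℝ} {ψ : ℝ → ℝ} (hp : Par K ε s L) (hψ : Cut K ψ) (cψ : ContDiff ℝ 1 ψ)
    (dψ : ∀ x, |deriv ψ x| ≤ K) (hsδ : s < δ) (ha : ε ≤ a) (ha8 : a ≤ 8 * ε) (hb : ε ≤ b) (hb8 : b ≤ 8 * ε) {κ : ℝ} (hκ0 : 0 < κ)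
    (hκ : κ * (5000 * K) ≤ 1) :
    InC2 δ ε (fun α => κ * (ψ (α / (s / 128)) * (PK a α + PK b α))) ∧
    tsupport (fun α => κ * (ψ (α / (s / 128)) * (PK a α + PK b α))) ⊆ Ioo (-(s / 8)) (s / 8) := by
  have he := hp.he0
  have hs := hp.hs
  have hK := hp.hK
  have hes := hp.hes
  have ha0 := he.trans_le ha
  have hb0 := he.trans_le hb
  set φ : ℝ → ℝ := fun α => κ * (ψ (α / (s / 128)) * (PK a α + PK b α)) with hφ
  have hz : ∀ α, s / 128 < |α| → φ α = 0 := fun α h => by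
    simp only [hφ]
    rw [hψ.supp, zero_mul, mul_zero]
    rw [abs_div, abs_of_pos (by positivity : 0 < s / 128), le_div_iff₀ (by positivity)]; linarith
  have hts : tsupport φ ⊆ Icc (-(s / 128)) (s / 128) := by
    refine closure_minimal (fun α hα => ?_) isClosed_Icc
    by_contra h
    exact hα (hz α (by by_contra h2; exact h (abs_le.1 (not_lt.1 h2))))
  have hcs : HasCompactSupport φ := isCompact_Icc.of_isClosed_subset (isClosed_tsupport φ) hts
  have hC : ContDiff ℝ 1 φ :=
    contDiff_const.mul ((cψ.comp (contDiff_id.div_const _)).mul ((PK_C2 ha0).add (PK_C2 hb0)))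
  have hκK : κ ≤ 1 / 5000 := by nlinarith
  refine ⟨⟨hC, hcs, hts.trans fun x hx => ⟨by linarith [hx.1], by linarith [hx.2]⟩, fun α _ => ⟨?_, ?_⟩⟩,
    hts.trans fun x hx => ⟨by linarith [hx.1], by linarith [hx.2]⟩⟩
  all_goals
    have hD : 0 < ε ^ 2 + |α| ^ 2 := by positivity
    have hPa := PK_nonneg ha0 α
    have hPb := PK_nonneg hb0 α
    have hP : PK a α + PK b α ≤ 16 * (ε / (ε ^ 2 + |α| ^ 2)) := by
      have h1 := PK_comp he ha ha8 α
      have h2 := PK_comp he hb hb8 α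
      have e : PK ε α = ε / (ε ^ 2 + |α| ^ 2) := by unfold PK; rw [sq_abs, add_comm]
      rw [e] at h1 h2
      linarith
  · simp only [hφ]
    rw [abs_of_nonneg (mul_nonneg hκ0.le (mul_nonneg (hψ.nn _) (by linarith)))]
    calc _ ≤ 1 / 5000 * (1 * (16 * (ε / (ε ^ 2 + |α| ^ 2)))) := by
          gcongr
          · exact mul_nonneg (hψ.nn _) (by linarith)
          · exact hψ.le1 _
      _ ≤ _ := by
          have : 0 ≤ ε / (ε ^ 2 + |α| ^ 2) := by positivity
          linarith
  · have hN : 0 < ε ^ 3 + |α| ^ 3 := by positivity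
    by_cases hα : |α| ≤ s / 128
    · have d1 : HasDerivAt (fun α : ℝ => ψ (α / (s / 128))) (deriv ψ (α / (s / 128)) * (1 / (s / 128))) α :=
        ((cψ.differentiable one_ne_zero) _).hasDerivAt.comp α ((hasDerivAt_id α).div_const (s / 128))
      have d2 := (d1.mul ((PK_deriv ha0 α).add (PK_deriv hb0 α))).const_mul κ
      have d3 : HasDerivAt φ _ α := d2
      rw [d3.deriv, abs_mul, abs_of_pos hκ0]
      have b1 : |deriv ψ (α / (s / 128)) * (1 / (s / 128)) * (PK a α + PK b α)| ≤ 2048 * K * (ε / (ε ^ 3 + |α| ^ 3)) := by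
        rw [abs_mul, abs_mul, abs_of_nonneg (add_nonneg hPa hPb), abs_of_pos (by positivity : 0 < 1 / (s / 128))]
        calc _ ≤ K * (1 / (s / 128)) * (16 * (ε / (ε ^ 2 + |α| ^ 2))) := by
              gcongr
              exact dψ _
          _ = 2048 * K * (ε / (s * (ε ^ 2 + |α| ^ 2))) := by field_simp; norm_num
          _ ≤ _ := by
              have : ε ^ 3 + |α| ^ 3 ≤ s * (ε ^ 2 + |α| ^ 2) := by
                have h1 : ε * ε ^ 2 ≤ s * ε ^ 2 := by gcongr; linarith
                have h2 : |α| * |α| ^ 2 ≤ s * |α| ^ 2 := by gcongr; linarith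
                linarith
              gcongr
      have b2 : |ψ (α / (s / 128)) * (-(a * (2 * α)) / (α ^ 2 + a ^ 2) ^ 2 + -(b * (2 * α)) / (α ^ 2 + b ^ 2) ^ 2)| ≤
          64 * (ε / (ε ^ 3 + |α| ^ 3)) := by
        rw [abs_mul, abs_of_nonneg (hψ.nn _)]
        have h1 := PK_deriv_bd he ha ha8 α
        have h2 := PK_deriv_bd he hb hb8 α
        have h3 := (abs_add_le _ _).trans (add_le_add h1 h2)
        refine (mul_le_of_le_one_left (abs_nonneg _) (hψ.le1 _)).trans (h3.trans ?_)
        have h4 : |α| * (ε ^ 3 + |α| ^ 3) ≤ 2 * (ε ^ 2 + |α| ^ 2) ^ 2 := by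
          nlinarith [abs_nonneg α, sq_nonneg (ε - |α|), mul_nonneg (abs_nonneg α) he.le, sq_nonneg (ε ^ 2), sq_nonneg (|α| ^ 2),
            mul_nonneg (sq_nonneg ε) (sq_nonneg (ε - |α|)), mul_nonneg (sq_nonneg ε) (sq_nonneg |α|)]
        have e : 16 * ε * |α| / (ε ^ 2 + |α| ^ 2) ^ 2 + 16 * ε * |α| / (ε ^ 2 + |α| ^ 2) ^ 2 =
          32 * ε * |α| / (ε ^ 2 + |α| ^ 2) ^ 2 := by ring
        rw [e, ← mul_div_assoc, div_le_div_iff₀ (by positivity) hN]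
        have := mul_le_mul_of_nonneg_left h4 (by positivity : 0 ≤ 32 * ε)
        linarith
      calc _ ≤ κ * (2048 * K * (ε / (ε ^ 3 + |α| ^ 3)) + 64 * (ε / (ε ^ 3 + |α| ^ 3))) :=
            mul_le_mul_of_nonneg_left ((abs_add_le _ _).trans (add_le_add b1 b2)) hκ0.le
        _ = κ * (2048 * K + 64) * (ε / (ε ^ 3 + |α| ^ 3)) := by ring
        _ ≤ 1 * (ε / (ε ^ 3 + |α| ^ 3)) := by
            gcongr
            refine le_trans ?_ hκ
            gcongr
            linarith
        _ = _ := one_mul _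
    · push Not at hα
      have : φ =ᶠ[𝓝 α] fun _ => 0 := by
        have ho : IsOpen {x : ℝ | s / 128 < |x|} := isOpen_lt continuous_const continuous_abs
        filter_upwards [ho.mem_nhds hα] with x hx using hz x hx
      rw [this.deriv_eq, deriv_const, abs_zero]; positivity

lemma mvt {h h' : ℝ → ℝ} {a b C : ℝ} (hd : ∀ x ∈ uIcc a b, HasDerivAt h (h' x) x) (hb : ∀ x ∈ uIcc a b, |h' x| ≤ C) :
    |h b - h a| ≤ C * |b - a| :=
  (convex_uIcc a b).norm_image_sub_le_of_norm_hasDerivWithin_le (fun x hx => (hd x hx).hasDerivWithinAt) hb left_mem_uIcc right_mem_uIcc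

lemma uIcc_abs {a b x M : ℝ} (hx : x ∈ uIcc a b) (ha : |a| ≤ M) (hb : |b| ≤ M) : |x| ≤ M := by
  rw [mem_uIcc] at hx
  rw [abs_le] at *
  rcases hx with h | h <;> constructor <;> linarith [h.1, h.2, ha.1, ha.2, hb.1, hb.2]

lemma Fn_mk {K s δ : ℝ} {f f3 : ℝ → ℝ} (hK : 0 ≤ K) (hs : 0 < s) (hsδ : 4 * s < δ) (mf : Measurable f) (f0 : f 0 = 0)
    (h1 : ∀ x, |x| < δ → HasDerivAt f (deriv f x) x) (h2 : ∀ x, |x| < δ → HasDerivAt (deriv f) (deriv (deriv f) x) x)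
    (h3 : ∀ x, |x| < δ → HasDerivAt (deriv (deriv f)) (f3 x) x) (d0 : deriv f 0 = 0)
    (b2 : ∀ x, |x| < δ → |deriv (deriv f) x| ≤ K) (b3 : ∀ x, |x| < δ → |f3 x| ≤ K) : Fn K s f (deriv f) (deriv (deriv f)) := by
  have hin : ∀ {α β x : ℝ}, |α| < 4 * s → |β| < 4 * s → x ∈ uIcc β α → |x| < δ := fun ha hb hx =>
    (uIcc_abs hx hb.le ha.le).trans_lt hsδ
  have f1b : ∀ β, |β| < 4 * s → |deriv f β| ≤ K * |β| := fun β hb => by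
    have := mvt (a := 0) (b := β) (fun x hx => h2 x (hin hb (by simpa using hs) hx)) (fun x hx => b2 x (hin hb (by simpa using hs) hx))
    rwa [d0, sub_zero, sub_zero] at this
  have dist : ∀ {α β x : ℝ}, x ∈ uIcc β α → |x - β| ≤ |α - β| := fun hx => abs_sub_left_of_mem_uIcc hx
  refine ⟨mf, measurable_deriv f, measurable_deriv _, f0, f1b, fun β hb => b2 β (by linarith), fun α β ha hb => ?_, fun α β ha hb => ?_⟩
  · have := mvt (a := β) (b := α) (C := K * (|α| + |β|)) (fun x hx => h1 x (hin ha hb hx)) (fun x hx => by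
      exact (f1b x ((uIcc_abs hx (le_max_right _ _) (le_max_left _ _)).trans_lt (max_lt ha hb))).trans
        (mul_le_mul_of_nonneg_left (uIcc_abs hx (by linarith [abs_nonneg α]) (by linarith [abs_nonneg β])) hK))
    linarith
  · have r2 : ∀ x ∈ uIcc β α, |deriv (deriv f) x - deriv (deriv f) β| ≤ K * |α - β| := fun x hx => by
      have hsub := uIcc_subset_uIcc left_mem_uIcc hx
      refine (mvt (a := β) (b := x) (fun y hy => h3 y (hin ha hb (hsub hy))) (fun y hy => b3 y (hin ha hb (hsub hy)))).trans ?_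
      exact mul_le_mul_of_nonneg_left (dist hx) hK
    have r1 : ∀ x ∈ uIcc β α, |deriv f x - deriv f β - (x - β) * deriv (deriv f) β| ≤ K * |α - β| ^ 2 := fun x hx => by
      have hsub := uIcc_subset_uIcc left_mem_uIcc hx
      have := mvt (a := β) (b := x) (h := fun y => deriv f y - deriv f β - (y - β) * deriv (deriv f) β)
        (h' := fun y => deriv (deriv f) y - deriv (deriv f) β) (C := K * |α - β|)
        (fun y hy => (((h2 y (hin ha hb (hsub hy))).sub_const _).sub (((hasDerivAt_id y).sub_const β).mul_const _)).congr_deriv (by ring))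
        (fun y hy => r2 y (hsub hy))
      simp only [sub_self, zero_mul, sub_zero] at this
      refine this.trans ?_
      have := mul_le_mul_of_nonneg_left (dist hx) (by positivity : 0 ≤ K * |α - β|)
      linarith
    have := mvt (a := β) (b := α) (h := fun y => f y - f β - (y - β) * deriv f β - (y - β) ^ 2 / 2 * deriv (deriv f) β)
        (h' := fun y => deriv f y - deriv f β - (y - β) * deriv (deriv f) β) (C := K * |α - β| ^ 2)
        (fun y hy => ((((h1 y (hin ha hb hy)).sub_const _).sub (((hasDerivAt_id y).sub_const β).mul_const _)).sub
          (((((hasDerivAt_id y).sub_const β).pow 2).div_const 2).mul_const _)).congr_deriv (by simp)) r1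
    simp only [sub_self, zero_mul, sub_zero, ne_eq, OfNat.ofNat_ne_zero, not_false_eq_true, zero_pow, zero_div] at this
    linarith

end


section
open scoped ENNReal Topology

lemma Cut_mk {ψ : ℝ → ℝ} (hψ : IsCutoff ψ) : ∃ K₀ : ℝ, 0 ≤ K₀ ∧ ∀ K, K₀ ≤ K → 0 < K → Cut K ψ ∧ ContDiff ℝ 1 ψ ∧ ∀ x, |deriv ψ x| ≤ K := by
  obtain ⟨h1, h2, h3, h4, h5⟩ := hψ
  have hC : ContDiff ℝ 1 ψ := h1.of_le (by exact_mod_cast le_top)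
  have hts : tsupport ψ ⊆ Icc (-1) 1 := by
    refine closure_minimal (fun α hα => ?_) isClosed_Icc
    by_contra h
    exact hα (h4 α (by by_contra h2; exact h (abs_le.1 (not_lt.1 h2))))
  have hcs : HasCompactSupport ψ := isCompact_Icc.of_isClosed_subset (isClosed_tsupport ψ) hts
  obtain ⟨K₀, hK₀⟩ := hcs.deriv.exists_bound_of_continuous (hC.continuous_deriv le_rfl)
  refine ⟨K₀, (norm_nonneg _).trans (hK₀ 0), fun K hK hK0 => ?_⟩
  have hd : ∀ x, |deriv ψ x| ≤ K := fun x => (hK₀ x).trans hK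
  have hl : ∀ x y, |ψ x - ψ y| ≤ K * |x - y| := fun x y =>
    mvt (fun z _ => (hC.differentiable (by norm_num) z).hasDerivAt) (fun z _ => hd z)
  refine ⟨⟨hC.continuous.measurable, fun x => (h3 x).1, fun x => (h3 x).2, fun x hx => ?_, h5, hl⟩, hC, hd⟩
  rcases hx.lt_or_eq with h | h
  · exact h4 x h
  · refine le_antisymm (le_of_forall_pos_le_add fun η hη => ?_) (h3 x).1
    have hk : 0 < η / K := by positivity
    have e1 : ψ ((1 + η / K) * x) = 0 := h4 _ (by rw [abs_mul, ← h, mul_one, abs_of_pos (by linarith)]; linarith)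
    have e2 := hl x ((1 + η / K) * x)
    have e3 : x - (1 + η / K) * x = -(η / K) * x := by ring
    rw [e1, sub_zero, e3, abs_mul, ← h, abs_neg, abs_of_pos hk, mul_one, mul_div_cancel₀ _ hK0.ne'] at e2
    linarith [le_abs_self (ψ x)]

lemma ind_eq {δ x : ℝ} {f : ℝ → ℝ} (h : |x| < δ) : (Ioo (-δ) δ).indicator f x = f x :=
  indicator_of_mem (show x ∈ Ioo (-δ) δ from abs_lt.1 h) f

lemma Fn_ind {K s δ : ℝ} {f : ℝ → ℝ} (hK : 0 ≤ K) (hs : 0 < s) (hsδ : 4 * s < δ) (hf : ContDiffOn ℝ 5 f (Ioo (-δ) δ)) (f0 : f 0 = 0)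
    (d0 : derivWithin f (Ioo (-δ) δ) 0 = 0) (hb : ∀ x ∈ Ioo (-δ) δ, ∀ i : ℕ, i ≤ 3 → |iteratedDerivWithin i f (Ioo (-δ) δ) x| ≤ K) :
    ∃ f1 f2, Fn K s ((Ioo (-δ) δ).indicator f) f1 f2 := by
  set S := Ioo (-δ) δ with hS
  have oS : IsOpen S := isOpen_Ioo
  have mem0 : (0:ℝ) ∈ S := ⟨by linarith, by linarith⟩
  set F := S.indicator f with hF
  have hEq : EqOn F f S := fun x hx => indicator_of_mem hx f
  have c5 : ContDiffOn ℝ 5 F S := hf.congr hEq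
  have c4 : ContDiffOn ℝ 4 (deriv F) S := c5.deriv_of_isOpen oS (by norm_num)
  have c3 : ContDiffOn ℝ 3 (deriv (deriv F)) S := c4.deriv_of_isOpen oS (by norm_num)
  have hasd : ∀ {h : ℝ → ℝ} {n : WithTop ℕ∞}, n ≠ 0 → ContDiffOn ℝ n h S → ∀ x, |x| < δ → HasDerivAt h (deriv h x) x := fun hn hc x hx =>
    ((hc.differentiableOn hn).differentiableAt (oS.mem_nhds (abs_lt.1 hx))).hasDerivAt
  have it : ∀ i x, x ∈ S → iteratedDeriv i F x = iteratedDerivWithin i f S x := fun i x hx => by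
    rw [iteratedDerivWithin_of_isOpen oS hx]
    exact Filter.EventuallyEq.iteratedDeriv_eq i (hEq.eventuallyEq_of_mem (oS.mem_nhds hx))
  have i2 : iteratedDeriv 2 F = deriv (deriv F) := by
    rw [iteratedDeriv_succ, iteratedDeriv_one]
  have i3 : iteratedDeriv 3 F = deriv (deriv (deriv F)) := by
    rw [iteratedDeriv_succ, i2]
  refine ⟨_, _, Fn_mk (f3 := deriv (deriv (deriv F))) hK hs hsδ ?_ ?_ (hasd (by norm_num) c5) (hasd (by norm_num) c4) (hasd (by norm_num) c3) ?_ ?_ ?_⟩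
  · have := hf.continuousOn.measurable_piecewise (g := (0 : ℝ → ℝ)) continuousOn_const oS.measurableSet
    rwa [piecewise_eq_indicator] at this
  · rw [hF, indicator_of_mem mem0, f0]
  · rw [(hEq.eventuallyEq_of_mem (oS.mem_nhds mem0)).deriv_eq, ← derivWithin_of_isOpen oS mem0, d0]
  · intro x hx
    rw [← i2, it 2 x (abs_lt.1 hx)]; exact hb x (abs_lt.1 hx) 2 (by norm_num)
  · intro x hx
    rw [← i3, it 3 x (abs_lt.1 hx)]; exact hb x (abs_lt.1 hx) 3 (by norm_num)

lemma lip0 {s B : ℝ} {F : ℝ → ℝ} (hs : 0 < s) (hF : ContDiffOn ℝ 1 F (Ioo (-(2 * s)) (2 * s)))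
    (hb : ∀ x ∈ Ioo (-(2 * s)) (2 * s), |derivWithin F (Ioo (-(2 * s)) (2 * s)) x| ≤ B) {x : ℝ} (hx : |x| < s) :
    |F x - F 0| ≤ B * |x| := by
  have := (convex_Ioo (-(2 * s)) (2 * s)).norm_image_sub_le_of_norm_derivWithin_le (x := 0) (y := x)
    (hF.differentiableOn (by norm_num)) hb ⟨by linarith, by linarith⟩ (abs_lt.1 (by linarith))
  simpa using this

section
variable {K ψ f g h φ : ℝ → ℝ} {ε s δ k α : ℝ}

lemma scut_zero (hψ : Cut k ψ) {r x : ℝ} (hr : 0 < r) (hx : r ≤ |x|) : scut ψ r x = 0 :=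
  hψ.supp _ (by rwa [abs_div, abs_of_pos hr, le_div_iff₀ hr, one_mul])

lemma near {β : ℝ} (hs : 0 < s) (hsδ : 4 * s < δ) (ha : |α| < s) (h : ¬ s ≤ |α - β|) : |β| < δ := by
  have := abs_sub_abs_le_abs_sub β α
  rw [abs_sub_comm] at this
  linarith

lemma T1_ind (hψ : Cut k ψ) (hs : 0 < √ε) (hsδ : 4 * √ε < δ) (ha : |α| < √ε) :
    T1 ψ ε ((Ioo (-δ) δ).indicator f) h α = T1 ψ ε f h α := by
  unfold T1
  congr 2; funext β
  by_cases hb : √ε ≤ |α - β|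
  · rw [scut_zero hψ hs hb, mul_zero, mul_zero]
  · rw [ind_eq (near hs hsδ ha hb), ind_eq (by linarith : |α| < δ)]

lemma T2_ind (hψ : Cut k ψ) (hs : 0 < √ε) (hsδ : 4 * √ε < δ) (ha : |α| < √ε) :
    T2 ψ ε ((Ioo (-δ) δ).indicator f) h α = T2 ψ ε f h α := by
  unfold T2
  congr 2; funext β
  by_cases hb : √ε ≤ |α - β|
  · rw [scut_zero hψ hs hb, mul_zero, mul_zero]
  · rw [ind_eq (near hs hsδ ha hb), ind_eq (by linarith : |α| < δ)]

lemma T3_ind (hψ : Cut k ψ) (hs : 0 < √ε) (hsδ : 4 * √ε < δ) (ha : |α| < √ε) :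
    T3 ψ ε ((Ioo (-δ) δ).indicator f) ((Ioo (-δ) δ).indicator g) h α = T3 ψ ε f g h α := by
  unfold T3
  congr 2; funext β
  by_cases hb : √ε ≤ |α - β|
  · rw [scut_zero hψ hs hb, mul_zero, mul_zero]
  · rw [ind_eq (near hs hsδ ha hb), ind_eq (by linarith : |α| < δ)]

lemma T4_ind (hψ : Cut k ψ) (hs : 0 < √ε) (hsδ : 4 * √ε < δ) (ha : |α| < √ε) :
    T4 ψ ε ((Ioo (-δ) δ).indicator f) ((Ioo (-δ) δ).indicator g) h α = T4 ψ ε f g h α := by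
  unfold T4
  congr 2; funext β
  by_cases hb : √ε ≤ |α - β|
  · rw [scut_zero hψ hs hb, mul_zero, mul_zero]
  · rw [ind_eq (near hs hsδ ha hb), ind_eq (by linarith : |α| < δ)]

lemma Hstar_ind (hψ : Cut k ψ) (hs : 0 < √ε) (hsδ : 4 * √ε < δ) (β : ℝ) :
    Hstar ψ ε ((Ioo (-δ) δ).indicator f) ((Ioo (-δ) δ).indicator g) φ β = Hstar ψ ε f g φ β := by
  unfold Hstar
  congr 2; funext α
  unfold Hker Xt
  by_cases hb : √ε / 2 ^ 6 ≤ |α|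
  · rw [scut_zero hψ (by positivity) hb]; simp only [mul_zero, zero_mul]
  · have : |α| < δ := by
      push Not at hb
      have : √ε / 2 ^ 6 ≤ √ε := div_le_self hs.le (by norm_num)
      linarith
    rw [ind_eq this, ind_eq this]
end

end

/-- **Main technical proposition (Proposition 3.4).**  If `F⁺, F⁻, G, ω⁺, ω⁻, E⁺, E⁻, E ∈ L²(I_δ)`
satisfy the `C¹`/`L∞` bounds by `B`, the `Z`-norm (resp. weak) bounds `≤ B ε log(1/ε)` for
`E⁺, E⁻` (resp. `E`), and the identities
`F⁺ = T_{1,f}ω⁺ − T_{3,(f,g)}ω⁻ − ω⁺/2 + E⁺`,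
`F⁻ = −T_{3,(g,f)}ω⁺ + T_{1,g}ω⁻ + ω⁻/2 + E⁻`,
`G = (T_{4,(g,f)} − T_{2,f})ω⁺ + (T_{4,(f,g)} − T_{2,g})ω⁻ + E` on `I_{√ε}`, then
`|G(0)| ≤ C ε log(1/ε)` with `C` depending only on `A`, `δ`, `B` (and `ψ`). -/
theorem main_technical_proposition (δ A : ℝ) (hδ : δ ∈ Ioc (0:ℝ) (1/100)) (hA : 1 ≤ A)
    (ψ : ℝ → ℝ) (hψ : IsCutoff ψ) (B : ℝ) (hB : 1 ≤ B) :
    ∃ C : ℝ, 0 < C ∧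
      ∀ ε : ℝ, ε ∈ Ioc (0:ℝ) (δ ^ 2 / 100) →
      ∀ f g : ℝ → ℝ, GoodFG δ A ε f g →
      ∀ Fp Fm G ωp ωm Ep Em E : ℝ → ℝ,
        (Measurable Fp ∧ Measurable Fm ∧ Measurable G ∧ Measurable ωp ∧ Measurable ωm ∧
          Measurable Ep ∧ Measurable Em ∧ Measurable E) →
        (IntegrableOn (fun x => Fp x ^ 2) (Ioo (-δ) δ) ∧
          IntegrableOn (fun x => Fm x ^ 2) (Ioo (-δ) δ) ∧
          IntegrableOn (fun x => G x ^ 2) (Ioo (-δ) δ) ∧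
          IntegrableOn (fun x => ωp x ^ 2) (Ioo (-δ) δ) ∧
          IntegrableOn (fun x => ωm x ^ 2) (Ioo (-δ) δ) ∧
          IntegrableOn (fun x => Ep x ^ 2) (Ioo (-δ) δ) ∧
          IntegrableOn (fun x => Em x ^ 2) (Ioo (-δ) δ) ∧
          IntegrableOn (fun x => E x ^ 2) (Ioo (-δ) δ)) →
        (ContDiffOn ℝ 1 Fp (Ioo (-(2 * Real.sqrt ε)) (2 * Real.sqrt ε)) ∧
          ContDiffOn ℝ 1 Fm (Ioo (-(2 * Real.sqrt ε)) (2 * Real.sqrt ε)) ∧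
          ContDiffOn ℝ 1 G (Ioo (-(2 * Real.sqrt ε)) (2 * Real.sqrt ε))) →
        (∀ x ∈ Ioo (-(2 * Real.sqrt ε)) (2 * Real.sqrt ε),
          |Fp x| ≤ B ∧ |derivWithin Fp (Ioo (-(2 * Real.sqrt ε)) (2 * Real.sqrt ε)) x| ≤ B ∧
          |Fm x| ≤ B ∧ |derivWithin Fm (Ioo (-(2 * Real.sqrt ε)) (2 * Real.sqrt ε)) x| ≤ B ∧
          |G x| ≤ B ∧ |derivWithin G (Ioo (-(2 * Real.sqrt ε)) (2 * Real.sqrt ε)) x| ≤ B ∧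
          |ωp x| ≤ B ∧ |ωm x| ≤ B) →
        (∀ φ : ℝ → ℝ, InC2 δ ε φ →
          |∫ α : ℝ, Ep α * Hstar ψ ε f g φ α| ≤ B * ε * Real.log (1 / ε) ∧
          |∫ α : ℝ, Em α * Hstar ψ ε f g φ α| ≤ B * ε * Real.log (1 / ε)) →
        (∀ φ : ℝ → ℝ, InC2 δ ε φ →
          tsupport φ ⊆ Ioo (-(Real.sqrt ε / 8)) (Real.sqrt ε / 8) →
          |∫ α : ℝ, E α * φ α| ≤ B * ε * Real.log (1 / ε)) →
        (∀ α ∈ Ioo (-(Real.sqrt ε)) (Real.sqrt ε),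
          Fp α = T1 ψ ε f ωp α - T3 ψ ε f g ωm α - (1/2) * ωp α + Ep α ∧
          Fm α = -T3 ψ ε g f ωp α + T1 ψ ε g ωm α + (1/2) * ωm α + Em α ∧
          G α = (T4 ψ ε g f ωp α - T2 ψ ε f ωp α) +
                (T4 ψ ε f g ωm α - T2 ψ ε g ωm α) + E α) →
        |G 0| ≤ C * ε * Real.log (1 / ε) := by
  obtain ⟨K₀, hK₀, hcut⟩ := Cut_mk hψ
  set K : ℝ := 32 * A + K₀ + 2 with hKd
  have hK : 1 ≤ K := by linarith
  have hAK : A ≤ K := by linarith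
  obtain ⟨cut, cψ, dψ⟩ := hcut K (by linarith) (by linarith)
  set κ : ℝ := (5000 * K)⁻¹ with hκd
  have hκ : 0 < κ := by positivity
  have hκ1 : κ * (5000 * K) = 1 := inv_mul_cancel₀ (by positivity)
  obtain ⟨C, hC, hcore⟩ := core hK hB hκ
  refine ⟨C, hC, ?_⟩
  intro ε hε f g hfg Fp Fm G ωp ωm Ep Em E hm _ hc1 hbd hZ hW hid
  obtain ⟨cf, cg, f0, g0, df0, dg0, hder, hlow⟩ := hfg
  have he := hε.1
  have hδ0 := hδ.1
  have hs : 0 < √ε := Real.sqrt_pos.2 he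
  have hsq : √ε ^ 2 = ε := Real.sq_sqrt he.le
  have hsd : √ε ≤ δ / 10 := by
    rw [Real.sqrt_le_left (by positivity)]; linarith [hε.2]
  have hs4 : 4 * √ε < δ := by linarith
  have hp : Par K ε (√ε) (Real.log (1 / ε)) := ⟨hK, hs, by linarith [hδ.2], hsq.symm, rfl⟩
  have bf : ∀ x ∈ Ioo (-δ) δ, ∀ i : ℕ, i ≤ 3 → |iteratedDerivWithin i f (Ioo (-δ) δ) x| ≤ A := fun x hx i hi => by
    linarith [hder x hx i hi, abs_nonneg (iteratedDerivWithin i g (Ioo (-δ) δ) x)]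
  have bg : ∀ x ∈ Ioo (-δ) δ, ∀ i : ℕ, i ≤ 3 → |iteratedDerivWithin i g (Ioo (-δ) δ) x| ≤ A := fun x hx i hi => by
    linarith [hder x hx i hi, abs_nonneg (iteratedDerivWithin i f (Ioo (-δ) δ) x)]
  have hA0 : 0 ≤ A := by linarith
  obtain ⟨_, _, ff⟩ := Fn_ind hA0 hs hs4 cf f0 df0 bf
  obtain ⟨_, _, gg⟩ := Fn_ind hA0 hs hs4 cg g0 dg0 bg
  obtain ⟨f1, f2, hf⟩ := Fn_ind (by linarith : 0 ≤ K) hs hs4 cf f0 df0 (fun x hx i hi => (bf x hx i hi).trans hAK)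
  obtain ⟨g1, g2, hg⟩ := Fn_ind (by linarith : 0 ≤ K) hs hs4 cg g0 dg0 (fun x hx i hi => (bg x hx i hi).trans hAK)
  have hpair : PairFG K ε (√ε) ((Ioo (-δ) δ).indicator f) ((Ioo (-δ) δ).indicator g) := by
    refine ⟨fun α β ha hb => ?_, fun α β ha hb => ?_⟩
    · rw [ind_eq (ha.trans hs4), ind_eq (hb.trans hs4)]
      linarith [hlow α (abs_lt.1 ha) β (abs_lt.1 hb)]
    · have q : ∀ x : ℝ, |x| < 4 * √ε → A * x ^ 2 ≤ A * (16 * ε) := fun x hx => by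
        have : |x| ^ 2 ≤ (4 * √ε) ^ 2 := pow_le_pow_left₀ (abs_nonneg x) hx.le 2
        rw [sq_abs, mul_pow, hsq] at this
        exact mul_le_mul_of_nonneg_left (by linarith) hA0
      have e1 := (le_abs_self _).trans (ff.abs_le hs ha)
      have e2 := (le_abs_self _).trans (gg.abs_le hs hb)
      have e3 := q α ha
      have e4 := q β hb
      have e5 : 0 ≤ K₀ * ε := by positivity
      rw [hKd]
      linarith
  obtain ⟨mFp, mFm, mG, mωp, mωm, -, -, -⟩ := hm
  obtain ⟨cFp, cFm, cG⟩ := hc1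
  have hmem : ∀ x, |x| < 2 * √ε → x ∈ Ioo (-(2 * √ε)) (2 * √ε) := fun x hx => abs_lt.1 hx
  have hmain := hcore ε (√ε) (Real.log (1 / ε)) ψ _ f1 f2 _ g1 g2 Fp Fm G ωp ωm Ep Em E hp cut hf hg hpair mFp mFm mG mωp mωm
    ?_ ?_ ?_ ?_ ?_
  · rwa [← mul_assoc] at hmain
  · intro x hx
    obtain ⟨h1, -, h2, -, h3, -, -, -⟩ := hbd x (hmem x (by linarith))
    exact ⟨h1, h2, h3, lip0 hs cFp (fun y hy => (hbd y hy).2.1) hx, lip0 hs cFm (fun y hy => (hbd y hy).2.2.2.1) hx,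
      lip0 hs cG (fun y hy => (hbd y hy).2.2.2.2.2.1) hx⟩
  · intro x hx
    exact (hbd x (hmem x hx)).2.2.2.2.2.2
  · intro c hc hc8
    have hphi := (phi_InC2 (κ := κ / 2) hp cut cψ dψ (by linarith : √ε < δ) hc hc8 hc hc8 (by positivity) (by linarith)).1
    have e : (fun α => κ / 2 * (ψ (α / (√ε / 128)) * (PK c α + PK c α))) = fun α => κ * (ψ (α / (√ε / 128)) * PK c α) := by
      funext α; ring
    rw [e] at hphi
    have := hZ _ hphi
    simp only [Hstar_ind cut hs hs4]
    rwa [← mul_assoc]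
  · obtain ⟨p1, p2⟩ := phi_InC2 (κ := κ) (a := 2 * ε) (b := 6 * ε) hp cut cψ dψ (by linarith : √ε < δ) (by linarith) (by linarith) (by linarith) (by linarith) hκ hκ1.le
    have := hW _ p1 p2
    rwa [← mul_assoc]
  · intro α ha
    rw [T1_ind cut hs hs4 ha, T1_ind cut hs hs4 ha, T2_ind cut hs hs4 ha, T2_ind cut hs hs4 ha, T3_ind cut hs hs4 ha, T3_ind cut hs hs4 ha,
      T4_ind cut hs hs4 ha, T4_ind cut hs hs4 ha]
    exact hid α (abs_lt.1 ha)
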